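/- arXiv:1109.2463 — 4 statements merged into one kernel-verified Lean document; each statement's English description precedes it below -/
import Mathlib

section
/- Let I = (L^i(v)) ⊆ S be an initial squarefree lexsegment ideal generated in degree q ≥ 2, determined by v = x_{j_1}···x_{j_q} with 2 ≤ j_1 < ... < j_q ≤ n. Then depth(S/I) = q - 1, and the Stanley–Reisner simplicial complex Δ with I = I_Δ is Cohen–Macaulay if and only if it is pure, which happens if and only if v = x_{n-q+1}···x_n. -/
open MvPolynomial

variable {k : Type*} [Field k]

/-- The squarefree monomial `x_F = ∏_{i ∈ F} x_i`. -/
noncomputable def sqMon (n : ℕ) (k : Type*) [Field k] (F : Finset (Fin n)) :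
    MvPolynomial (Fin n) k :=
  ∏ i ∈ F, X i

/-- `x_F >_lex x_G` for squarefree monomials: at the smallest index where the supports
differ, the index belongs to `F`. -/
def sqGtLex {n : ℕ} (F G : Finset (Fin n)) : Prop :=
  ∃ a, a ∈ F ∧ a ∉ G ∧ ∀ b, b < a → (b ∈ F ↔ b ∈ G)

/-- `x_F ≥_lex x_G` for squarefree monomials. -/
def sqGeLex {n : ℕ} (F G : Finset (Fin n)) : Prop :=
  F = G ∨ sqGtLex F G

/-- The squarefree lexsegment set `L(u,v)` of degree `q` (as a set of supports). -/
def sqLexSeg {n : ℕ} (q : ℕ) (u v : Finset (Fin n)) : Set (Finset (Fin n)) :=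
  {w | w.card = q ∧ sqGeLex u w ∧ sqGeLex w v}

/-- The initial squarefree lexsegment set `L^i(v)` of degree `q`. -/
def sqLexSegInit {n : ℕ} (q : ℕ) (v : Finset (Fin n)) : Set (Finset (Fin n)) :=
  {w | w.card = q ∧ sqGeLex w v}

/-- The final squarefree lexsegment set `L^f(u)` of degree `q`. -/
def sqLexSegFinal {n : ℕ} (q : ℕ) (u : Finset (Fin n)) : Set (Finset (Fin n)) :=
  {w | w.card = q ∧ sqGeLex u w}

/-- The squarefree monomial ideal generated by a set of supports. -/
noncomputable def sqIdeal (n : ℕ) (k : Type*) [Field k] (L : Set (Finset (Fin n))) :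
    Ideal (MvPolynomial (Fin n) k) :=
  Ideal.span ((fun F => sqMon n k F) '' L)

/-- The monomial prime ideal `P_G` generated by the variables indexed by `G`. -/
noncomputable def varIdeal (n : ℕ) (k : Type*) [Field k] (G : Finset (Fin n)) :
    Ideal (MvPolynomial (Fin n) k) :=
  Ideal.span ((fun i => (X i : MvPolynomial (Fin n) k)) '' (G : Set (Fin n)))

/-- The depth of `S/I`: the supremum of lengths of regular sequences on `S/I`
contained in the graded maximal ideal `(x_1, ..., x_n)`. -/
noncomputable def depthQ {n : ℕ} {k : Type*} [Field k]
    (I : Ideal (MvPolynomial (Fin n) k)) : ℕ :=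
  sSup {r | ∃ rs : List (MvPolynomial (Fin n) k), rs.length = r ∧
    (∀ x ∈ rs, x ∈ Ideal.span (Set.range (X : Fin n → MvPolynomial (Fin n) k))) ∧
    RingTheory.Sequence.IsRegular (MvPolynomial (Fin n) k ⧸ I) rs}

/-- A face of the Stanley–Reisner complex of the squarefree monomial ideal `I`. -/
def isFace {n : ℕ} (k : Type*) [Field k] (I : Ideal (MvPolynomial (Fin n) k))
    (F : Finset (Fin n)) : Prop :=
  sqMon n k F ∉ I

/-- A facet (maximal face) of the Stanley–Reisner complex of `I`. -/
def isFacet {n : ℕ} (k : Type*) [Field k] (I : Ideal (MvPolynomial (Fin n) k))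
    (F : Finset (Fin n)) : Prop :=
  isFace k I F ∧ ∀ G, F ⊂ G → ¬ isFace k I G
namespace Lexseg
open RingTheory.Sequence CategoryTheory Abelian Pointwise

/-- existence of a regular sequence of length `r` in the ideal `m`. -/
def DepthGE {R : Type*} [CommRing R] (m : Ideal R) (r : ℕ) (M : Type*) [AddCommGroup M]
    [Module R M] : Prop :=
  ∃ rs : List R, rs.length = r ∧ (∀ x ∈ rs, x ∈ m) ∧ IsRegular M rs

universe u

/-- The depth lemma for the middle term of a short exact sequence. -/
theorem DepthGE.middle {R : Type u} [CommRing R] [IsNoetherianRing R] (m : Ideal R) (r : ℕ)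
    {A B C : Type u} [AddCommGroup A] [AddCommGroup B] [AddCommGroup C]
    [Module R A] [Module R B] [Module R C]
    [Module.Finite R A] [Module.Finite R B] [Module.Finite R C]
    (f : A →ₗ[R] B) (g : B →ₗ[R] C) (hf : Function.Injective f) (hg : Function.Surjective g)
    (hfg : Function.Exact f g)
    (hA : m • (⊤ : Submodule R A) < ⊤) (hB : m • (⊤ : Submodule R B) < ⊤)
    (hC : m • (⊤ : Submodule R C) < ⊤)
    (dA : DepthGE m r A) (dC : DepthGE m r C) : DepthGE m r B := by
  have tA := ModuleCat.exists_isRegular_tfae m r (ModuleCat.of R A) hA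
  have tB := ModuleCat.exists_isRegular_tfae m r (ModuleCat.of R B) hB
  have tC := ModuleCat.exists_isRegular_tfae m r (ModuleCat.of R C) hC
  have eA := (tA.out 1 3).2 dA
  have eC := (tC.out 1 3).2 dC
  refine (tB.out 1 3).1 ?_
  intro i hi
  let T : ShortComplex (ModuleCat.{u} R) :=
    ShortComplex.mk (ModuleCat.ofHom f) (ModuleCat.ofHom g) (by
      ext x; simpa using hfg.apply_apply_eq_zero x)
  have hT : T.ShortExact :=
    { exact := (ShortComplex.ShortExact.moduleCat_exact_iff_function_exact T).2 hfg
      mono_f := (ModuleCat.mono_iff_injective _).2 hf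
      epi_g := (ModuleCat.epi_iff_surjective _).2 hg }
  have h1 : Subsingleton (Ext (ModuleCat.of R (Shrink.{u} (R ⧸ m))) T.X₁ i) := eA i hi
  have h3 : Subsingleton (Ext (ModuleCat.of R (Shrink.{u} (R ⧸ m))) T.X₃ i) := eC i hi
  change Subsingleton (Ext (ModuleCat.of R (Shrink.{u} (R ⧸ m))) T.X₂ i)
  refine subsingleton_of_forall_eq 0 fun x => ?_
  obtain ⟨y, hy⟩ := Ext.covariant_sequence_exact₂ _ hT x (Subsingleton.elim _ _)
  rw [← hy, Subsingleton.elim y 0, Ext.zero_comp]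

/-- In a Noetherian local ring, the length of a weakly regular sequence is at most
the dimension of any associated prime. -/
theorem length_le_coheight {R : Type*} [CommRing R] [IsNoetherianRing R] [IsLocalRing R]
    (rs : List R) : ∀ {M : Type*} [AddCommGroup M] [Module R M] [Module.Finite R M]
    (_ : ∀ x ∈ rs, x ∈ IsLocalRing.maximalIdeal R) (_ : IsWeaklyRegular M rs)
    (P : PrimeSpectrum R) (_ : IsAssociatedPrime P.asIdeal M),
    (rs.length : ℕ∞) ≤ Order.coheight P := by
  induction rs with
  | nil => intros; simp
  | cons x rs ih =>
    intro M _ _ _ hm hreg P hP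
    rw [isWeaklyRegular_cons_iff] at hreg
    obtain ⟨hx, hrs⟩ := hreg
    obtain ⟨hPp, z, hz⟩ := isAssociatedPrime_iff.1 hP
    have hz0 : z ≠ 0 := by
      rintro rfl
      apply hPp.ne_top
      rw [hz]; ext; simp
    let N : Submodule R M := Submodule.torsionBySet R M P.asIdeal
    have hzN : z ∈ N := by
      rw [Submodule.mem_torsionBySet_iff]
      rintro ⟨a, ha⟩
      rw [SetLike.mem_coe, hz, Submodule.mem_colon_singleton] at ha
      simpa using ha
    have key : ∃ w ∈ N, w ∉ x • (⊤ : Submodule R M) := by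
      by_contra! hcon
      have hN : N ≤ (Ideal.span {x}) • N := by
        intro w hw
        obtain ⟨w', -, rfl⟩ := (Submodule.mem_smul_pointwise_iff_exists _ _ _).1 (hcon w hw)
        refine Submodule.smul_mem_smul (Ideal.mem_span_singleton_self x) ?_
        rw [Submodule.mem_torsionBySet_iff] at hw ⊢
        intro a
        apply hx
        have := hw a
        simp only [smul_zero]
        rw [smul_comm]; exact this
      have := Submodule.eq_bot_of_le_smul_of_le_jacobson_bot (Ideal.span {x}) N
        (IsNoetherian.noetherian N) hN (by
          rw [IsLocalRing.jacobson_eq_maximalIdeal _ bot_ne_top, Ideal.span_singleton_le_iff_mem]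
          exact hm x (by simp))
      rw [this] at hzN
      exact hz0 (by simpa using hzN)
    obtain ⟨w, hwN, hw⟩ := key
    let w' : QuotSMulTop x M := Submodule.Quotient.mk w
    have hw' : w' ≠ 0 := by
      intro h
      exact hw ((Submodule.Quotient.mk_eq_zero _).1 h)
    obtain ⟨Q, hQ, hle⟩ := exists_le_isAssociatedPrime_of_isNoetherianRing R w' hw'
    have hPQ : P.asIdeal ≤ Q := by
      intro a ha
      apply hle
      rw [Submodule.mem_colon_singleton]
      rw [Submodule.mem_torsionBySet_iff] at hwN
      have := hwN ⟨a, ha⟩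
      change a • (Submodule.Quotient.mk w : QuotSMulTop x M) ∈ _
      rw [← Submodule.Quotient.mk_smul]
      rw [show a • w = 0 from this]
      simp
    have hxQ : x ∈ Q := by
      apply hle
      rw [Submodule.mem_colon_singleton]
      change x • (Submodule.Quotient.mk w : QuotSMulTop x M) ∈ _
      rw [← Submodule.Quotient.mk_smul, Submodule.mem_bot, Submodule.Quotient.mk_eq_zero]
      exact Submodule.smul_mem_pointwise_smul _ _ _ trivial
    have hxP : x ∉ P.asIdeal := by
      intro h
      rw [hz, Submodule.mem_colon_singleton, Submodule.mem_bot] at h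
      exact hz0 (hx (by simpa using h))
    have := ih (M := QuotSMulTop x M) (fun y hy => hm y (by simp [hy])) hrs ⟨Q, hQ.isPrime⟩ hQ
    refine le_trans ?_ (Order.coheight_add_one_le (b := P) (a := ⟨Q, hQ.isPrime⟩) ?_)
    · simpa using this
    · refine lt_of_le_of_ne hPQ ?_
      rintro rfl
      exact hxP hxQ

theorem length_le_coheight' {R : Type*} [CommRing R] [IsNoetherianRing R]
    (m : Ideal R) [m.IsPrime]
    (rs : List R) {M : Type*} [AddCommGroup M] [Module R M] [Module.Finite R M]
    (hm : ∀ x ∈ rs, x ∈ m) (hreg : IsWeaklyRegular M rs)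
    (P : PrimeSpectrum R) (hPm : P.asIdeal ≤ m) (hP : IsAssociatedPrime P.asIdeal M) :
    (rs.length : ℕ∞) ≤ Order.coheight P := by
  let R' := Localization.AtPrime m
  let M' := LocalizedModule m.primeCompl M
  have h1 := IsWeaklyRegular.of_isLocalizedModule R' m.primeCompl
    (LocalizedModule.mkLinearMap m.primeCompl M) hreg
  have hdisj : Disjoint (m.primeCompl : Set R) P.asIdeal := by
    rw [Set.disjoint_left]
    intro a ha hb
    exact ha (hPm hb)
  have hcomap := IsLocalization.under_map_of_isPrime_disjoint m.primeCompl R' P.2 hdisj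
  have hprime := IsLocalization.isPrime_of_isPrime_disjoint m.primeCompl R' P.asIdeal P.2 hdisj
  have h2 : P.asIdeal.map (algebraMap R R') ∈ associatedPrimes R' M' := by
    apply Module.associatedPrimes.mem_associatedPrimes_of_comap_mem_associatedPrimes_of_isLocalizedModule
      m.primeCompl (LocalizedModule.mkLinearMap m.primeCompl M)
    change Ideal.under _ _ ∈ _
    rw [hcomap]; exact hP
  have h3 := length_le_coheight (R := R') (rs.map (algebraMap R R')) (M := M') (by
    intro x hx
    obtain ⟨y, hy, rfl⟩ := List.mem_map.1 hx
    exact (IsLocalization.AtPrime.to_map_mem_maximal_iff R' m y).2 (hm y hy)) h1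
      ⟨P.asIdeal.map (algebraMap R R'), hprime⟩ h2
  rw [List.length_map] at h3
  refine h3.trans ?_
  have hmono : StrictMono (PrimeSpectrum.comap (algebraMap R R')) := by
    refine Monotone.strictMono_of_injective ?_
      (PrimeSpectrum.localization_comap_injective R' m.primeCompl)
    intro a b hab
    exact Ideal.comap_mono hab
  refine (Order.coheight_le_coheight_apply_of_strictMono _ hmono _).trans (le_of_eq ?_)
  congr 1
  ext1
  exact hcomap
variable {n : ℕ}

/-- The irrelevant ideal. -/
noncomputable abbrev mIdeal (n : ℕ) (k : Type*) [Field k] : Ideal (MvPolynomial (Fin n) k) :=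
  Ideal.span (Set.range (X : Fin n → MvPolynomial (Fin n) k))

theorem mem_mIdeal_iff (p : MvPolynomial (Fin n) k) : p ∈ mIdeal n k ↔ coeff 0 p = 0 := by
  rw [mIdeal, ← Set.image_univ, mem_ideal_span_X_image]
  constructor
  · intro h
    by_contra h0
    obtain ⟨i, -, hi⟩ := h 0 (mem_support_iff.2 h0)
    simp at hi
  · intro h s hs
    by_contra! hcon
    have : s = 0 := by ext i; simpa using hcon i
    subst this
    exact (mem_support_iff.1 hs) h

theorem mIdeal_eq_ker : mIdeal n k = RingHom.ker (constantCoeff : MvPolynomial (Fin n) k →+* k) := by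
  ext p
  rw [mem_mIdeal_iff, RingHom.mem_ker, constantCoeff_eq]

instance : (mIdeal n k).IsPrime := by
  rw [mIdeal_eq_ker]; exact RingHom.ker_isPrime _

/-- Stanley–Reisner ideal of a simplicial complex. -/
noncomputable def srI (k : Type*) [Field k] (Δ : LowerSet (Finset (Fin n))) : Ideal (MvPolynomial (Fin n) k) where
  carrier := {p | ∀ s ∈ p.support, s.support ∉ Δ}
  zero_mem' := by simp
  add_mem' := by
    intro a b ha hb s hs
    classical
    rcases Finset.mem_union.1 (support_add hs) with h | h
    · exact ha s h
    · exact hb s h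
  smul_mem' := by
    intro c p hp s hs
    classical
    rw [smul_eq_mul] at hs
    obtain ⟨a, -, b, hb, rfl⟩ := Finset.mem_add.1 (support_mul _ _ hs)
    intro hmem
    refine hp b hb (Δ.lower ?_ hmem)
    intro i hi
    simp only [Finsupp.mem_support_iff, Finsupp.add_apply] at hi ⊢
    omega

theorem mem_srI (Δ : LowerSet (Finset (Fin n))) (p : MvPolynomial (Fin n) k) :
    p ∈ srI k Δ ↔ ∀ s ∈ p.support, s.support ∉ Δ := Iff.rfl

/-- closed star of a vertex -/
def star (Δ : LowerSet (Finset (Fin n))) (v : Fin n) : LowerSet (Finset (Fin n)) :=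
  ⟨{G | insert v G ∈ Δ}, fun _ _ h hG => Δ.lower (Finset.insert_subset_insert v h) hG⟩

/-- deletion of a vertex -/
def del (Δ : LowerSet (Finset (Fin n))) (v : Fin n) : LowerSet (Finset (Fin n)) :=
  ⟨{G | v ∉ G ∧ G ∈ Δ}, fun _ _ h hG => ⟨fun hv => hG.1 (h hv), Δ.lower h hG.2⟩⟩

theorem mem_star (Δ : LowerSet (Finset (Fin n))) (v : Fin n) (G) :
    G ∈ star Δ v ↔ insert v G ∈ Δ := Iff.rfl

theorem mem_del (Δ : LowerSet (Finset (Fin n))) (v : Fin n) (G) :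
    G ∈ del Δ v ↔ v ∉ G ∧ G ∈ Δ := Iff.rfl

theorem star_star (Δ : LowerSet (Finset (Fin n))) (v : Fin n) : star (star Δ v) v = star Δ v := by
  ext G
  simp only [SetLike.mem_coe, mem_star, Finset.insert_idem]

theorem mul_X_mem (Δ : LowerSet (Finset (Fin n))) (v : Fin n) (p : MvPolynomial (Fin n) k) :
    p * X v ∈ srI k Δ ↔ p ∈ srI k (star Δ v) := by
  have hs : ∀ s : Fin n →₀ ℕ, (s + Finsupp.single v 1).support = insert v s.support := by
    intro s
    ext i
    by_cases hi : i = v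
    · subst hi; simp
    · simp [hi]
  rw [mem_srI, mem_srI, support_mul_X]
  simp only [Finset.mem_map, addRightEmbedding_apply, forall_exists_index, and_imp,
    forall_apply_eq_imp_iff₂, hs, mem_star]

theorem mem_srI_del (Δ : LowerSet (Finset (Fin n))) (v : Fin n) (p : MvPolynomial (Fin n) k) :
    p ∈ srI k (del Δ v) ↔ ∃ r, p - r * X v ∈ srI k Δ := by
  constructor
  · intro hp
    refine ⟨p.divMonomial (Finsupp.single v 1), ?_⟩
    have h : p - p.divMonomial (Finsupp.single v 1) * X v
        = p.modMonomial (Finsupp.single v 1) := by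
      rw [mul_comm]
      exact sub_eq_of_eq_add' (divMonomial_add_modMonomial_single p v).symm
    rw [h]
    intro s hs hmem
    have hs' := mem_support_iff.1 hs
    by_cases hle : Finsupp.single v 1 ≤ s
    · exact hs' (coeff_modMonomial_of_le p hle)
    · rw [coeff_modMonomial_of_not_le p hle] at hs'
      refine hp s (mem_support_iff.2 hs') ((mem_del _ _ _).2 ⟨?_, hmem⟩)
      intro hv
      apply hle
      rw [Finsupp.single_le_iff]
      have := Finsupp.mem_support_iff.1 hv
      omega
  · rintro ⟨r, hr⟩
    have h1 : p - r * X v ∈ srI k (del Δ v) := fun s hs h => hr s hs h.2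
    have h2 : r * X v ∈ srI k (del Δ v) := by
      rw [mul_X_mem]
      intro s _ h
      exact ((mem_del _ _ _).1 ((mem_star _ _ _).1 h)).1 (Finset.mem_insert_self _ _)
    simpa using Ideal.add_mem _ h1 h2

theorem srI_le_mIdeal (Δ : LowerSet (Finset (Fin n))) (h : ∅ ∈ Δ) : srI k Δ ≤ mIdeal n k := by
  intro p hp
  rw [mem_mIdeal_iff]
  by_contra h0
  exact hp 0 (mem_support_iff.2 h0) (by simpa using h)

theorem smul_top_lt (I : Ideal (MvPolynomial (Fin n) k)) (h : I ≤ mIdeal n k) :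
    mIdeal n k • (⊤ : Submodule (MvPolynomial (Fin n) k) (MvPolynomial (Fin n) k ⧸ I)) < ⊤ := by
  rw [lt_top_iff_ne_top]
  intro hcon
  have h1 : mIdeal n k • (⊤ : Submodule (MvPolynomial (Fin n) k) (MvPolynomial (Fin n) k ⧸ I))
      = Submodule.map (Submodule.mkQ I) (mIdeal n k) := by
    rw [← LinearMap.range_eq_top.2 (Submodule.mkQ_surjective I), ← Submodule.map_top,
      ← Submodule.map_smul'']
    congr 1
    simp
  rw [h1] at hcon
  have h2 : (Submodule.mkQ I) 1 ∈ Submodule.map (Submodule.mkQ I) (mIdeal n k) := by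
    rw [hcon]; trivial
  obtain ⟨a, ha, hab⟩ := h2
  have h3 : a - 1 ∈ I := (Submodule.Quotient.eq I).1 hab
  have h4 : (1 : MvPolynomial (Fin n) k) ∈ mIdeal n k := by
    have := Ideal.sub_mem _ ha (h h3)
    simpa using this
  rw [mem_mIdeal_iff] at h4
  simp at h4

theorem nontrivial_quot (I : Ideal (MvPolynomial (Fin n) k)) (h : I ≤ mIdeal n k) :
    Nontrivial (MvPolynomial (Fin n) k ⧸ I) := by
  apply Ideal.Quotient.nontrivial_iff.2
  rintro rfl
  exact (inferInstance : (mIdeal n k).IsPrime).ne_top (top_le_iff.1 h)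

/-- killing a variable in a quotient ring -/
theorem exists_quotEquiv {R : Type*} [CommRing R] (I J : Ideal R) (x : R)
    (h : ∀ p, p ∈ J ↔ ∃ r, p - r * x ∈ I) :
    Nonempty (QuotSMulTop x (R ⧸ I) ≃ₗ[R] (R ⧸ J)) := by
  have hIJ : I ≤ J := fun p hp => (h p).2 ⟨0, by simpa using hp⟩
  let g : (R ⧸ I) →ₗ[R] (R ⧸ J) := Submodule.mapQ I J LinearMap.id hIJ
  have hg : Function.Surjective g := by
    intro y
    obtain ⟨p, rfl⟩ := Submodule.Quotient.mk_surjective _ y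
    exact ⟨Submodule.Quotient.mk p, rfl⟩
  have hker : LinearMap.ker g = x • (⊤ : Submodule R (R ⧸ I)) := by
    ext y
    obtain ⟨p, rfl⟩ := Submodule.Quotient.mk_surjective _ y
    rw [LinearMap.mem_ker, Submodule.mem_smul_pointwise_iff_exists]
    change (Submodule.Quotient.mk p : R ⧸ J) = 0 ↔ _
    rw [Submodule.Quotient.mk_eq_zero, h]
    constructor
    · rintro ⟨r, hr⟩
      refine ⟨Submodule.Quotient.mk r, trivial, ?_⟩
      rw [← Submodule.Quotient.mk_smul]
      refine ((Submodule.Quotient.eq I).2 ?_).symm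
      rwa [smul_eq_mul, mul_comm]
    · rintro ⟨z, -, hz⟩
      obtain ⟨r, rfl⟩ := Submodule.Quotient.mk_surjective _ z
      rw [← Submodule.Quotient.mk_smul] at hz
      refine ⟨r, ?_⟩
      have := (Submodule.Quotient.eq I).1 hz.symm
      rwa [smul_eq_mul, mul_comm] at this
  exact ⟨(Submodule.quotEquivOfEq _ _ hker.symm).trans (g.quotKerEquivOfSurjective hg)⟩

/-- A squarefree monomial ideal whose complex contains all sets of size `≤ d` on its vertex
set `W`, `d ≤ |W|`, has depth at least `d`. -/
theorem depth_claim : ∀ (w : ℕ) (W : Finset (Fin n)) (_ : W.card = w) (d : ℕ) (_ : d ≤ w)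
    (Δ : LowerSet (Finset (Fin n))) (_ : ∀ G ⊆ W, G.card ≤ d → G ∈ Δ) (_ : ∀ G ∈ Δ, G ⊆ W),
    DepthGE (mIdeal n k) d (MvPolynomial (Fin n) k ⧸ srI k Δ) := by
  have zero : ∀ (Δ : LowerSet (Finset (Fin n))), ∅ ∈ Δ →
      DepthGE (mIdeal n k) 0 (MvPolynomial (Fin n) k ⧸ srI k Δ) := by
    intro Δ hΔ
    have := nontrivial_quot _ (srI_le_mIdeal (k := k) Δ hΔ)
    exact ⟨[], rfl, by simp, IsRegular.nil _ _⟩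
  intro w
  induction w with
  | zero =>
    intro W hW d hd Δ h1 h2
    obtain rfl : d = 0 := by omega
    exact zero Δ (h1 _ (Finset.empty_subset _) (by simp))
  | succ w ih =>
    intro W hW d hd Δ h1 h2
    have h0 : ∅ ∈ Δ := h1 _ (Finset.empty_subset _) (by simp)
    obtain _ | d := d
    · exact zero Δ h0
    obtain ⟨v, hv⟩ : W.Nonempty := Finset.card_pos.1 (by omega)
    have hWe : (W.erase v).card = w := by rw [Finset.card_erase_of_mem hv]; omega
    have hstar0 : ∅ ∈ star Δ v := by
      rw [mem_star]
      exact h1 _ (by simpa using hv) (by simp)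
    have dlink : DepthGE (mIdeal n k) d (MvPolynomial (Fin n) k ⧸ srI k (del (star Δ v) v)) := by
      refine ih (W.erase v) hWe d (by omega) _ ?_ ?_
      · intro G hG hc
        have hvG : v ∉ G := fun h => by simpa using hG h
        refine (mem_del _ _ _).2 ⟨hvG, (mem_star _ _ _).2 (h1 _ ?_ ?_)⟩
        · exact Finset.insert_subset hv (hG.trans (Finset.erase_subset _ _))
        · rw [Finset.card_insert_of_notMem hvG]; omega
      · intro G hG
        obtain ⟨hvG, hG'⟩ := (mem_del _ _ _).1 hG
        have := h2 _ ((mem_star _ _ _).1 hG')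
        exact Finset.subset_erase.2 ⟨(Finset.subset_insert _ _).trans this, hvG⟩
    have dstar : DepthGE (mIdeal n k) (d + 1) (MvPolynomial (Fin n) k ⧸ srI k (star Δ v)) := by
      obtain ⟨rs, hl, hm, hr⟩ := dlink
      obtain ⟨e⟩ := exists_quotEquiv (srI k (star Δ v)) (srI k (del (star Δ v) v)) (X v)
        (fun p => mem_srI_del _ _ p)
      refine ⟨X v :: rs, by simp [hl], ?_, IsRegular.cons ?_ ((e.isRegular_congr rs).2 hr)⟩
      · intro x hx
        rcases List.mem_cons.1 hx with rfl | hx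
        · exact Ideal.subset_span ⟨v, rfl⟩
        · exact hm x hx
      · rw [isSMulRegular_iff_right_eq_zero_of_smul]
        intro y hy
        obtain ⟨p, rfl⟩ := Submodule.Quotient.mk_surjective _ y
        rw [← Submodule.Quotient.mk_smul, Submodule.Quotient.mk_eq_zero, smul_eq_mul, mul_comm,
          mul_X_mem, star_star] at hy
        exact (Submodule.Quotient.mk_eq_zero _).2 hy
    by_cases hdw : d + 1 ≤ w
    · have ddel : DepthGE (mIdeal n k) (d + 1) (MvPolynomial (Fin n) k ⧸ srI k (del Δ v)) := by
        refine ih (W.erase v) hWe (d + 1) hdw _ ?_ ?_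
        · intro G hG hc
          have hvG : v ∉ G := fun h => by simpa using hG h
          exact (mem_del _ _ _).2 ⟨hvG, h1 _ (hG.trans (Finset.erase_subset _ _)) hc⟩
        · intro G hG
          obtain ⟨hvG, hG'⟩ := (mem_del _ _ _).1 hG
          exact Finset.subset_erase.2 ⟨h2 _ hG', hvG⟩
      let f : (MvPolynomial (Fin n) k ⧸ srI k (star Δ v)) →ₗ[MvPolynomial (Fin n) k]
          (MvPolynomial (Fin n) k ⧸ srI k Δ) :=
        Submodule.mapQ _ _ (LinearMap.mulRight _ (X v)) (fun p hp => (mul_X_mem Δ v p).2 hp)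
      let g : (MvPolynomial (Fin n) k ⧸ srI k Δ) →ₗ[MvPolynomial (Fin n) k]
          (MvPolynomial (Fin n) k ⧸ srI k (del Δ v)) :=
        Submodule.mapQ _ _ LinearMap.id (fun p hp => (mem_srI_del Δ v p).2 ⟨0, by simpa using hp⟩)
      refine DepthGE.middle (mIdeal n k) (d + 1) f g ?_ ?_ ?_
        (smul_top_lt _ (srI_le_mIdeal _ hstar0)) (smul_top_lt _ (srI_le_mIdeal _ h0))
        (smul_top_lt _ (srI_le_mIdeal _ ((mem_del _ _ _).2 ⟨by simp, h0⟩))) dstar ddel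
      · rw [injective_iff_map_eq_zero]
        intro y hy
        obtain ⟨p, rfl⟩ := Submodule.Quotient.mk_surjective _ y
        change (Submodule.Quotient.mk (p * X v) : MvPolynomial (Fin n) k ⧸ srI k Δ) = 0 at hy
        rw [Submodule.Quotient.mk_eq_zero, mul_X_mem] at hy
        exact (Submodule.Quotient.mk_eq_zero _).2 hy
      · intro y
        obtain ⟨p, rfl⟩ := Submodule.Quotient.mk_surjective _ y
        exact ⟨Submodule.Quotient.mk p, rfl⟩
      · intro y
        obtain ⟨p, rfl⟩ := Submodule.Quotient.mk_surjective _ y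
        change (Submodule.Quotient.mk p : MvPolynomial (Fin n) k ⧸ srI k (del Δ v)) = 0 ↔ _
        rw [Submodule.Quotient.mk_eq_zero, mem_srI_del]
        constructor
        · rintro ⟨r, hr⟩
          exact ⟨Submodule.Quotient.mk r, ((Submodule.Quotient.eq _).2 hr).symm⟩
        · rintro ⟨z, hz⟩
          obtain ⟨r, rfl⟩ := Submodule.Quotient.mk_surjective _ z
          exact ⟨r, (Submodule.Quotient.eq _).1 hz.symm⟩
    · have hd' : d = w := by omega
      have : star Δ v = Δ := by
        ext G
        simp only [SetLike.mem_coe, mem_star]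
        constructor
        · intro h; exact Δ.lower (Finset.subset_insert _ _) h
        · intro h
          have hsub : insert v G ⊆ W := Finset.insert_subset hv (h2 _ h)
          exact h1 _ hsub ((Finset.card_le_card hsub).trans (by omega))
      rwa [this] at dstar
/-- the complex of sets containing no member of `L` -/
def cplx (L : Set (Finset (Fin n))) : LowerSet (Finset (Fin n)) :=
  ⟨{G | ∀ w ∈ L, ¬ w ⊆ G}, fun _ _ h hG w hw hc => hG w hw (hc.trans h)⟩

theorem mem_cplx (L : Set (Finset (Fin n))) (G) : G ∈ cplx L ↔ ∀ w ∈ L, ¬ w ⊆ G := Iff.rfl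

/-- exponent vector of a squarefree monomial -/
noncomputable def expo (F : Finset (Fin n)) : Fin n →₀ ℕ := ∑ i ∈ F, Finsupp.single i 1

theorem expo_apply (F : Finset (Fin n)) (i : Fin n) : expo F i = if i ∈ F then 1 else 0 := by
  simp [expo, Finsupp.finsetSum_apply, Finsupp.single_apply]

theorem expo_support (F : Finset (Fin n)) : (expo F).support = F := by
  ext i; simp [expo_apply]

theorem sqMon_eq (F : Finset (Fin n)) : sqMon n k F = monomial (expo F) 1 := by
  rw [expo, monomial_sum_one]; rfl

theorem expo_le_iff (F : Finset (Fin n)) (s : Fin n →₀ ℕ) : expo F ≤ s ↔ F ⊆ s.support := by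
  constructor
  · intro h i hi
    have := h i
    rw [expo_apply, if_pos hi] at this
    rw [Finsupp.mem_support_iff]; omega
  · intro h i
    rw [expo_apply]
    split_ifs with hi
    · have := Finsupp.mem_support_iff.1 (h hi); omega
    · exact Nat.zero_le _

theorem sqIdeal_eq (L : Set (Finset (Fin n))) : sqIdeal n k L = srI k (cplx L) := by
  ext p
  have : (fun F => sqMon n k F) '' L = (fun s => monomial s (1 : k)) '' (expo '' L) := by
    rw [Set.image_image]; simp only [sqMon_eq]
  rw [sqIdeal, this, mem_ideal_span_monomial_image, mem_srI]
  refine forall₂_congr fun s _ => ?_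
  simp only [Set.exists_mem_image, expo_le_iff, mem_cplx]
  push Not
  rfl

theorem isFace_iff (Δ : LowerSet (Finset (Fin n))) (F : Finset (Fin n)) :
    isFace k (srI k Δ) F ↔ F ∈ Δ := by
  classical
  rw [isFace, sqMon_eq, mem_srI, support_monomial]
  simp [expo_support]

/-- monomial prime attached to `F` -/
noncomputable abbrev PF (k : Type*) [Field k] (F : Finset (Fin n)) :
    Ideal (MvPolynomial (Fin n) k) := srI k (LowerSet.Iic F)

/-- kill the variables outside `F` -/
noncomputable abbrev kill (k : Type*) [Field k] (F : Finset (Fin n)) :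
    MvPolynomial (Fin n) k →+* MvPolynomial {i // i ∈ F} k :=
  (killCompl (R := k) (f := (Subtype.val : {i // i ∈ F} → Fin n)) Subtype.val_injective).toRingHom

theorem kill_surj (F : Finset (Fin n)) : Function.Surjective (kill k F) := fun p =>
  ⟨rename Subtype.val p, killCompl_rename_app _ p⟩

theorem PF_eq_ker (F : Finset (Fin n)) : PF k F = RingHom.ker (kill k F) := by
  ext p
  rw [RingHom.mem_ker, mem_srI]
  constructor
  · intro h
    ext t
    change coeff t (killCompl (R := k) Subtype.val_injective p) = _
    rw [coeff_killCompl, coeff_zero]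
    by_contra h0
    refine h _ (mem_support_iff.2 h0) ?_
    rw [LowerSet.mem_Iic_iff]
    intro i hi
    obtain ⟨a, -, rfl⟩ := Finset.mem_image.1 (Finsupp.mapDomain_support hi)
    exact a.2
  · intro h s hs hF
    rw [LowerSet.mem_Iic_iff] at hF
    have hs' : (s.support : Set (Fin n)) ⊆ Set.range (Subtype.val : {i // i ∈ F} → Fin n) := by
      intro i hi; exact ⟨⟨i, hF hi⟩, rfl⟩
    have h1 := s.mapDomain_comapDomain Subtype.val Subtype.val_injective hs'
    have h2 : coeff (s.comapDomain Subtype.val Subtype.val_injective.injOn) (kill k F p) = 0 := by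
      rw [h, coeff_zero]
    change coeff _ (killCompl (R := k) Subtype.val_injective p) = _ at h2
    rw [coeff_killCompl, h1] at h2
    exact mem_support_iff.1 hs h2

instance (F : Finset (Fin n)) : (PF k F).IsPrime := by
  rw [PF_eq_ker]; exact RingHom.ker_isPrime _

theorem dim_kill (F : Finset (Fin n)) :
    ringKrullDim (MvPolynomial {i // i ∈ F} k) = (F.card : WithBot ℕ∞) := by
  rw [MvPolynomial.ringKrullDim_of_isNoetherianRing, ringKrullDim_eq_zero_of_field]
  simp

theorem dim_PF (F : Finset (Fin n)) :
    ringKrullDim (MvPolynomial (Fin n) k ⧸ PF k F) = (F.card : WithBot ℕ∞) := by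
  rw [← dim_kill (k := k), PF_eq_ker]
  exact ringKrullDim_eq_of_ringEquiv (RingHom.quotientKerEquivOfSurjective (kill_surj F))

theorem coheight_le_dim {R : Type*} [CommRing R] (P : Ideal R) (Q : PrimeSpectrum R)
    (h : P ≤ Q.asIdeal) : (Order.coheight Q : WithBot ℕ∞) ≤ ringKrullDim (R ⧸ P) := by
  rw [Order.coheight_eq_krullDim_Ici, ringKrullDim_quotient]
  refine Order.krullDim_le_of_strictMono
    (fun x : Set.Ici Q => (⟨x.1, ?_⟩ : PrimeSpectrum.zeroLocus (P : Set R))) ?_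
  · exact h.trans x.2
  · intro x y h; exact h

theorem coheight_le_card (F : Finset (Fin n)) (Q : PrimeSpectrum (MvPolynomial (Fin n) k))
    (h : PF k F ≤ Q.asIdeal) : Order.coheight Q ≤ F.card := by
  have := coheight_le_dim _ Q h
  rw [dim_PF] at this
  exact_mod_cast this

theorem dim_le_of {R : Type*} [CommRing R] (I : Ideal R) (d : ℕ) (hI : I ≠ ⊤)
    (h : ∀ Q : PrimeSpectrum R, I ≤ Q.asIdeal → Order.coheight Q ≤ d) :
    ringKrullDim (R ⧸ I) ≤ d := by
  have : Nontrivial (R ⧸ I) := Ideal.Quotient.nontrivial_iff.2 hI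
  rw [ringKrullDim, Order.krullDim_eq_iSup_coheight_of_nonempty]
  have key : (⨆ a : PrimeSpectrum (R ⧸ I), Order.coheight a) ≤ (d : ℕ∞) := by
    refine iSup_le fun Q => ?_
    refine le_trans (Order.coheight_le_coheight_apply_of_strictMono
      (PrimeSpectrum.comap (Ideal.Quotient.mk I)) ?_ Q) (h _ ?_)
    · apply Monotone.strictMono_of_injective
      · intro a b hab; exact Ideal.comap_mono hab
      · exact PrimeSpectrum.comap_injective_of_surjective _ Ideal.Quotient.mk_surjective
    · intro x hx
      change Ideal.Quotient.mk I x ∈ Q.asIdeal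
      rw [Ideal.Quotient.eq_zero_iff_mem.2 hx]
      exact Q.asIdeal.zero_mem
  exact_mod_cast key

theorem card_le_dim (Δ : LowerSet (Finset (Fin n))) (F : Finset (Fin n)) (hF : F ∈ Δ) :
    (F.card : WithBot ℕ∞) ≤ ringKrullDim (MvPolynomial (Fin n) k ⧸ srI k Δ) := by
  rw [← dim_PF (k := k)]
  have hle : srI k Δ ≤ PF k F := by
    intro p hp s hs hsF
    exact hp s hs (Δ.lower hsF hF)
  exact ringKrullDim_le_of_surjective (Ideal.Quotient.factor hle)
    (Ideal.Quotient.factor_surjective hle)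

theorem dim_le (Δ : LowerSet (Finset (Fin n))) (d : ℕ) (h0 : ∅ ∈ Δ)
    (h : ∀ F ∈ Δ, F.card ≤ d) :
    ringKrullDim (MvPolynomial (Fin n) k ⧸ srI k Δ) ≤ d := by
  classical
  refine dim_le_of _ d ?_ ?_
  · intro ht
    exact (inferInstance : (mIdeal n k).IsPrime).ne_top
      (top_le_iff.1 (ht ▸ srI_le_mIdeal (k := k) Δ h0))
  · intro Q hQ
    let F : Finset (Fin n) := Finset.univ.filter (fun i => (X i : MvPolynomial (Fin n) k) ∉ Q.asIdeal)
    have hF : F ∈ Δ := by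
      rw [← isFace_iff (k := k)]
      intro hmem
      have := hQ hmem
      rw [sqMon] at this
      obtain ⟨i, hi, hiQ⟩ := (Ideal.IsPrime.prod_mem_iff (hp := Q.2)).1 this
      exact (Finset.mem_filter.1 hi).2 hiQ
    refine (coheight_le_card F Q ?_).trans (by exact_mod_cast h F hF)
    have : PF k F ≤ Ideal.span ((X : Fin n → MvPolynomial (Fin n) k) '' {i | i ∉ F}) := by
      intro p hp
      rw [mem_ideal_span_X_image]
      intro s hs
      have := hp s hs
      rw [LowerSet.mem_Iic_iff] at this
      obtain ⟨i, hi, hiF⟩ := Finset.not_subset.1 this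
      exact ⟨i, hiF, Finsupp.mem_support_iff.1 hi⟩
    refine this.trans (Ideal.span_le.2 ?_)
    rintro _ ⟨i, hi, rfl⟩
    by_contra hcon
    exact hi (Finset.mem_filter.2 ⟨Finset.mem_univ _, hcon⟩)

/-- facets give associated primes -/
theorem assoc_facet (Δ : LowerSet (Finset (Fin n))) (F : Finset (Fin n)) (hF : F ∈ Δ)
    (hmax : ∀ G ∈ Δ, F ⊆ G → G = F) :
    IsAssociatedPrime (PF k F) (MvPolynomial (Fin n) k ⧸ srI k Δ) := by
  rw [isAssociatedPrime_iff]
  refine ⟨inferInstance, Submodule.Quotient.mk (sqMon n k F), ?_⟩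
  ext p
  rw [Submodule.mem_colon_singleton, ← Submodule.Quotient.mk_smul, Submodule.mem_bot,
    Submodule.Quotient.mk_eq_zero, smul_eq_mul, mem_srI, mem_srI, sqMon_eq]
  have hs : ∀ s : Fin n →₀ ℕ, (s + expo F).support = s.support ∪ F := by
    intro s
    ext i
    simp [expo_apply, imp_iff_not_or]
  have h2 : ∀ s : Fin n →₀ ℕ, s.support ∈ LowerSet.Iic F ↔ (s + expo F).support ∈ Δ := by
    intro s
    rw [hs, LowerSet.mem_Iic_iff]
    constructor
    · intro h
      rwa [Finset.union_eq_right.2 h]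
    · intro h
      have := hmax _ h Finset.subset_union_right
      exact Finset.union_eq_right.1 this
  constructor
  · intro h t ht
    rw [mem_support_iff, coeff_mul_monomial'] at ht
    split_ifs at ht with hle
    · have := h (t - expo F) (mem_support_iff.2 (by simpa using ht))
      rw [h2, tsub_add_cancel_of_le hle] at this
      exact this
    · exact absurd rfl ht
  · intro h s hs
    rw [h2]
    refine h _ ?_
    rw [mem_support_iff, coeff_mul_monomial]
    simpa using hs

theorem depth_eq (Δ : LowerSet (Finset (Fin n))) (d : ℕ) (hd : d ≤ n)
    (h : ∀ G : Finset (Fin n), G.card ≤ d → G ∈ Δ) (F : Finset (Fin n)) (hF : F ∈ Δ)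
    (hc : F.card = d) (hmax : ∀ G ∈ Δ, F ⊆ G → G = F) : depthQ (srI k Δ) = d := by
  apply IsGreatest.csSup_eq
  constructor
  · exact depth_claim n Finset.univ (by simp) d hd Δ (fun G _ => h G)
      (fun G _ => Finset.subset_univ _)
  · rintro r ⟨rs, rfl, hm, hr⟩
    have h1 := length_le_coheight' (mIdeal n k) rs hm hr.toIsWeaklyRegular ⟨PF k F, inferInstance⟩
      (srI_le_mIdeal _ (by rw [LowerSet.mem_Iic_iff]; exact Finset.empty_subset _))
      (assoc_facet Δ F hF hmax)
    have h2 := h1.trans (coheight_le_card F _ le_rfl)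
    rw [hc] at h2
    exact_mod_cast h2
theorem lex_last {q : ℕ} {l w : Finset (Fin n)} (hlm : ∀ i, i ∈ l ↔ n - q ≤ (i : ℕ))
    (hl : l.card = q) (hw : w.card = q) (a : Fin n) (ha : a ∈ l) (haw : a ∉ w)
    (h : ∀ b, b < a → (b ∈ w ↔ b ∈ l)) : False := by
  have hsub : w ⊆ l := by
    intro b hb
    by_contra hbl
    have h1 := (hlm a).1 ha
    have h2 : ¬ n - q ≤ (b : ℕ) := fun h => hbl ((hlm b).2 h)
    have : b < a := by rw [Fin.lt_def]; omega
    exact hbl ((h b this).1 hb)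
  have := Finset.eq_of_subset_of_card_le hsub (by omega)
  exact haw (this ▸ ha)

theorem ge_last {q : ℕ} {l w : Finset (Fin n)} (hlm : ∀ i, i ∈ l ↔ n - q ≤ (i : ℕ))
    (hl : l.card = q) (hw : w.card = q) : sqGeLex w l := by
  by_cases hwl : w = l
  · exact Or.inl hwl
  right
  have hne : (symmDiff w l).Nonempty := by
    rw [Finset.nonempty_iff_ne_empty]
    intro h
    exact hwl (symmDiff_eq_bot.1 h)
  let a := (symmDiff w l).min' hne
  have ha : a ∈ symmDiff w l := Finset.min'_mem _ _
  have hlt : ∀ b, b < a → (b ∈ w ↔ b ∈ l) := by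
    intro b hb
    by_contra hcon
    have : b ∈ symmDiff w l := by
      rw [Finset.mem_symmDiff]; tauto
    exact absurd (Finset.min'_le _ _ this) (not_le.2 hb)
  rcases Finset.mem_symmDiff.1 ha with ⟨h1, h2⟩ | ⟨h1, h2⟩
  · exact ⟨a, h1, h2, hlt⟩
  · exact (lex_last hlm hl hw a h1 h2 hlt).elim

theorem main (n q : ℕ) (hq : 2 ≤ q) (v : Finset (Fin n)) (hv : v.card = q)
    (hv1 : ∀ i ∈ v, 1 ≤ (i : ℕ)) (I : Ideal (MvPolynomial (Fin n) k))
    (hI : I = sqIdeal n k (sqLexSegInit q v)) :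
    depthQ I = q - 1 ∧
    (((depthQ I : ℕ) : WithBot (WithTop ℕ)) = ringKrullDim (MvPolynomial (Fin n) k ⧸ I)
      ↔ (∀ F G : Finset (Fin n), isFacet k I F → isFacet k I G → F.card = G.card)) ∧
    ((∀ F G : Finset (Fin n), isFacet k I F → isFacet k I G → F.card = G.card)
      ↔ v = Finset.univ.filter (fun i : Fin n => n - q ≤ (i : ℕ))) := by
  classical
  rw [sqIdeal_eq] at hI
  subst hI
  set Δ := cplx (sqLexSegInit q v) with hΔ
  have hne : 0 < n := by
    obtain ⟨i, -⟩ := Finset.card_pos.1 (show 0 < v.card by omega)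
    exact i.pos
  have hnq : q + 1 ≤ n := by
    have hsub : v ⊆ Finset.univ.erase ⟨0, hne⟩ := by
      intro i hi
      rw [Finset.mem_erase]
      refine ⟨?_, Finset.mem_univ _⟩
      rintro rfl
      simpa using hv1 _ hi
    have := Finset.card_le_card hsub
    rw [Finset.card_erase_of_mem (Finset.mem_univ _), hv, Finset.card_univ, Fintype.card_fin] at this
    omega
  set l : Finset (Fin n) := Finset.univ.filter (fun i : Fin n => n - q ≤ (i : ℕ)) with hl
  have hlm : ∀ i, i ∈ l ↔ n - q ≤ (i : ℕ) := by intro i; simp [hl]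
  have hlc : l.card = q := by
    have : l = Finset.Ici (⟨n - q, by omega⟩ : Fin n) := by
      ext i; simp [hl, Fin.le_def]
    rw [this, Fin.card_Ici]
    simp only
    omega
  let F0 : Finset (Fin n) := Finset.Iio (⟨q - 1, by omega⟩ : Fin n)
  have hF0c : F0.card = q - 1 := by simp [F0]
  have h0F : (⟨0, hne⟩ : Fin n) ∈ F0 := by
    simp only [F0, Finset.mem_Iio, Fin.lt_def]; omega
  have hsmall : ∀ G : Finset (Fin n), G.card ≤ q - 1 → G ∈ Δ := by
    intro G hG w hw hwG
    have := Finset.card_le_card hwG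
    have := hw.1
    omega
  have hmax : ∀ G ∈ Δ, F0 ⊆ G → G = F0 := by
    intro G hG hFG
    by_contra hne'
    have hlt : F0.card < G.card :=
      Finset.card_lt_card (hFG.ssubset_of_ne (Ne.symm hne'))
    obtain ⟨w, hFw, hwG, hwc⟩ := Finset.exists_subsuperset_card_eq hFG
      (show F0.card ≤ q by omega) (show q ≤ G.card by omega)
    refine hG w ⟨hwc, Or.inr ⟨⟨0, hne⟩, hFw h0F, ?_, ?_⟩⟩ hwG
    · intro h; simpa using hv1 _ h
    · intro b hb
      simp [Fin.lt_def] at hb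
  have hfacet : ∀ F, isFacet k (srI k Δ) F ↔ F ∈ Δ ∧ ∀ G, F ⊂ G → G ∉ Δ := by
    intro F
    simp only [isFacet, isFace_iff]
  have hF0 : isFacet k (srI k Δ) F0 := by
    rw [hfacet]
    refine ⟨hsmall _ hF0c.le, fun G hG hGΔ => ?_⟩
    exact hG.ne (hmax G hGΔ hG.subset).symm
  have hdepth : depthQ (srI k Δ) = q - 1 :=
    depth_eq Δ (q - 1) (by omega) hsmall F0 (hsmall _ hF0c.le) hF0c hmax
  -- the two cases
  have hlast : v ≠ l → l ∈ Δ := by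
    intro hvl w hw hwl
    obtain ⟨hwc, hge⟩ := hw
    have hwl' := Finset.eq_of_subset_of_card_le hwl (by omega)
    subst hwl'
    rcases hge with h | ⟨a, ha, hav, hb⟩
    · exact hvl h.symm
    · exact lex_last hlm hlc hv a ha hav (fun b hba => (hb b hba).symm)
  have hface : v = l → ∀ F ∈ Δ, F.card ≤ q - 1 := by
    intro hvl F hF
    by_contra hcon
    obtain ⟨w, hwF, hwc⟩ := Finset.exists_subset_card_eq (show q ≤ F.card by omega)
    exact hF w ⟨hwc, hvl ▸ ge_last hlm hlc hwc⟩ hwF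
  have hpure : (∀ F G : Finset (Fin n), isFacet k (srI k Δ) F → isFacet k (srI k Δ) G →
      F.card = G.card) ↔ v = l := by
    constructor
    · intro h
      by_contra hvl
      obtain ⟨G, hlG, hGm⟩ := (Set.toFinite {G | G ∈ Δ}).exists_le_maximal (hlast hvl)
      have hG : isFacet k (srI k Δ) G := by
        rw [hfacet]
        refine ⟨hGm.1, fun H hH hHΔ => ?_⟩
        exact hH.not_subset (hGm.2 hHΔ hH.subset)
      have h1 := h _ _ hF0 hG
      have h2 := Finset.card_le_card hlG
      omega
    · intro hvl
      have key : ∀ F, isFacet k (srI k Δ) F → F.card = q - 1 := by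
        intro F hF
        rw [hfacet] at hF
        have h1 := hface hvl F hF.1
        by_contra hcon
        obtain ⟨G, hFG, -, hGc⟩ := Finset.exists_subsuperset_card_eq (Finset.subset_univ F) h1
          (by rw [Finset.card_univ, Fintype.card_fin]; omega)
        refine hF.2 G (hFG.ssubset_of_ne ?_) (hsmall _ hGc.le)
        rintro rfl
        exact hcon hGc
      intro F G hF hG
      rw [key F hF, key G hG]
  have hdim : (((q - 1 : ℕ) : WithBot ℕ∞) =
      ringKrullDim (MvPolynomial (Fin n) k ⧸ srI k Δ)) ↔ v = l := by
    constructor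
    · intro h
      by_contra hvl
      have h1 := card_le_dim (k := k) Δ l (hlast hvl)
      rw [← h, hlc] at h1
      have : q ≤ q - 1 := by exact_mod_cast h1
      omega
    · intro hvl
      apply le_antisymm
      · have := card_le_dim (k := k) Δ F0 (hsmall _ hF0c.le)
        rwa [hF0c] at this
      · exact dim_le Δ (q - 1) (hsmall _ (by simp)) (hface hvl)
  refine ⟨hdepth, ?_, hpure⟩
  rw [hdepth, hpure]
  exact hdim

end Lexseg
/-- for the initial squarefree lexsegment ideal `I = (L^i(v))` generated in
degree `q ≥ 2`, determined by `v = x_{j_1} ⋯ x_{j_q}` with `2 ≤ j_1 < ... < j_q ≤ n`: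
`depth(S/I) = q - 1`; the Stanley–Reisner complex `Δ` of `I` is Cohen–Macaulay iff it
is pure, and it is pure iff `v = x_{n-q+1} ⋯ x_n`.  (Variables are 0-indexed; purity
means all facets have the same cardinality; Cohen–Macaulayness of `Δ` means
`depth(S/I) = dim(S/I)`.) -/
theorem stmt12 {k : Type*} [Field k] (n q : ℕ) (hq : 2 ≤ q) (j : Fin q → Fin n)
    (hmono : StrictMono j)
    (hj1 : 1 ≤ ((j ⟨0, by omega⟩ : Fin n) : ℕ)) :
    depthQ (sqIdeal n k (sqLexSegInit q (Finset.image j Finset.univ))) = q - 1 ∧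
    (((depthQ (sqIdeal n k (sqLexSegInit q (Finset.image j Finset.univ))) : ℕ) :
          WithBot (WithTop ℕ)) =
        ringKrullDim (MvPolynomial (Fin n) k ⧸
          sqIdeal n k (sqLexSegInit q (Finset.image j Finset.univ)))
      ↔ (∀ F G : Finset (Fin n),
          isFacet k (sqIdeal n k (sqLexSegInit q (Finset.image j Finset.univ))) F →
          isFacet k (sqIdeal n k (sqLexSegInit q (Finset.image j Finset.univ))) G →
          F.card = G.card)) ∧
    ((∀ F G : Finset (Fin n),
          isFacet k (sqIdeal n k (sqLexSegInit q (Finset.image j Finset.univ))) F →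
          isFacet k (sqIdeal n k (sqLexSegInit q (Finset.image j Finset.univ))) G →
          F.card = G.card)
      ↔ Finset.image j Finset.univ
          = Finset.univ.filter (fun i : Fin n => n - q ≤ (i : ℕ))) := by
  refine Lexseg.main n q hq _ ?_ ?_ _ rfl
  · rw [Finset.card_image_of_injective _ hmono.injective, Finset.card_univ, Fintype.card_fin]
  · intro i hi
    obtain ⟨a, -, rfl⟩ := Finset.mem_image.1 hi
    have h1 : j ⟨0, by omega⟩ ≤ j a := hmono.monotone (Fin.le_def.2 (Nat.zero_le _))
    exact hj1.trans (Fin.le_def.1 h1)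
end

section
/- Let I = (L^f(u)) ⊆ S be the final squarefree lexsegment ideal determined by u = x_1 x_{i_2}···x_{i_q} with 2 ≤ i_2 < ... < i_q ≤ n and u ≠ x_1 x_2 ··· x_q. Then dim(S/I) = q and depth(S/I) = q - 1; in particular S/I is not Cohen–Macaulay. -/
open MvPolynomial

variable {k : Type*} [Field k]

section General

variable {R : Type*} [CommRing R]

/-- Ideal-level version of weak regularity of a sequence on `R ⧸ J`. -/
def WReg : Ideal R → List R → Prop
  | _, [] => True
  | J, x :: rs => (∀ f, x * f ∈ J → f ∈ J) ∧ WReg (J ⊔ Ideal.span {x}) rs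

lemma mem_sup_sing {J : Ideal R} {x f : R} :
    f ∈ J ⊔ Ideal.span {x} ↔ ∃ h, f - x * h ∈ J := by
  rw [Submodule.mem_sup]
  constructor
  · rintro ⟨y, hy, z, hz, rfl⟩
    obtain ⟨a, rfl⟩ := Ideal.mem_span_singleton'.1 hz
    exact ⟨a, by convert hy using 1; ring⟩
  · rintro ⟨h, hh⟩
    exact ⟨_, hh, x * h, Ideal.mem_span_singleton'.2 ⟨h, by ring⟩, by ring⟩

lemma wreg_top (rs : List R) : WReg (⊤ : Ideal R) rs := by
  induction rs with
  | nil => trivial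
  | cons x rs ih => exact ⟨fun f _ => trivial, by rw [top_sup_eq]; exact ih⟩

open Pointwise in
lemma wreg_iff (J : Ideal R) (rs : List R) :
    RingTheory.Sequence.IsWeaklyRegular (R ⧸ J) rs ↔ WReg J rs := by
  induction rs generalizing J with
  | nil => simp [WReg]
  | cons x rs ih =>
    rw [RingTheory.Sequence.isWeaklyRegular_cons_iff, WReg, ← ih]
    apply and_congr
    · rw [isSMulRegular_iff_right_eq_zero_of_smul]
      constructor
      · intro h f hf
        have := h (Ideal.Quotient.mk J f) (by
          rw [Algebra.smul_def, Ideal.Quotient.algebraMap_eq, ← map_mul]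
          exact Ideal.Quotient.eq_zero_iff_mem.2 hf)
        exact Ideal.Quotient.eq_zero_iff_mem.1 this
      · intro h f hf
        obtain ⟨f, rfl⟩ := Ideal.Quotient.mk_surjective f
        rw [Algebra.smul_def, Ideal.Quotient.algebraMap_eq, ← map_mul] at hf
        exact Ideal.Quotient.eq_zero_iff_mem.2 (h f (Ideal.Quotient.eq_zero_iff_mem.1 hf))
    · have e1 := Submodule.quotientQuotientEquivQuotient J (J ⊔ Ideal.span {x}) le_sup_left
      have e2 : (x • ⊤ : Submodule R (R ⧸ J)) =
          Submodule.map (Submodule.mkQ J) (J ⊔ Ideal.span {x}) := by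
        ext y
        rw [Submodule.mem_smul_pointwise_iff_exists, Submodule.mem_map]
        constructor
        · rintro ⟨b, -, rfl⟩
          obtain ⟨b, rfl⟩ := Submodule.mkQ_surjective J b
          exact ⟨x * b, mem_sup_sing.2 ⟨b, by simp⟩, by rw [← smul_eq_mul, map_smul]⟩
        · rintro ⟨b, hb, rfl⟩
          obtain ⟨h, hh⟩ := mem_sup_sing.1 hb
          refine ⟨Submodule.mkQ J h, trivial, ?_⟩
          rw [← map_smul, smul_eq_mul]
          symm
          rw [← sub_eq_zero, ← map_sub]
          exact Ideal.Quotient.eq_zero_iff_mem.2 hh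
      exact LinearEquiv.isWeaklyRegular_congr ((Submodule.quotEquivOfEq _ _ e2).trans e1) rs

/-- Extension lemma for `0 → R/(J:x) → R/J → R/(J+x) → 0`. -/
lemma wreg_ext (rs : List R) (x : R) (J K : Ideal R) (hK : ∀ f, f ∈ K ↔ x * f ∈ J)
    (h1 : WReg K rs) (h2 : WReg (J ⊔ Ideal.span {x}) rs) : WReg J rs := by
  induction rs generalizing J K with
  | nil => trivial
  | cons t rs ih =>
    obtain ⟨a1, b1⟩ := h1
    obtain ⟨a2, b2⟩ := h2
    refine ⟨fun f hf => ?_, ?_⟩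
    · obtain ⟨h, hh⟩ := mem_sup_sing.1 (a2 f (Ideal.mem_sup_left hf))
      have : h ∈ K := a1 h ((hK _).2 (by
        have := J.sub_mem hf (J.mul_mem_left t hh)
        convert this using 1; ring))
      have := J.add_mem hh ((hK _).1 this)
      simpa using this
    · refine ih _ _ ?_ b1 (by rwa [sup_right_comm])
      intro f
      constructor
      · intro hf
        obtain ⟨h, hh⟩ := mem_sup_sing.1 hf
        refine mem_sup_sing.2 ⟨x * h, ?_⟩
        convert (hK _).1 hh using 1; ring
      · intro hf
        obtain ⟨g, hg⟩ := mem_sup_sing.1 hf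
        have : t * g ∈ J ⊔ Ideal.span {x} := mem_sup_sing.2 ⟨f, by
          convert J.neg_mem hg using 1; ring⟩
        obtain ⟨h, hh⟩ := mem_sup_sing.1 (a2 g this)
        refine mem_sup_sing.2 ⟨h, (hK _).2 ?_⟩
        convert J.add_mem hg (J.mul_mem_left t hh) using 1; ring

/-- One step for the bound of depth by the dimension of an associated prime. -/
lemma step_ass [IsNoetherianRing R] (J m P : Ideal R) [m.IsPrime] (x z : R) (hx : x ∈ m)
    (hreg : ∀ f, x * f ∈ J → f ∈ J) (hP : ∀ f, f ∈ P ↔ f * z ∈ J) (hPm : P ≤ m) :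
    ∃ (Q : Ideal R) (z' : R), Q.IsPrime ∧ (∀ f, f ∈ Q ↔ f * z' ∈ J ⊔ Ideal.span {x}) ∧
      P ≤ Q ∧ x ∈ Q ∧ Q ≤ m := by
  have hmP : m.IsPrime := inferInstance
  let N : Set R := {g | ∀ p ∈ P, p * g ∈ J}
  let K : R → Ideal R := fun g => Submodule.comap (LinearMap.mulRight R g) (J ⊔ Ideal.span {x})
  have memK : ∀ g f, f ∈ K g ↔ f * g ∈ J ⊔ Ideal.span {x} := fun g f => Iff.rfl
  have key : ∃ g ∈ N, K g ≤ m := by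
    by_contra! hcon
    have hstep : ∀ g : N, ∃ sy : R × N, sy.1 ∉ m ∧ sy.1 * g.1 - x * sy.2.1 ∈ J := by
      rintro ⟨g, hg⟩
      obtain ⟨s, hs, hsm⟩ := SetLike.not_le_iff_exists.1 (hcon g hg)
      obtain ⟨y, hy⟩ := mem_sup_sing.1 ((memK _ _).1 hs)
      refine ⟨(s, ⟨y, ?_⟩), hsm, hy⟩
      intro p hp
      apply hreg
      have := J.sub_mem (J.mul_mem_left s (hg p hp)) (J.mul_mem_left p hy)
      convert this using 1; ring
    choose nx hnx using hstep
    have hzN : z ∈ N := fun p hp => (hP p).1 hp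
    let y : ℕ → N := fun i => Nat.rec ⟨z, hzN⟩ (fun _ g => (nx g).2) i
    have y0 : (y 0).1 = z := rfl
    have ys : ∀ i, y (i+1) = (nx (y i)).2 := fun i => rfl
    let c : ℕ → R := fun t => ∏ i ∈ Finset.range t, (nx (y i)).1
    have hc : ∀ t, c t ∉ m := by
      intro t ht
      obtain ⟨i, -, hi⟩ := (Ideal.IsPrime.prod_mem_iff (hp := hmP)).1 ht
      exact (hnx (y i)).1 hi
    have hcy : ∀ t, c t * z - x ^ t * (y t).1 ∈ J := by
      intro t
      induction t with
      | zero => simp [c, y0]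
      | succ t ih =>
        have h2 := (hnx (y t)).2
        rw [← ys] at h2
        have := J.add_mem (J.mul_mem_left (nx (y t)).1 ih) (J.mul_mem_left (x ^ t) h2)
        convert this using 1
        simp only [c, Finset.prod_range_succ]
        ring
    let A : ℕ →o Ideal R := ⟨fun t => Ideal.span ((fun i => (y i).1) '' Set.Iio t), fun a b hab =>
      Ideal.span_mono (Set.image_mono (Set.Iio_subset_Iio hab))⟩
    obtain ⟨t, ht⟩ := (monotone_stabilizes_iff_noetherian (R := R) (M := R)).2 inferInstance A
    have hyt : (y t).1 ∈ A t := by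
      rw [ht (t+1) (Nat.le_succ t)]
      exact Ideal.subset_span ⟨t, by simp, rfl⟩
    have hA : A t ≤ Submodule.comap (LinearMap.mulLeft R (x ^ t)) (J ⊔ Ideal.span {x * z}) := by
      refine Ideal.span_le.2 ?_
      rintro _ ⟨i, hi, rfl⟩
      simp only [Set.mem_Iio] at hi
      simp only [Submodule.comap_coe, Set.mem_preimage, LinearMap.mulLeft_apply, SetLike.mem_coe]
      obtain ⟨d, rfl⟩ := Nat.exists_eq_add_of_lt hi
      refine mem_sup_sing.2 ⟨x ^ d * c i, ?_⟩
      convert J.neg_mem (J.mul_mem_left (x ^ (d+1)) (hcy i)) using 1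
      ring
    obtain ⟨h, hh⟩ := mem_sup_sing.1 (hA hyt)
    simp only [LinearMap.mulLeft_apply] at hh
    have : c t - x * h ∈ P := (hP _).2 (by
      convert J.add_mem hh (hcy t) using 1; ring)
    apply hc t
    have := m.add_mem (hPm this) (m.mul_mem_right h hx)
    simpa using this
  obtain ⟨g0, hg0, hK0⟩ := key
  obtain ⟨Q, ⟨g, hgN, rfl, hgm⟩, hmax⟩ :=
    (set_has_maximal_iff_noetherian (R := R) (M := R)).2 inferInstance
      {Q : Ideal R | ∃ g ∈ N, K g = Q ∧ K g ≤ m} ⟨K g0, g0, hg0, rfl, hK0⟩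
  have hmulN : ∀ a, a * g ∈ N := fun a p hp => by
    convert J.mul_mem_left a (hgN p hp) using 1; ring
  have hmono : ∀ a, K g ≤ K (a * g) := fun a f hf => by
    rw [memK] at hf ⊢
    convert Ideal.mul_mem_left _ a hf using 1; ring
  have heq : ∀ a, K (a * g) ≤ m → K (a * g) ≤ K g := fun a ha => by
    by_contra hle
    exact hmax _ ⟨a * g, hmulN a, rfl, ha⟩ (lt_of_le_not_ge (hmono a) hle)
  refine ⟨K g, g, ⟨?_, ?_⟩, memK g, ?_, ?_, hgm⟩
  · intro h
    rw [h] at hgm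
    exact hmP.ne_top (top_le_iff.1 hgm)
  · intro a b hab
    by_cases h : K (a * g) ≤ m
    · right
      apply heq a h
      rw [memK] at hab ⊢
      convert hab using 1; ring
    · left
      obtain ⟨s, hs, hsm⟩ := SetLike.not_le_iff_exists.1 h
      refine heq s ?_ ?_
      · intro f hf
        have : f * s ∈ K g := by
          rw [memK] at hf ⊢
          convert hf using 1; ring
        exact (hmP.mem_or_mem (hgm this)).resolve_right hsm
      · rw [memK] at hs ⊢
        convert hs using 1; ring
  · intro p hp
    exact (memK _ _).2 (Ideal.mem_sup_left (hgN p hp))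
  · exact (memK _ _).2 (mem_sup_sing.2 ⟨g, by simp⟩)

lemma wreg_length_le [IsNoetherianRing R] (m : Ideal R) [m.IsPrime] (rs : List R)
    (hm : ∀ x ∈ rs, x ∈ m) (J P : Ideal R) (z : R) [P.IsPrime]
    (hP : ∀ f, f ∈ P ↔ f * z ∈ J) (hPm : P ≤ m) (h : WReg J rs) :
    (rs.length : WithBot ℕ∞) ≤ ringKrullDim (R ⧸ P) := by
  induction rs generalizing J P z with
  | nil =>
    have : Nontrivial (R ⧸ P) := inferInstance
    simpa using ringKrullDim_nonneg_of_nontrivial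
  | cons x rs ih =>
    obtain ⟨a, b⟩ := h
    obtain ⟨Q, z', hQp, hQ, hPQ, hxQ, hQm⟩ := step_ass J m P x z (hm x (by simp)) a hP hPm
    have h1 := ih (fun y hy => hm y (by simp [hy])) _ Q z' hQ hQm b
    have hxP : x ∉ P := fun hx => by
      have := a z ((hP _).1 hx)
      exact (inferInstance : P.IsPrime).ne_top ((Ideal.eq_top_iff_one P).2 ((hP 1).2 (by simpa)))
    have h2 := ringKrullDim_succ_le_of_surjective (Ideal.Quotient.factor hPQ)
      (Ideal.Quotient.factor_surjective hPQ) (r := Ideal.Quotient.mk P x)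
      (mem_nonZeroDivisors_of_ne_zero (fun h => hxP (Ideal.Quotient.eq_zero_iff_mem.1 h)))
      (by rw [Ideal.Quotient.factor_mk]; exact Ideal.Quotient.eq_zero_iff_mem.2 hxQ)
    refine le_trans ?_ h2
    rw [List.length_cons]
    push_cast
    gcongr

end General

section Poly

variable {n : ℕ}

attribute [local instance] MvPolynomial.gradedAlgebra

lemma hom_X_pow_sep (J : Ideal (MvPolynomial (Fin n) k))
    (hJ : Ideal.IsHomogeneous (homogeneousSubmodule (Fin n) k) J) (v : Fin n)
    (f : MvPolynomial (Fin n) k) (h : ∀ N : ℕ, ∃ g, f - X v ^ N * g ∈ J) : f ∈ J := by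
  classical
  rw [← DirectSum.sum_support_decompose (homogeneousSubmodule (Fin n) k) f]
  refine J.sum_mem fun d _ => ?_
  obtain ⟨g, hg⟩ := h (d + 1)
  have h1 := hJ d hg
  rw [DirectSum.decompose_sub] at h1
  have h2 : ((DirectSum.decompose (homogeneousSubmodule (Fin n) k) (X v ^ (d+1) * g) d :
      homogeneousSubmodule (Fin n) k d) : MvPolynomial (Fin n) k) = 0 := by
    refine DirectSum.coe_decompose_mul_of_left_mem_of_not_le
      (homogeneousSubmodule (Fin n) k) (i := d + 1) ?_ ?_
    · rw [mem_homogeneousSubmodule]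
      exact isHomogeneous_X_pow v (d + 1)
    · simp
  rwa [DirectSum.sub_apply, AddSubgroupClass.coe_sub, h2, sub_zero] at h1

/-- Lifting a homogeneous weakly regular sequence along a regular variable. -/
lemma wreg_lift (rs : List (MvPolynomial (Fin n) k)) (J : Ideal (MvPolynomial (Fin n) k))
    (hrs : ∀ x ∈ rs, SetLike.IsHomogeneousElem (homogeneousSubmodule (Fin n) k) x)
    (hJ : Ideal.IsHomogeneous (homogeneousSubmodule (Fin n) k) J) (v : Fin n)
    (hv : ∀ f, X v * f ∈ J → f ∈ J) (h : WReg (J ⊔ Ideal.span {X v}) rs) : WReg J rs := by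
  induction rs generalizing J with
  | nil => trivial
  | cons t rs ih =>
    obtain ⟨a, b⟩ := h
    refine ⟨fun f hf => ?_, ?_⟩
    · apply hom_X_pow_sep J hJ v
      suffices H : ∀ N : ℕ, ∃ g, f - X v ^ N * g ∈ J ∧ t * g ∈ J from
        fun N => (H N).imp fun g hg => hg.1
      intro N
      induction N with
      | zero => exact ⟨f, by simp, hf⟩
      | succ N ihN =>
        obtain ⟨g, hg, htg⟩ := ihN
        obtain ⟨g', hg'⟩ := mem_sup_sing.1 (a g (Ideal.mem_sup_left htg))
        refine ⟨g', ?_, hv _ ?_⟩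
        · convert J.add_mem hg (J.mul_mem_left (X v ^ N) hg') using 1; ring
        · convert J.sub_mem htg (J.mul_mem_left t hg') using 1; ring
    · refine ih _ (fun x hx => hrs x (by simp [hx])) ?_ ?_ (by rwa [sup_right_comm])
      · refine hJ.sup (Ideal.homogeneous_span _ _ ?_)
        rintro x rfl
        exact hrs _ (by simp)
      · intro f hf
        obtain ⟨g, hg⟩ := mem_sup_sing.1 hf
        have : t * g ∈ J ⊔ Ideal.span {X v} := mem_sup_sing.2 ⟨f, by
          convert J.neg_mem hg using 1; ring⟩
        obtain ⟨h, hh⟩ := mem_sup_sing.1 (a g this)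
        refine mem_sup_sing.2 ⟨h, hv _ ?_⟩
        convert J.add_mem hg (J.mul_mem_left t hh) using 1; ring

lemma mem_varIdeal (B : Finset (Fin n)) (f : MvPolynomial (Fin n) k) :
    f ∈ varIdeal n k B ↔ ∀ m ∈ f.support, ∃ i ∈ B, i ∈ m.support := by
  unfold varIdeal
  rw [mem_ideal_span_X_image]
  simp

lemma varIdeal_insert (B : Finset (Fin n)) (v : Fin n) :
    varIdeal n k (insert v B) = varIdeal n k B ⊔ Ideal.span {X v} := by
  unfold varIdeal
  rw [Finset.coe_insert, Set.image_insert_eq, Ideal.span_insert, sup_comm]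

lemma varIdeal_hom (B : Finset (Fin n)) :
    Ideal.IsHomogeneous (homogeneousSubmodule (Fin n) k) (varIdeal n k B) := by
  refine Ideal.homogeneous_span _ _ ?_
  rintro _ ⟨i, -, rfl⟩
  exact ⟨1, isHomogeneous_X k i⟩

lemma X_mul_support (v : Fin n) (f : MvPolynomial (Fin n) k) (Q : Finset (Fin n) → Prop) :
    (∀ m ∈ (X v * f).support, Q m.support) ↔ ∀ m ∈ f.support, Q (insert v m.support) := by
  classical
  have : ∀ m : Fin n →₀ ℕ, (Finsupp.single v 1 + m).support = insert v m.support := by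
    intro m
    ext i
    by_cases h : i = v
    · subst h; simp
    · simp [h]
  rw [support_X_mul]
  simp [this]

lemma varIdeal_X_reg (B : Finset (Fin n)) (v : Fin n) (hv : v ∉ B)
    (f : MvPolynomial (Fin n) k) (hf : X v * f ∈ varIdeal n k B) : f ∈ varIdeal n k B := by
  rw [mem_varIdeal] at hf ⊢
  rw [X_mul_support v f (fun s => ∃ i ∈ B, i ∈ s)] at hf
  intro m hm
  obtain ⟨i, hi, hi'⟩ := hf m hm
  refine ⟨i, hi, ?_⟩
  rcases Finset.mem_insert.1 hi' with h | h
  · exact absurd (h ▸ hi) hv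
  · exact h

lemma varIdeal_prod_reg (B G : Finset (Fin n)) (hG : Disjoint G B)
    (f : MvPolynomial (Fin n) k) (hf : (∏ i ∈ G, X i) * f ∈ varIdeal n k B) :
    f ∈ varIdeal n k B := by
  induction G using Finset.induction_on with
  | empty => simpa using hf
  | insert v G hv ih =>
    rw [Finset.disjoint_insert_left] at hG
    apply ih hG.2
    apply varIdeal_X_reg B v hG.1
    rw [Finset.prod_insert hv] at hf
    rwa [← mul_assoc]

lemma wreg_prod (rs : List (MvPolynomial (Fin n) k)) (B G : Finset (Fin n)) (hG : Disjoint G B)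
    (h : ∀ v ∈ G, WReg (varIdeal n k (insert v B)) rs) :
    WReg (varIdeal n k B ⊔ Ideal.span {∏ i ∈ G, X i}) rs := by
  induction G using Finset.induction_on with
  | empty => simpa using wreg_top rs
  | insert v G hv ih =>
    rw [Finset.disjoint_insert_left] at hG
    have ih' := ih hG.2 (fun w hw => h w (by simp [hw]))
    refine wreg_ext rs (X v) _ _ ?_ ih' ?_
    · intro f
      rw [mem_sup_sing, mem_sup_sing, Finset.prod_insert hv]
      refine exists_congr fun g => ?_
      have e : X v * f - X v * (∏ i ∈ G, X i) * g =
        (X v * (f - (∏ i ∈ G, X i) * g) : MvPolynomial (Fin n) k) := by ring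
      rw [e]
      exact ⟨fun h => Ideal.mul_mem_left _ _ h, varIdeal_X_reg B v hG.1 _⟩
    · have e : varIdeal n k B ⊔ Ideal.span {∏ i ∈ insert v G, X i} ⊔ Ideal.span {X v} =
          varIdeal n k (insert v B) := by
        rw [varIdeal_insert, sup_assoc]
        congr 1
        rw [sup_eq_right, Ideal.span_singleton_le_span_singleton, Finset.prod_insert hv]
        exact Dvd.intro _ rfl
      rw [e]
      exact h v (by simp)

/-- The sequence `e_m, e_{m-1}, …, e_1` of elementary symmetric polynomials. -/
noncomputable def esList (n : ℕ) (k : Type*) [Field k] : ℕ → List (MvPolynomial (Fin n) k)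
  | 0 => []
  | m + 1 => esymm (Fin n) k (m + 1) :: esList n k m

lemma esList_length (m : ℕ) : (esList n k m).length = m := by
  induction m with
  | zero => rfl
  | succ m ih => simp [esList, ih]

lemma esList_mem (m : ℕ) (x : MvPolynomial (Fin n) k) (hx : x ∈ esList n k m) :
    ∃ d, x = esymm (Fin n) k (d + 1) := by
  induction m with
  | zero => simp [esList] at hx
  | succ m ih =>
    rcases List.mem_cons.1 hx with h | h
    · exact ⟨m, h⟩
    · exact ih h

lemma esymm_hom (d : ℕ) :
    SetLike.IsHomogeneousElem (homogeneousSubmodule (Fin n) k) (esymm (Fin n) k d) := by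
  refine ⟨d, ?_⟩
  rw [mem_homogeneousSubmodule]
  unfold esymm
  refine IsHomogeneous.sum _ _ _ fun t ht => ?_
  have := IsHomogeneous.prod t (fun i => (X i : MvPolynomial (Fin n) k)) (fun _ => 1)
    (fun i _ => isHomogeneous_X k i)
  simpa [(Finset.mem_powersetCard.1 ht).2] using this

lemma esymm_congr (B : Finset (Fin n)) (m : ℕ) (hm : B.card + m = n) :
    esymm (Fin n) k m - ∏ i ∈ Bᶜ, X i ∈ varIdeal n k B := by
  classical
  have hc : Bᶜ.card = m := by rw [Finset.card_compl, Fintype.card_fin]; omega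
  unfold esymm
  rw [← Finset.sum_erase_add _ _ (Finset.mem_powersetCard.2 ⟨Finset.subset_univ _, hc⟩),
    add_sub_cancel_right]
  refine Ideal.sum_mem _ fun t ht => ?_
  rw [Finset.mem_erase, Finset.mem_powersetCard] at ht
  obtain ⟨i, hi, hiB⟩ : ∃ i ∈ t, i ∈ B := by
    by_contra! hcon
    apply ht.1
    refine Finset.eq_of_subset_of_card_le (fun i hi => by simpa using hcon i hi) ?_
    omega
  rw [← Finset.mul_prod_erase t _ hi]
  exact Ideal.mul_mem_right _ _ (Ideal.subset_span ⟨i, hiB, rfl⟩)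

lemma wreg_leaf_base (m : ℕ) (B : Finset (Fin n)) (hm : B.card + m = n) :
    WReg (varIdeal n k B) (esList n k m) := by
  classical
  induction m generalizing B with
  | zero => trivial
  | succ m ih =>
    have hc := esymm_congr (k := k) B (m + 1) hm
    have hd : Disjoint Bᶜ B := disjoint_compl_left
    refine ⟨fun f hf => ?_, ?_⟩
    · apply varIdeal_prod_reg B Bᶜ hd
      convert Ideal.sub_mem _ hf (Ideal.mul_mem_right f _ hc) using 1; ring
    · have e : varIdeal n k B ⊔ Ideal.span {esymm (Fin n) k (m + 1)} =
          varIdeal n k B ⊔ Ideal.span {∏ i ∈ Bᶜ, X i} := by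
        ext f
        rw [mem_sup_sing, mem_sup_sing]
        refine exists_congr fun h => ⟨fun hf => ?_, fun hf => ?_⟩
        · convert Ideal.add_mem _ hf (Ideal.mul_mem_right h _ hc) using 1; ring
        · convert Ideal.sub_mem _ hf (Ideal.mul_mem_right h _ hc) using 1; ring
      rw [e]
      refine wreg_prod _ _ _ hd fun v hv => ih _ ?_
      rw [Finset.card_insert_of_notMem (by simpa using hv)]
      omega

lemma wreg_leaf (m : ℕ) (B : Finset (Fin n)) (hm : B.card + m ≤ n) :
    WReg (varIdeal n k B) (esList n k m) := by
  classical
  obtain ⟨d, hd⟩ := Nat.exists_eq_add_of_le hm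
  induction d generalizing B with
  | zero => exact wreg_leaf_base m B (by omega)
  | succ d ih =>
    obtain ⟨v, hv⟩ : ∃ v, v ∉ B := by
      by_contra! hcon
      have : B = Finset.univ := Finset.eq_univ_iff_forall.2 hcon
      rw [this, Finset.card_univ, Fintype.card_fin] at hd
      omega
    refine wreg_lift _ _ (fun x hx => ?_) (varIdeal_hom B) v (varIdeal_X_reg B v hv) ?_
    · obtain ⟨e, rfl⟩ := esList_mem m x hx
      exact esymm_hom _
    · rw [← varIdeal_insert]
      have := Finset.card_insert_of_notMem hv
      exact ih _ (by omega) (by omega)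

/-- The ideal spanned by all monomials whose support satisfies `P`. -/
noncomputable def supIdeal (n : ℕ) (k : Type*) [Field k] (P : Finset (Fin n) → Prop) :
    Ideal (MvPolynomial (Fin n) k) :=
  Ideal.span ((fun s => monomial s (1 : k)) '' {s | P s.support})

lemma mem_supIdeal (P : Finset (Fin n) → Prop) (hP : ∀ F G, F ⊆ G → P F → P G)
    (f : MvPolynomial (Fin n) k) : f ∈ supIdeal n k P ↔ ∀ m ∈ f.support, P m.support := by
  unfold supIdeal
  rw [mem_ideal_span_monomial_image]
  refine forall₂_congr fun m _ => ⟨?_, fun h => ⟨m, h, le_rfl⟩⟩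
  rintro ⟨s, hs, hsm⟩
  exact hP _ _ (Finsupp.support_mono hsm) hs

lemma supIdeal_add (P : Finset (Fin n) → Prop) (hP : ∀ F G, F ⊆ G → P F → P G) (v : Fin n) :
    supIdeal n k P ⊔ Ideal.span {X v} = supIdeal n k (fun F => P F ∨ v ∈ F) := by
  ext f
  rw [mem_supIdeal (fun F => P F ∨ v ∈ F) (fun F G h h' => h'.imp (hP F G h) (fun h' => h h'))]
  have : supIdeal n k P ⊔ Ideal.span {X v} =
      Ideal.span ((fun s => monomial s (1 : k)) '' ({s | P s.support} ∪ {Finsupp.single v 1})) := by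
    rw [Set.image_union, Ideal.span_union, Set.image_singleton]
    rfl
  rw [this, mem_ideal_span_monomial_image]
  refine forall₂_congr fun m _ => ⟨?_, ?_⟩
  · rintro ⟨s, hs | hs, hsm⟩
    · exact Or.inl (hP _ _ (Finsupp.support_mono hsm) hs)
    · right
      rw [Set.mem_singleton_iff] at hs
      subst hs
      exact Finsupp.support_mono hsm (by simp)
  · rintro (h | h)
    · exact ⟨m, Or.inl h, le_rfl⟩
    · refine ⟨_, Or.inr rfl, ?_⟩
      rw [Finsupp.single_le_iff]
      have := Finsupp.mem_support_iff.1 h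
      omega

lemma wreg_main (q : ℕ) (d : ℕ) : ∀ (A B : Finset (Fin n)) (P : Finset (Fin n) → Prop)
    (_ : ∀ F G, F ⊆ G → P F → P G) (_ : ∀ a ∈ A, ∀ F, P (insert a F) → P F)
    (_ : ∀ b ∈ B, P {b}) (_ : Disjoint A B)
    (_ : ∀ F, P F → Disjoint F B → q < (F ∪ A).card) (_ : B.card + q ≤ n)
    (_ : A.card + B.card + d = n),
    WReg (supIdeal n k P) (esList n k q) := by
  classical
  induction d with
  | zero =>
    intro A B P hmono hA hB hAB hq hBn hd
    by_cases h0 : P ∅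
    · have : supIdeal n k P = ⊤ := by
        rw [eq_top_iff]
        intro f _
        rw [mem_supIdeal P hmono]
        exact fun m _ => hmono ∅ _ (by simp) h0
      rw [this]
      exact wreg_top _
    · have hU : A ∪ B = Finset.univ := by
        rw [← Finset.card_eq_iff_eq_univ, Finset.card_union_of_disjoint hAB, Fintype.card_fin]
        exact hd
      have : supIdeal n k P = varIdeal n k B := by
        ext f
        rw [mem_supIdeal P hmono, mem_varIdeal]
        refine forall₂_congr fun m _ => ⟨fun h => ?_, ?_⟩
        · by_contra! hcon
          have hsub : m.support ⊆ A := fun i hi => by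
            have : i ∈ A ∪ B := by rw [hU]; simp
            exact (Finset.mem_union.1 this).resolve_right fun h => hcon i h hi
          have : ∀ s ⊆ A, P s → P ∅ := by
            intro s
            induction s using Finset.induction_on with
            | empty => exact fun _ h => h
            | insert a s ha ih =>
              intro hs h
              rw [Finset.insert_subset_iff] at hs
              exact ih hs.2 (hA a hs.1 _ h)
          exact h0 (this _ hsub h)
        · rintro ⟨i, hi, him⟩
          exact hmono _ _ (by simpa using him) (hB i hi)
      rw [this]
      exact wreg_leaf q B hBn
  | succ d ih =>
    intro A B P hmono hA hB hAB hq hBn hd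
    rcases hBn.eq_or_lt with hBn' | hBn'
    · have : supIdeal n k P = varIdeal n k B := by
        ext f
        rw [mem_supIdeal P hmono, mem_varIdeal]
        refine forall₂_congr fun m _ => ⟨fun h => ?_, ?_⟩
        · by_contra! hcon
          have hdis : Disjoint m.support B := Finset.disjoint_right.2 hcon
          have h1 := hq _ h hdis
          have h2 : ((m.support ∪ A) ∪ B).card ≤ n := by
            simpa using Finset.card_le_univ ((m.support ∪ A) ∪ B)
          rw [Finset.card_union_of_disjoint (Finset.disjoint_union_left.2 ⟨hdis, hAB⟩)] at h2
          omega
        · rintro ⟨i, hi, him⟩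
          exact hmono _ _ (by simpa using him) (hB i hi)
      rw [this]
      exact wreg_leaf q B hBn
    · obtain ⟨w, hw⟩ : ∃ w, w ∉ A ∪ B := by
        by_contra! hcon
        have : A ∪ B = Finset.univ := Finset.eq_univ_iff_forall.2 hcon
        have := congrArg Finset.card this
        rw [Finset.card_univ, Fintype.card_fin, Finset.card_union_of_disjoint hAB] at this
        omega
      rw [Finset.mem_union, not_or] at hw
      refine wreg_ext _ (X w) _ (supIdeal n k (fun F => P (insert w F))) ?_ ?_ ?_
      · intro f
        rw [mem_supIdeal P hmono, X_mul_support, mem_supIdeal (fun F => P (insert w F))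
          (fun F G h h' => hmono _ _ (Finset.insert_subset_insert w h) h')]
      · refine ih (insert w A) B _ ?_ ?_ ?_ ?_ ?_ hBn ?_
        · exact fun F G h h' => hmono _ _ (Finset.insert_subset_insert w h) h'
        · intro a ha F hF
          rcases Finset.mem_insert.1 ha with rfl | ha
          · simpa using hF
          · rw [Finset.insert_comm] at hF
            exact hA a ha _ hF
        · exact fun b hb => hmono _ _ (by simp) (hB b hb)
        · exact Finset.disjoint_insert_left.2 ⟨hw.2, hAB⟩
        · intro F hF hFB
          have := hq _ hF (Finset.disjoint_insert_left.2 ⟨hw.2, hFB⟩)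
          rwa [Finset.insert_union, ← Finset.union_insert] at this
        · rw [Finset.card_insert_of_notMem hw.1]; omega
      · rw [supIdeal_add P hmono]
        refine ih A (insert w B) _ ?_ ?_ ?_ ?_ ?_ ?_ ?_
        · exact fun F G h h' => h'.imp (hmono F G h) (fun h' => h h')
        · intro a ha F hF
          refine hF.imp (hA a ha F) fun h => ?_
          refine (Finset.mem_insert.1 h).resolve_left ?_
          rintro rfl
          exact hw.1 ha
        · intro b hb
          rcases Finset.mem_insert.1 hb with rfl | hb
          · right; simp
          · exact Or.inl (hB b hb)
        · exact Finset.disjoint_insert_right.2 ⟨hw.1, hAB⟩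
        · intro F hF hFB
          rw [Finset.disjoint_insert_right] at hFB
          exact hq F (hF.resolve_right hFB.1) hFB.2
        · rw [Finset.card_insert_of_notMem hw.2]; omega
        · rw [Finset.card_insert_of_notMem hw.2]; omega

end Poly

section Final

variable {n : ℕ}

lemma varIdeal_ker (B : Finset (Fin n)) :
    RingHom.ker (killCompl (R := k) (Subtype.val_injective (p := fun i : Fin n => i ∉ B))).toRingHom
      = varIdeal n k B := by
  classical
  ext f
  rw [RingHom.mem_ker, mem_varIdeal]
  constructor
  · intro h m hm
    by_contra! hcon
    have hs : ((m.support : Finset (Fin n)) : Set (Fin n)) ⊆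
        Set.range (Subtype.val : {i : Fin n // i ∉ B} → Fin n) := by
      intro i hi
      exact ⟨⟨i, fun h => hcon i h hi⟩, rfl⟩
    have h2 := m.mapDomain_comapDomain _ (Subtype.val_injective (p := fun i : Fin n => i ∉ B)) hs
    have h3 := congrArg (coeff (m.comapDomain Subtype.val Subtype.val_injective.injOn)) h
    simp only [AlgHom.toRingHom_eq_coe, RingHom.coe_coe, coeff_killCompl, coeff_zero] at h3
    rw [h2] at h3
    exact (mem_support_iff.1 hm) h3
  · intro h
    ext s
    simp only [AlgHom.toRingHom_eq_coe, RingHom.coe_coe, coeff_killCompl, coeff_zero]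
    by_contra hne
    obtain ⟨i, hi, hi'⟩ := h _ (mem_support_iff.2 hne)
    have := Finsupp.mapDomain_support hi'
    obtain ⟨j, -, rfl⟩ := Finset.mem_image.1 this
    exact j.2 hi

lemma killCompl_surj (B : Finset (Fin n)) : Function.Surjective
    (killCompl (R := k) (Subtype.val_injective (p := fun i : Fin n => i ∉ B))).toRingHom :=
  fun p => ⟨rename Subtype.val p, killCompl_rename_app _ p⟩

lemma varIdeal_prime (B : Finset (Fin n)) : (varIdeal n k B).IsPrime := by
  rw [← varIdeal_ker]
  exact RingHom.ker_isPrime _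

lemma varIdeal_dim (B : Finset (Fin n)) (q : ℕ) (h : B.card + q = n) :
    ringKrullDim (MvPolynomial (Fin n) k ⧸ varIdeal n k B) = (q : WithBot (WithTop ℕ)) := by
  classical
  have e := (Ideal.quotEquivOfEq (varIdeal_ker (k := k) B).symm).trans
    (RingHom.quotientKerEquivOfSurjective (killCompl_surj (k := k) B))
  rw [ringKrullDim_eq_of_ringEquiv e, MvPolynomial.ringKrullDim_of_isNoetherianRing,
    ringKrullDim_eq_zero_of_field, zero_add]
  have : Nat.card {i : Fin n // i ∉ B} = q := by
    rw [Nat.card_eq_fintype_card, Fintype.card_subtype_compl, Fintype.card_fin,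
      Fintype.card_coe]
    omega
  rw [this]
  rfl

lemma sqMon_eq (F : Finset (Fin n)) :
    sqMon n k F = monomial (∑ i ∈ F, Finsupp.single i 1) (1 : k) := by
  rw [monomial_sum_one]
  rfl

lemma sum_single_support (F : Finset (Fin n)) :
    (∑ i ∈ F, Finsupp.single i 1 : Fin n →₀ ℕ).support = F := by
  classical
  ext j
  simp [Finsupp.finset_sum_apply, Finsupp.single_apply]

lemma sqIdeal_eq (L : Set (Finset (Fin n))) :
    sqIdeal n k L = supIdeal n k (fun F => ∃ w ∈ L, w ⊆ F) := by
  classical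
  have hmono : ∀ F G : Finset (Fin n), F ⊆ G → (∃ w ∈ L, w ⊆ F) → ∃ w ∈ L, w ⊆ G :=
    fun F G h ⟨w, hw, hw'⟩ => ⟨w, hw, hw'.trans h⟩
  ext f
  rw [mem_supIdeal (fun F => ∃ w ∈ L, w ⊆ F) hmono]
  have : sqIdeal n k L = Ideal.span ((fun s => monomial s (1 : k)) ''
      ((fun F : Finset (Fin n) => (∑ i ∈ F, Finsupp.single i 1 : Fin n →₀ ℕ)) '' L)) := by
    unfold sqIdeal
    rw [Set.image_image]
    simp only [sqMon_eq]
  rw [this, mem_ideal_span_monomial_image]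
  refine forall₂_congr fun m _ => ⟨?_, ?_⟩
  · rintro ⟨_, ⟨w, hw, rfl⟩, hle⟩
    refine ⟨w, hw, ?_⟩
    have := Finsupp.support_mono hle
    rwa [sum_single_support] at this
  · rintro ⟨w, hw, hwm⟩
    refine ⟨_, ⟨w, hw, rfl⟩, ?_⟩
    intro j
    rw [Finsupp.finset_sum_apply]
    simp only [Finsupp.single_apply, Finset.sum_ite_eq']
    split_ifs with hj
    · have := Finsupp.mem_support_iff.1 (hwm hj)
      omega
    · exact Nat.zero_le _

lemma prod_mul_support (G : Finset (Fin n)) (f : MvPolynomial (Fin n) k)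
    (Q : Finset (Fin n) → Prop) :
    (∀ m ∈ ((∏ i ∈ G, X i) * f).support, Q m.support) ↔
      ∀ m ∈ f.support, Q (G ∪ m.support) := by
  classical
  induction G using Finset.induction_on generalizing Q with
  | empty => simp
  | insert v G hv ih =>
    rw [Finset.prod_insert hv, mul_assoc, X_mul_support v _ Q, ih (fun s => Q (insert v s))]
    simp [Finset.insert_union]

lemma ne_q {q : ℕ} (hn : 0 < n) (U : Finset (Fin n)) (hcard : U.card = q)
    (h0 : (⟨0, hn⟩ : Fin n) ∈ U)
    (hne : U ≠ Finset.univ.filter (fun i : Fin n => (i : ℕ) < q)) : 2 ≤ q ∧ q < n := by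
  classical
  have hle : q ≤ n := by simpa [hcard] using Finset.card_le_univ U
  have hq0 : 0 < q := hcard ▸ Finset.card_pos.2 ⟨_, h0⟩
  refine ⟨?_, ?_⟩
  · by_contra hlt
    have hq : q = 1 := by omega
    apply hne
    rw [hq] at hcard ⊢
    obtain ⟨a, rfl⟩ := Finset.card_eq_one.1 hcard
    have := Finset.mem_singleton.1 h0
    subst this
    ext i
    simp [Fin.ext_iff]
  · refine lt_of_le_of_ne hle fun h => hne ?_
    rw [(Finset.card_eq_iff_eq_univ U).1 (by rw [hcard, h, Fintype.card_fin])]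
    symm
    rw [Finset.filter_eq_self]
    intro i _
    have := i.2
    omega

/-- Sets avoiding index `0` come after `U`. -/
lemma final_of_zero_notMem {q : ℕ} (hn : 0 < n) (U w : Finset (Fin n))
    (h0 : (⟨0, hn⟩ : Fin n) ∈ U) (hw : w.card = q) (hw0 : (⟨0, hn⟩ : Fin n) ∉ w) :
    w ∈ sqLexSegFinal q U := by
  refine ⟨hw, Or.inr ⟨_, h0, hw0, fun b hb => ?_⟩⟩
  exact absurd (Fin.lt_def.1 hb) (by simp)

/-- The initial segment is not in the final lexsegment. -/
lemma init_not_final {q : ℕ} (U : Finset (Fin n)) (hcard : U.card = q)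
    (hne : U ≠ Finset.univ.filter (fun i : Fin n => (i : ℕ) < q)) (hqn : q < n) :
    Finset.univ.filter (fun i : Fin n => (i : ℕ) < q) ∉ sqLexSegFinal q U := by
  classical
  rintro ⟨-, h | ⟨a, haU, ha, hb⟩⟩
  · exact hne h
  · simp only [Finset.mem_filter, Finset.mem_univ, true_and, not_lt] at ha hb
    have hsub : insert a (Finset.univ.filter (fun i : Fin n => (i : ℕ) < q)) ⊆ U := by
      intro i hi
      rcases Finset.mem_insert.1 hi with rfl | hi
      · exact haU
      · have hi' : (i : ℕ) < q := by simpa using hi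
        exact (hb i (Fin.lt_def.2 (by omega))).2 hi'
    have h1 := Finset.card_le_card hsub
    rw [Finset.card_insert_of_notMem (by simpa using ha), hcard] at h1
    have h2 : (Finset.univ.filter (fun i : Fin n => (i : ℕ) < q)).card = q := by
      have := Fin.card_filter_val_lt (n := n) (m := q)
      rw [this]; omega
    omega

/-- The facet of size `q - 1`: the last `q - 1` indices. -/
lemma tail_facet {q : ℕ} (hn : 0 < n) (U : Finset (Fin n)) (hcard : U.card = q)
    (h0 : (⟨0, hn⟩ : Fin n) ∈ U) (hqn : q < n) (hq : 2 ≤ q) (j : Fin n)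
    (hj : (j : ℕ) + (q - 1) < n) :
    insert j (Finset.univ.filter (fun i : Fin n => n ≤ (i : ℕ) + (q - 1))) ∈
      sqLexSegFinal q U := by
  classical
  set G := Finset.univ.filter (fun i : Fin n => n ≤ (i : ℕ) + (q - 1)) with hG
  have memG : ∀ i : Fin n, i ∈ G ↔ n ≤ (i : ℕ) + (q - 1) := fun i => by simp [hG]
  have hGc : G.card = q - 1 := by
    have h1 : Gᶜ = Finset.univ.filter (fun i : Fin n => (i : ℕ) < n - (q - 1)) := by
      ext i
      rw [Finset.mem_compl, memG]
      simp
      omega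
    have h2 := Fin.card_filter_val_lt (n := n) (m := n - (q - 1))
    rw [← h1, Finset.card_compl, Fintype.card_fin] at h2
    have h3 : G.card ≤ n := by simpa using Finset.card_le_univ G
    omega
  have hjG : j ∉ G := by rw [memG]; omega
  have hc : (insert j G).card = q := by
    rw [Finset.card_insert_of_notMem hjG, hGc]; omega
  by_cases hj0 : (⟨0, hn⟩ : Fin n) ∈ insert j G
  · refine ⟨hc, ?_⟩
    by_cases hU : U = insert j G
    · exact Or.inl hU
    · right
      -- the smallest element of the symmetric difference
      have h0G : (⟨0, hn⟩ : Fin n) ∉ G := by rw [memG]; simp; omega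
      have hj : j = ⟨0, hn⟩ := by
        rcases Finset.mem_insert.1 hj0 with h | h
        · exact h.symm
        · exact absurd h h0G
      have hne : (U \ insert j G).Nonempty := by
        rw [Finset.nonempty_iff_ne_empty, Ne, Finset.sdiff_eq_empty_iff_subset]
        intro hs
        exact hU (Finset.eq_of_subset_of_card_le hs (by omega))
      set a := (U \ insert j G).min' hne with ha
      have haM := Finset.min'_mem _ hne
      rw [← ha, Finset.mem_sdiff] at haM
      refine ⟨a, haM.1, haM.2, fun b hb => ⟨fun hbU => ?_, fun hbG => ?_⟩⟩
      · by_contra hbn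
        exact absurd (Finset.min'_le _ b (Finset.mem_sdiff.2 ⟨hbU, hbn⟩)) (not_le.2 hb)
      · rcases Finset.mem_insert.1 hbG with h | h
        · rw [h, hj]; exact h0
        · exfalso
          apply haM.2
          rw [Finset.mem_insert, memG]
          rw [memG] at h
          have := Fin.lt_def.1 hb
          right; omega
  · exact final_of_zero_notMem hn U _ h0 hc hj0

end Final

/-- for the final squarefree lexsegment ideal `I = (L^f(u))` determined by
`u = x_1 x_{i_2} ⋯ x_{i_q}` (a squarefree monomial of degree `q` divisible by `x_1`)
with `u ≠ x_1 x_2 ⋯ x_q`: `dim(S/I) = q`, `depth(S/I) = q - 1`, and in particular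
`S/I` is not Cohen–Macaulay.  (Variables are 0-indexed, so `x_1` is index `0` and
`x_1 ⋯ x_q` has support `{i : (i : ℕ) < q}`.) -/
theorem stmt13 {k : Type*} [Field k] (n q : ℕ) (hn : 0 < n) (U : Finset (Fin n))
    (hcard : U.card = q) (h0 : (⟨0, hn⟩ : Fin n) ∈ U)
    (hne : U ≠ Finset.univ.filter (fun i : Fin n => (i : ℕ) < q)) :
    ringKrullDim (MvPolynomial (Fin n) k ⧸ sqIdeal n k (sqLexSegFinal q U))
        = (q : WithBot (WithTop ℕ)) ∧
    depthQ (sqIdeal n k (sqLexSegFinal q U)) = q - 1 ∧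
    ¬ ((depthQ (sqIdeal n k (sqLexSegFinal q U)) : WithBot (WithTop ℕ))
        = ringKrullDim (MvPolynomial (Fin n) k ⧸ sqIdeal n k (sqLexSegFinal q U))) := by
  classical
  obtain ⟨hq2, hqn⟩ := ne_q hn U hcard h0 hne
  set L := sqLexSegFinal q U with hL
  set I := sqIdeal n k L with hI
  have hmono : ∀ F G : Finset (Fin n), F ⊆ G → (∃ w ∈ L, w ⊆ F) → ∃ w ∈ L, w ⊆ G :=
    fun F G h ⟨w, hw, hw'⟩ => ⟨w, hw, hw'.trans h⟩
  have hIs : I = supIdeal n k (fun F => ∃ w ∈ L, w ⊆ F) := sqIdeal_eq L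
  have memI : ∀ f, f ∈ I ↔ ∀ m ∈ f.support, ∃ w ∈ L, w ⊆ m.support := fun f => by
    rw [hIs, mem_supIdeal _ hmono]
  -- the irrelevant ideal
  have hmm : Ideal.span (Set.range (X : Fin n → MvPolynomial (Fin n) k)) =
      varIdeal n k Finset.univ := by
    unfold varIdeal
    rw [Finset.coe_univ, Set.image_univ]
  have hmp : (varIdeal n k (Finset.univ : Finset (Fin n))).IsPrime := varIdeal_prime _
  have hIm : I ≤ varIdeal n k Finset.univ := by
    intro f hf
    rw [memI] at hf
    rw [mem_varIdeal]
    intro m hm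
    obtain ⟨w, hw, hwm⟩ := hf m hm
    obtain ⟨i, hi⟩ : w.Nonempty := Finset.card_pos.1 (by rw [hw.1]; omega)
    exact ⟨i, Finset.mem_univ i, hwm hi⟩
  have hdim : ringKrullDim (MvPolynomial (Fin n) k ⧸ I) = (q : WithBot (WithTop ℕ)) := by
    apply le_antisymm
    · rw [ringKrullDim_quotient]
      refine iSup_le fun l => ?_
      set p := l.head.1.asIdeal with hp
      have hpp : p.IsPrime := l.head.1.isPrime
      have hIp : I ≤ p := l.head.2
      set B := Finset.univ.filter (fun i : Fin n => (X i : MvPolynomial (Fin n) k) ∈ p) with hB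
      have hBp : varIdeal n k B ≤ p := by
        refine Ideal.span_le.2 ?_
        rintro _ ⟨i, hi, rfl⟩
        simpa [hB] using hi
      have hBc : Bᶜ.card ≤ q := by
        by_contra! hlt
        have h1 : q ≤ (Bᶜ.erase ⟨0, hn⟩).card := by
          have := Finset.pred_card_le_card_erase (s := Bᶜ) (a := (⟨0, hn⟩ : Fin n))
          omega
        obtain ⟨w, hw, hwc⟩ := Finset.exists_subset_card_eq h1
        have hwL : w ∈ L := final_of_zero_notMem hn U w h0 hwc
          (fun h => by simpa using hw h)
        have hwp : sqMon n k w ∈ p := hIp (Ideal.subset_span ⟨w, hwL, rfl⟩)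
        obtain ⟨i, hi, hip⟩ := (Ideal.IsPrime.prod_mem_iff (hp := hpp)).1 hwp
        have := Finset.mem_of_mem_erase (hw hi)
        rw [Finset.mem_compl] at this
        exact this (by simp [hB, hip])
      have hd := varIdeal_dim (k := k) B (Bᶜ.card) (by
        rw [Finset.card_add_card_compl, Fintype.card_fin])
      rw [ringKrullDim_quotient] at hd
      have hmem : ∀ i, (l i).1 ∈ PrimeSpectrum.zeroLocus (varIdeal n k B :
          Set (MvPolynomial (Fin n) k)) := by
        intro i
        have h1 : l.head ≤ l i := LTSeries.head_le l i
        have h2 : p ≤ (l i).1.asIdeal := h1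
        exact hBp.trans h2
      let l' : LTSeries (PrimeSpectrum.zeroLocus (varIdeal n k B :
          Set (MvPolynomial (Fin n) k))) :=
        { length := l.length
          toFun := fun i => ⟨(l i).1, hmem i⟩
          step := fun i => l.step i }
      have h3 : (l'.length : WithBot ℕ∞) ≤ _ := le_iSup (fun l : LTSeries (PrimeSpectrum.zeroLocus
          (varIdeal n k B : Set (MvPolynomial (Fin n) k))) => (l.length : WithBot ℕ∞)) l'
      refine h3.trans (hd.le.trans ?_)
      exact (Nat.cast_le (α := WithBot ℕ∞)).2 hBc
    · set F := Finset.univ.filter (fun i : Fin n => (i : ℕ) < q) with hF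
      have hFc : F.card = q := by
        have := Fin.card_filter_val_lt (n := n) (m := q)
        rw [hF, this]; omega
      have hIF : I ≤ varIdeal n k Fᶜ := by
        intro f hf
        rw [memI] at hf
        rw [mem_varIdeal]
        intro m hm
        obtain ⟨w, hw, hwm⟩ := hf m hm
        by_contra! hcon
        have hwF : w ⊆ F := fun i hi => by
          by_contra h
          exact hcon i (Finset.mem_compl.2 h) (hwm hi)
        have := Finset.eq_of_subset_of_card_le hwF (by rw [hFc, hw.1])
        rw [this] at hw
        exact init_not_final U hcard hne hqn hw
      rw [← varIdeal_dim (k := k) Fᶜ q (by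
        rw [Finset.card_compl, Fintype.card_fin]; omega)]
      exact ringKrullDim_le_of_surjective (Ideal.Quotient.factor hIF)
        (Ideal.Quotient.factor_surjective hIF)
  have hdepth : depthQ I = q - 1 := by
    unfold depthQ
    apply IsGreatest.csSup_eq
    constructor
    · refine ⟨esList n k (q - 1), esList_length _, ?_, ?_⟩
      · intro x hx
        obtain ⟨d, rfl⟩ := esList_mem _ x hx
        rw [hmm]
        unfold esymm
        refine Ideal.sum_mem _ fun t ht => ?_
        obtain ⟨i, hi⟩ : t.Nonempty := Finset.card_pos.1 (by
          rw [(Finset.mem_powersetCard.1 ht).2]; omega)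
        rw [← Finset.mul_prod_erase t _ hi]
        exact Ideal.mul_mem_right _ _ (Ideal.subset_span ⟨i, by simp, rfl⟩)
      · refine ⟨(wreg_iff _ _).2 ?_, ?_⟩
        · rw [hIs]
          refine wreg_main (q - 1) n ∅ ∅ _ hmono (by simp) (by simp) (by simp) ?_ ?_ (by simp)
          · rintro F ⟨w, hw, hwF⟩ -
            have := Finset.card_le_card hwF
            rw [hw.1] at this
            rw [Finset.union_empty]
            omega
          · simp; omega
        · intro htop
          have hle : Ideal.ofList (esList n k (q - 1)) ≤ varIdeal n k Finset.univ := by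
            refine Ideal.span_le.2 ?_
            intro x hx
            obtain ⟨d, rfl⟩ := esList_mem _ x hx
            unfold esymm
            refine Ideal.sum_mem _ fun t ht => ?_
            obtain ⟨i, hi⟩ : t.Nonempty := Finset.card_pos.1 (by
              rw [(Finset.mem_powersetCard.1 ht).2]; omega)
            rw [← Finset.mul_prod_erase t _ hi]
            exact Ideal.mul_mem_right _ _ (Ideal.subset_span ⟨i, by simp, rfl⟩)
          have h1 : (Ideal.Quotient.mk I 1) ∈
              (Ideal.ofList (esList n k (q - 1)) • ⊤ :
                Submodule (MvPolynomial (Fin n) k) (MvPolynomial (Fin n) k ⧸ I)) := by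
            rw [← htop]; trivial
          have h2 : (Ideal.ofList (esList n k (q - 1)) • ⊤ :
                Submodule (MvPolynomial (Fin n) k) (MvPolynomial (Fin n) k ⧸ I)) ≤
              Submodule.map (Submodule.mkQ I) (varIdeal n k Finset.univ) := by
            rw [Submodule.smul_le]
            intro r hr y _
            obtain ⟨y, rfl⟩ := Submodule.mkQ_surjective I y
            refine ⟨r * y, Ideal.mul_mem_right _ _ (hle hr), ?_⟩
            rw [← smul_eq_mul, map_smul]
          obtain ⟨g, hg, hg1⟩ := h2 h1
          have h3 : g - 1 ∈ I := Ideal.Quotient.eq.1 hg1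
          apply hmp.ne_top
          rw [Ideal.eq_top_iff_one]
          have := Ideal.sub_mem _ hg (hIm h3)
          simpa using this
    · rintro r ⟨rs, rfl, hrs, hreg⟩
      set G := Finset.univ.filter (fun i : Fin n => n ≤ (i : ℕ) + (q - 1)) with hG
      have hGc : Gᶜ = Finset.univ.filter (fun i : Fin n => (i : ℕ) < n - (q - 1)) := by
        ext i
        simp [hG]
        omega
      have hGcard : Gᶜ.card + (q - 1) = n := by
        have := Fin.card_filter_val_lt (n := n) (m := n - (q - 1))
        rw [hGc, this]; omega
      have hGcard' : G.card = q - 1 := by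
        have := Finset.card_add_card_compl G
        rw [Fintype.card_fin] at this
        omega
      have hpr : (varIdeal n k Gᶜ).IsPrime := varIdeal_prime _
      have key := wreg_length_le (varIdeal n k Finset.univ) rs (fun x hx => hmm ▸ hrs x hx) I
        (varIdeal n k Gᶜ) (∏ i ∈ G, X i) ?_ ?_ ((wreg_iff _ _).1 hreg.toIsWeaklyRegular)
      · rw [varIdeal_dim (k := k) Gᶜ (q - 1) hGcard] at key
        exact (Nat.cast_le (α := WithBot ℕ∞)).1 key
      · intro f
        rw [mul_comm, memI, prod_mul_support G f (fun s => ∃ w ∈ L, w ⊆ s), mem_varIdeal]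
        refine forall₂_congr fun m _ => ⟨?_, ?_⟩
        · rintro ⟨j, hj, hjm⟩
          have hj' : (j : ℕ) + (q - 1) < n := by
            rw [hGc] at hj
            simp at hj
            omega
          refine ⟨_, tail_facet hn U hcard h0 hqn hq2 j hj', ?_⟩
          exact Finset.insert_subset (Finset.mem_union_right _ hjm) Finset.subset_union_left
        · rintro ⟨w, hw, hwm⟩
          by_contra! hcon
          have hwG : w ⊆ G := fun i hi => by
            by_contra h
            rcases Finset.mem_union.1 (hwm hi) with h' | h'
            · exact h h'
            · exact hcon i (Finset.mem_compl.2 h) h'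
          have := Finset.card_le_card hwG
          rw [hw.1] at this
          omega
      · exact Ideal.span_mono (Set.image_mono (by simp))
  refine ⟨hdim, hdepth, ?_⟩
  rw [hdim, hdepth]
  intro h
  have h' : q - 1 = q := by exact_mod_cast h
  omega
end

section
/- Let u = x_1 x_i, v = x_j x_r with j ≥ 2 be squarefree degree-2 monomials with u ≥_lex v, and I = (L(u,v)) the lexsegment edge ideal in S = k[x_1,...,x_n]. Then depth(S/I) = 1 if and only if x_{i-1} x_n ≥_lex v. -/
open MvPolynomial

variable {k : Type*} [Field k]

open RingTheory.Sequence
open scoped Pointwise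

/-- An ideal not killing any nonzero element contains a regular element. -/
lemma aux_exists_reg {R M : Type*} [CommRing R] [IsNoetherianRing R] [AddCommGroup M] [Module R M]
    [Module.Finite R M] (J : Ideal R) (h : ∀ x : M, (∀ r ∈ J, r • x = 0) → x = 0) :
    ∃ r ∈ J, IsSMulRegular M r := by
  by_contra! hc
  have h1 : (J : Set R) ⊆ ⋃ p ∈ associatedPrimes R M, ((id p : Ideal R) : Set R) := by
    simp only [id]
    rw [biUnion_associatedPrimes_eq_compl_regular R M]
    intro r hr
    exact hc r hr
  obtain ⟨p, hp, hJp⟩ := (Ideal.subset_union_prime_finite (associatedPrimes.finite R M)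
    (f := id) 0 0 (fun p hp _ _ => IsAssociatedPrime.isPrime hp)).mp h1
  obtain ⟨hprime, x, hx⟩ := isAssociatedPrime_iff.mp hp
  have hx0 : x = 0 := h x fun r hr => by
    have h2 : r ∈ p := hJp hr
    rw [hx, Submodule.mem_colon_singleton] at h2
    simpa using h2
  apply hprime.ne_top
  rw [hx, hx0, Ideal.eq_top_iff_one, Submodule.mem_colon_singleton]
  simp

/-- membership in `f • ⊤` in a quotient -/
lemma aux_mem_smul_top {R : Type*} [CommRing R] (I : Ideal R) (f p : R) :
    (Ideal.Quotient.mk I p : R ⧸ I) ∈ (f • ⊤ : Submodule R (R ⧸ I)) ↔ ∃ h, p - f * h ∈ I := by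
  rw [Submodule.mem_smul_pointwise_iff_exists]
  constructor
  · rintro ⟨y, -, hy⟩
    obtain ⟨h, rfl⟩ := Ideal.Quotient.mk_surjective y
    refine ⟨h, ?_⟩
    rw [← Ideal.Quotient.eq, ← hy]
    rfl
  · rintro ⟨h, hh⟩
    refine ⟨Ideal.Quotient.mk I h, trivial, ?_⟩
    rw [← Ideal.Quotient.eq] at hh
    rw [hh]
    rfl

lemma aux_reg_one {R : Type*} [CommRing R] (I : Ideal R) (f : R) :
    IsSMulRegular (R ⧸ I) f ↔ ∀ p, f * p ∈ I → p ∈ I := by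
  exact isSMulRegular_quotient_iff_mem_of_smul_mem I f

lemma aux_reg_two {R : Type*} [CommRing R] (I : Ideal R) (f g : R) :
    IsSMulRegular (QuotSMulTop f (R ⧸ I)) g ↔
      ∀ p h, g * p - f * h ∈ I → ∃ h', p - f * h' ∈ I := by
  refine (isSMulRegular_quotient_iff_mem_of_smul_mem (f • ⊤ : Submodule R (R ⧸ I)) g).trans ?_
  constructor
  · intro H p h hp
    exact (aux_mem_smul_top I f p).mp (H (Ideal.Quotient.mk I p)
      ((aux_mem_smul_top I f (g * p)).mpr ⟨h, hp⟩))
  · intro H x hx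
    obtain ⟨p, rfl⟩ := Ideal.Quotient.mk_surjective x
    obtain ⟨h, hh⟩ := (aux_mem_smul_top I f (g * p)).mp hx
    exact (aux_mem_smul_top I f p).mpr (H p h hh)

lemma aux_top_ne {R : Type*} [CommRing R] (I m : Ideal R) (hIm : I ≤ m) (hm : m ≠ ⊤)
    (rs : List R) (hrs : ∀ x ∈ rs, x ∈ m) :
    (⊤ : Submodule R (R ⧸ I)) ≠ Ideal.ofList rs • ⊤ := by
  intro h
  have hJ : Ideal.ofList rs ≤ m := Ideal.span_le.mpr hrs
  have h2 : (Ideal.ofList rs • ⊤ : Submodule R (R ⧸ I)) ≤ Submodule.map I.mkQ m := by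
    rw [Submodule.smul_le]
    intro r hr x _
    obtain ⟨p, rfl⟩ := Ideal.Quotient.mk_surjective x
    exact ⟨r * p, m.mul_mem_right _ (hJ hr), rfl⟩
  rw [← h] at h2
  obtain ⟨q, hq, hq1⟩ := h2 (show (Ideal.Quotient.mk I 1) ∈ _ from trivial)
  have h3 : q - 1 ∈ I := by
    rw [← Ideal.Quotient.eq]; exact hq1
  apply hm
  rw [Ideal.eq_top_iff_one]
  have := m.sub_mem hq (hIm h3)
  simpa using this

section
variable {n : ℕ}

/-- exponent vectors lying in the monomial ideal -/
def auxN (L : Set (Finset (Fin n))) (e : Fin n →₀ ℕ) : Prop := ∃ F ∈ L, ∀ i ∈ F, e i ≠ 0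

lemma auxN_mono {L : Set (Finset (Fin n))} {e e' : Fin n →₀ ℕ} (h : ∀ i, e i ≠ 0 → e' i ≠ 0) :
    auxN L e → auxN L e' := fun ⟨F, hF, h1⟩ => ⟨F, hF, fun i hi => h i (h1 i hi)⟩

lemma aux_memI (L : Set (Finset (Fin n))) (p : MvPolynomial (Fin n) k) :
    p ∈ sqIdeal n k L ↔ ∀ e, ¬ auxN L e → coeff e p = 0 := by
  classical
  have h1 : ∀ F : Finset (Fin n), sqMon n k F = monomial (∑ i ∈ F, Finsupp.single i 1) 1 := by
    intro F
    rw [monomial_sum_one]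
    rfl
  have h2 : sqIdeal n k L = Ideal.span ((fun s => monomial s (1 : k)) ''
      ((fun F : Finset (Fin n) => ∑ i ∈ F, Finsupp.single i 1) '' L)) := by
    rw [Set.image_image]
    unfold sqIdeal
    simp only [h1]
  rw [h2, mem_ideal_span_monomial_image]
  have h3 : ∀ (F : Finset (Fin n)) (e : Fin n →₀ ℕ),
      (∑ i ∈ F, Finsupp.single i 1 ≤ e) ↔ ∀ i ∈ F, e i ≠ 0 := by
    intro F e
    rw [Finsupp.le_def]
    have h4 : ∀ i, (∑ j ∈ F, Finsupp.single j 1 : Fin n →₀ ℕ) i = if i ∈ F then 1 else 0 := by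
      intro i
      simp [Finsupp.finsetSum_apply, Finsupp.single_apply]
    constructor
    · intro h i hi
      have := h i
      rw [h4, if_pos hi] at this
      omega
    · intro h i
      rw [h4]
      split_ifs with hi
      · have := h i hi
        omega
      · omega
  constructor
  · intro h e he
    by_contra hc
    obtain ⟨s, ⟨F, hF, rfl⟩, hs⟩ := h e (mem_support_iff.mpr hc)
    exact he ⟨F, hF, (h3 F e).mp hs⟩
  · intro h e he
    by_contra hc
    apply mem_support_iff.mp he
    apply h
    rintro ⟨F, hF, hs⟩
    exact hc ⟨_, ⟨F, hF, rfl⟩, (h3 F e).mpr hs⟩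

lemma auxN_single {L : Set (Finset (Fin n))} (hL : ∀ F ∈ L, F.card = 2) (a : Fin n) (c : ℕ) :
    ¬ auxN L (Finsupp.single a c) := by
  rintro ⟨F, hF, h⟩
  have : F ⊆ {a} := by
    intro i hi
    have := h i hi
    by_contra hia
    rw [Finset.mem_singleton] at hia
    exact this (Finsupp.single_eq_of_ne hia)
  have := Finset.card_le_card this
  rw [hL F hF] at this
  simp at this

lemma auxN_zero {L : Set (Finset (Fin n))} (hL : ∀ F ∈ L, F.card = 2) : ¬ auxN L 0 := by
  rintro ⟨F, hF, h⟩
  have : F = ∅ := by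
    by_contra hne
    obtain ⟨i, hi⟩ := Finset.nonempty_iff_ne_empty.mpr hne
    exact h i hi rfl
  have h2 := hL F hF
  rw [this] at h2
  simp at h2

lemma auxN_pair {L : Set (Finset (Fin n))} (hL : ∀ F ∈ L, F.card = 2) (a b : Fin n)
    (hab : ({a, b} : Finset (Fin n)) ∉ L) :
    ¬ auxN L (Finsupp.single a 1 + Finsupp.single b 1) := by
  rintro ⟨F, hF, h⟩
  have h1 : F ⊆ {a, b} := by
    intro i hi
    have := h i hi
    by_contra hia
    rw [Finset.mem_insert, Finset.mem_singleton, not_or] at hia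
    apply this
    rw [Finsupp.add_apply, Finsupp.single_eq_of_ne hia.1, Finsupp.single_eq_of_ne hia.2, add_zero]
  have h2 : F = {a, b} := Finset.eq_of_subset_of_card_le h1 (by
    rw [hL F hF]; exact Finset.card_le_two)
  exact hab (h2 ▸ hF)

lemma aux_socle {L : Set (Finset (Fin n))} (hL : ∀ F ∈ L, F.card = 2) (hn : 0 < n)
    (p : MvPolynomial (Fin n) k) (hp : ∀ a, X a * p ∈ sqIdeal n k L) : p ∈ sqIdeal n k L := by
  rw [aux_memI]
  intro e he
  have key : ∃ a, ¬ auxN L (Finsupp.single a 1 + e) := by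
    by_cases h0 : e = 0
    · subst h0
      exact ⟨⟨0, hn⟩, by rw [add_zero]; exact auxN_single hL _ _⟩
    · obtain ⟨a, ha⟩ := Finsupp.ne_iff.mp h0
      refine ⟨a, fun h => he (auxN_mono ?_ h)⟩
      intro i hi
      by_cases hia : i = a
      · subst hia; exact ha
      · rwa [Finsupp.add_apply, Finsupp.single_eq_of_ne hia, zero_add] at hi
  obtain ⟨a, ha⟩ := key
  have := (aux_memI L _).mp (hp a) _ ha
  rwa [coeff_X_mul] at this

lemma aux_hom {L : Set (Finset (Fin n))} (hL : ∀ F ∈ L, F.card = 2) (hn : 2 ≤ n)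
    (hconn : ∀ c : Fin n → k, (∀ a b, a ≠ b → ({a, b} : Finset (Fin n)) ∉ L → c a = c b) →
      ∀ a b, c a = c b)
    (h : Fin n → MvPolynomial (Fin n) k)
    (hh : ∀ a b, X b * h a - X a * h b ∈ sqIdeal n k L) :
    ∃ g, ∀ a, h a - X a * g ∈ sqIdeal n k L := by
  classical
  have E : ∀ a b e, ¬ auxN L e → coeff e (X b * h a) = coeff e (X a * h b) := by
    intro a b e he
    have := (aux_memI L _).mp (hh a b) e he
    rwa [coeff_sub, sub_eq_zero] at this
  have E1 : ∀ a b d, ¬ auxN L (d + Finsupp.single a 1 + Finsupp.single b 1) →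
      coeff (d + Finsupp.single a 1) (h a) = coeff (d + Finsupp.single b 1) (h b) := by
    intro a b d hd
    have h1 := E a b _ hd
    rw [add_comm (d + Finsupp.single a 1), coeff_X_mul] at h1
    rw [h1, show Finsupp.single b 1 + (d + Finsupp.single a 1)
      = Finsupp.single a 1 + (d + Finsupp.single b 1) by abel, coeff_X_mul]
  have E2 : ∀ a b c, c a = 0 → b ≠ a → ¬ auxN L (Finsupp.single b 1 + c) →
      coeff c (h a) = 0 := by
    intro a b c hca hba hc
    have h1 := E a b _ hc
    rw [coeff_X_mul, coeff_X_mul', if_neg] at h1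
    · exact h1
    · rw [Finsupp.mem_support_iff, Finsupp.add_apply, Finsupp.single_eq_of_ne hba.symm, hca]
      simp
  let z : Fin n := ⟨0, by omega⟩
  let t : (Fin n →₀ ℕ) → Fin n := fun d => if hd : ∃ a, d a ≠ 0 then hd.choose else z
  let H : (Fin n →₀ ℕ) → k := fun d => coeff (d + Finsupp.single (t d) 1) (h (t d))
  have habs : ∀ (d : Fin n →₀ ℕ) a b, d a ≠ 0 → ¬ auxN L (d + Finsupp.single b 1) →
      ¬ auxN L (d + Finsupp.single a 1 + Finsupp.single b 1) := by
    intro d a b ha hd hN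
    refine hd (auxN_mono ?_ hN)
    intro i hi
    by_cases hia : i = a
    · subst hia
      rw [Finsupp.add_apply]
      omega
    · rw [Finsupp.add_apply, Finsupp.add_apply, Finsupp.single_eq_of_ne hia, add_zero] at hi
      rwa [Finsupp.add_apply]
  have claim : ∀ d a, ¬ auxN L (d + Finsupp.single a 1) →
      H d = coeff (d + Finsupp.single a 1) (h a) := by
    intro d a hd
    by_cases h0 : ∃ a, d a ≠ 0
    · have ht : d (t d) ≠ 0 := by
        simp only [t]
        rw [dif_pos h0]
        exact h0.choose_spec
      exact E1 _ _ _ (habs d (t d) a ht hd)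
    · have h0' : d = 0 := by
        push Not at h0
        exact Finsupp.ext h0
      subst h0'
      simp only [H, zero_add]
      refine hconn (fun a => coeff (Finsupp.single a 1) (h a)) ?_ _ _
      intro a b _ hab
      have := E1 a b 0 (by rw [zero_add]; exact auxN_pair hL a b hab)
      simpa using this
  let T : Finset (Fin n →₀ ℕ) :=
    Finset.univ.biUnion fun a => (h a).support.image (fun e => e - Finsupp.single a 1)
  have hT : ∀ d, d ∉ T → H d = 0 := by
    intro d hd
    by_contra hne
    apply hd
    simp only [T, Finset.mem_biUnion, Finset.mem_image]
    exact ⟨t d, Finset.mem_univ _, d + Finsupp.single (t d) 1, mem_support_iff.mpr hne, by simp⟩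
  refine ⟨∑ d ∈ T, monomial d (H d), fun a => ?_⟩
  have hg : ∀ d, coeff d (∑ d ∈ T, monomial d (H d)) = H d := by
    intro d
    rw [coeff_sum]
    simp only [coeff_monomial]
    rw [Finset.sum_ite_eq']
    split_ifs with hd
    · rfl
    · exact (hT d hd).symm
  rw [aux_memI]
  intro e he
  rw [coeff_sub, sub_eq_zero, coeff_X_mul']
  split_ifs with hea
  · rw [hg]
    have hde : e - Finsupp.single a 1 + Finsupp.single a 1 = e := by
      apply tsub_add_cancel_of_le
      rw [Finsupp.single_le_iff]
      have := Finsupp.mem_support_iff.mp hea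
      omega
    rw [claim _ a (by rw [hde]; exact he), hde]
  · rw [Finsupp.notMem_support_iff] at hea
    by_cases h0 : ∃ b, e b ≠ 0
    · obtain ⟨b, hb⟩ := h0
      refine E2 a b e hea (by rintro rfl; exact hb hea) ?_
      intro hN
      refine he (auxN_mono ?_ hN)
      intro i hi
      by_cases hib : i = b
      · subst hib; exact hb
      · rwa [Finsupp.add_apply, Finsupp.single_eq_of_ne hib, zero_add] at hi
    · have h0' : e = 0 := by
        push Not at h0
        exact Finsupp.ext h0
      subst h0'
      obtain ⟨b, hb⟩ : ∃ b : Fin n, b ≠ a := by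
        have : Nontrivial (Fin n) := Fin.nontrivial_iff_two_le.mpr hn
        exact exists_ne a
      exact E2 a b 0 hea hb (by rw [add_zero]; exact auxN_single hL _ _)

/-- the maximal ideal -/
noncomputable abbrev auxm (n : ℕ) (k : Type*) [Field k] : Ideal (MvPolynomial (Fin n) k) :=
  Ideal.span (Set.range (X : Fin n → MvPolynomial (Fin n) k))

lemma auxm_ne_top : auxm n k ≠ ⊤ := by
  intro h
  have h1 : auxm n k ≤ RingHom.ker (constantCoeff : MvPolynomial (Fin n) k →+* k) := by
    rw [Ideal.span_le]
    rintro _ ⟨i, rfl⟩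
    simp [RingHom.mem_ker]
  rw [h] at h1
  have := h1 (show (1 : MvPolynomial (Fin n) k) ∈ _ from trivial)
  simp [RingHom.mem_ker] at this

lemma aux_I_le {L : Set (Finset (Fin n))} (hL : ∀ F ∈ L, F.card = 2) :
    sqIdeal n k L ≤ auxm n k := by
  rw [sqIdeal, Ideal.span_le]
  rintro _ ⟨F, hF, rfl⟩
  have : F.Nonempty := by
    rw [← Finset.card_pos, hL F hF]; norm_num
  obtain ⟨i, hi⟩ := this
  exact Ideal.mem_of_dvd _ (Finset.dvd_prod_of_mem (fun i => (X i : MvPolynomial (Fin n) k)) hi)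
    (Ideal.subset_span ⟨i, rfl⟩)

lemma aux_ex_first {L : Set (Finset (Fin n))} (hL : ∀ F ∈ L, F.card = 2) (hn : 0 < n) :
    ∃ f ∈ auxm n k, ∀ p, f * p ∈ sqIdeal n k L → p ∈ sqIdeal n k L := by
  obtain ⟨f, hf, hreg⟩ := aux_exists_reg (M := MvPolynomial (Fin n) k ⧸ sqIdeal n k L)
    (auxm n k) (by
      intro x hx
      obtain ⟨p, rfl⟩ := Ideal.Quotient.mk_surjective x
      rw [Ideal.Quotient.eq_zero_iff_mem]
      apply aux_socle hL hn
      intro a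
      rw [← Ideal.Quotient.eq_zero_iff_mem]
      exact hx (X a) (Ideal.subset_span ⟨a, rfl⟩))
  exact ⟨f, hf, (aux_reg_one _ _).mp hreg⟩

lemma aux_ex_second {L : Set (Finset (Fin n))} (hL : ∀ F ∈ L, F.card = 2) (hn : 2 ≤ n)
    (hconn : ∀ c : Fin n → k, (∀ a b, a ≠ b → ({a, b} : Finset (Fin n)) ∉ L → c a = c b) →
      ∀ a b, c a = c b) (f : MvPolynomial (Fin n) k)
    (hf : ∀ p, f * p ∈ sqIdeal n k L → p ∈ sqIdeal n k L) :
    ∃ g ∈ auxm n k, IsSMulRegular (QuotSMulTop f (MvPolynomial (Fin n) k ⧸ sqIdeal n k L)) g := by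
  apply aux_exists_reg
  intro x hx
  obtain ⟨y, rfl⟩ := Submodule.mkQ_surjective _ x
  obtain ⟨p, rfl⟩ := Ideal.Quotient.mk_surjective y
  have h1 : ∀ a, ∃ h, X a * p - f * h ∈ sqIdeal n k L := by
    intro a
    rw [← aux_mem_smul_top]
    have := hx (X a) (Ideal.subset_span ⟨a, rfl⟩)
    rw [← map_smul, Submodule.mkQ_apply, Submodule.Quotient.mk_eq_zero] at this
    exact this
  choose h hh using h1
  obtain ⟨g, hg⟩ := aux_hom hL hn hconn h (by
    intro a b
    apply hf
    have := (sqIdeal n k L).sub_mem ((sqIdeal n k L).mul_mem_left (X a) (hh b))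
      ((sqIdeal n k L).mul_mem_left (X b) (hh a))
    convert this using 1
    ring)
  rw [Submodule.mkQ_apply, Submodule.Quotient.mk_eq_zero]
  rw [aux_mem_smul_top]
  refine ⟨g, aux_socle hL (by omega) _ fun a => ?_⟩
  have := (sqIdeal n k L).add_mem (hh a) ((sqIdeal n k L).mul_mem_left f (hg a))
  convert this using 1
  ring

lemma aux_conn {L : Set (Finset (Fin n))} (hL : ∀ F ∈ L, F.card = 2) (hn : 2 ≤ n)
    (hconn : ∀ c : Fin n → k, (∀ a b, a ≠ b → ({a, b} : Finset (Fin n)) ∉ L → c a = c b) →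
      ∀ a b, c a = c b) : depthQ (sqIdeal n k L) ≠ 1 := by
  obtain ⟨f, hfm, hf⟩ := aux_ex_first (k := k) hL (by omega)
  obtain ⟨g, hgm, hg⟩ := aux_ex_second hL hn hconn f hf
  have hmem : ∀ x ∈ [f, g], x ∈ auxm n k := by
    intro x hx
    simp only [List.mem_cons, List.not_mem_nil, or_false] at hx
    rcases hx with rfl | rfl <;> assumption
  have hreg : IsRegular (MvPolynomial (Fin n) k ⧸ sqIdeal n k L) [f, g] := by
    refine ⟨?_, aux_top_ne _ _ (aux_I_le hL) auxm_ne_top _ hmem⟩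
    exact IsWeaklyRegular.cons ((aux_reg_one _ _).mpr hf)
      (IsWeaklyRegular.cons hg (IsWeaklyRegular.nil _ _))
  intro h1
  unfold depthQ at h1
  have h2 : 2 ∈ {r | ∃ rs : List (MvPolynomial (Fin n) k), rs.length = r ∧
    (∀ x ∈ rs, x ∈ Ideal.span (Set.range (X : Fin n → MvPolynomial (Fin n) k))) ∧
    RingTheory.Sequence.IsRegular (MvPolynomial (Fin n) k ⧸ sqIdeal n k L) rs} :=
    ⟨[f, g], rfl, hmem, hreg⟩
  by_cases hb : BddAbove {r | ∃ rs : List (MvPolynomial (Fin n) k), rs.length = r ∧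
    (∀ x ∈ rs, x ∈ Ideal.span (Set.range (X : Fin n → MvPolynomial (Fin n) k))) ∧
    RingTheory.Sequence.IsRegular (MvPolynomial (Fin n) k ⧸ sqIdeal n k L) rs}
  · have := le_csSup hb h2
    omega
  · rw [Nat.sSup_of_not_bddAbove hb] at h1
    omega

lemma aux_disc {L : Set (Finset (Fin n))} (hL : ∀ F ∈ L, F.card = 2)
    (A : Set (Fin n)) (hAB : ∀ a ∈ A, ∀ b ∉ A, ({a, b} : Finset (Fin n)) ∈ L)
    (a₀ b₀ : Fin n) (ha₀ : a₀ ∈ A) (hb₀ : b₀ ∉ A) : depthQ (sqIdeal n k L) = 1 := by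
  set I := sqIdeal n k L with hI
  obtain ⟨f, hfm, hf⟩ := aux_ex_first (k := k) hL (by have := a₀.2; omega)
  have hmem1 : ∀ x ∈ [f], x ∈ auxm n k := by
    intro x hx
    rw [List.mem_singleton] at hx
    exact hx ▸ hfm
  have hreg : IsRegular (MvPolynomial (Fin n) k ⧸ I) [f] := by
    refine ⟨?_, aux_top_ne _ _ (aux_I_le hL) auxm_ne_top _ hmem1⟩
    exact IsWeaklyRegular.cons ((aux_reg_one _ _).mpr hf) (IsWeaklyRegular.nil _ _)
  let P : Ideal (MvPolynomial (Fin n) k) := Ideal.span (X '' A)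
  let Q : Ideal (MvPolynomial (Fin n) k) := Ideal.span (X '' Aᶜ)
  have hPQ : P * Q ≤ I := by
    rw [Ideal.span_mul_span', Ideal.span_le]
    rintro _ ⟨_, ⟨a, ha, rfl⟩, _, ⟨b, hb, rfl⟩, rfl⟩
    have hab : a ≠ b := by rintro rfl; exact hb ha
    have : sqMon n k {a, b} ∈ I := Ideal.subset_span ⟨_, hAB a ha b hb, rfl⟩
    rw [sqMon, Finset.prod_pair hab] at this
    exact this
  have hm : auxm n k ≤ P ⊔ Q := by
    rw [Ideal.span_le]
    rintro _ ⟨i, rfl⟩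
    by_cases hi : i ∈ A
    · exact Ideal.mem_sup_left (Ideal.subset_span ⟨i, hi, rfl⟩)
    · exact Ideal.mem_sup_right (Ideal.subset_span ⟨i, hi, rfl⟩)
  have hup : ∀ r ∈ {r | ∃ rs : List (MvPolynomial (Fin n) k), rs.length = r ∧
    (∀ x ∈ rs, x ∈ Ideal.span (Set.range (X : Fin n → MvPolynomial (Fin n) k))) ∧
    RingTheory.Sequence.IsRegular (MvPolynomial (Fin n) k ⧸ I) rs}, r ≤ 1 := by
    rintro r ⟨rs, rfl, hrs, hR⟩
    by_contra hlen
    match rs, hrs, hR, hlen with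
    | [], _, _, hlen => simp at hlen
    | [_], _, _, hlen => simp at hlen
    | f :: g :: rs, hrs, hR, _ =>
      have hw := hR.toIsWeaklyRegular
      rw [isWeaklyRegular_cons_iff, isWeaklyRegular_cons_iff] at hw
      have hf := (aux_reg_one _ _).mp hw.1
      have hg := (aux_reg_two _ _ _).mp hw.2.1
      obtain ⟨p, hp, q, hq, hpq⟩ := Submodule.mem_sup.mp (hm (hrs f (by simp)))
      obtain ⟨p', hp', q', hq', hpq'⟩ := Submodule.mem_sup.mp (hm (hrs g (by simp)))
      obtain ⟨h, hh⟩ := hg p p' (by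
        have h1 := hPQ (Ideal.mul_mem_mul hp hq')
        have h2 := hPQ (Ideal.mul_mem_mul hp' hq)
        have := I.sub_mem h1 h2
        convert this using 1
        rw [← hpq, ← hpq']
        ring)
      have hXa : (X a₀ : MvPolynomial (Fin n) k) ∈ P := Ideal.subset_span ⟨_, ha₀, rfl⟩
      have hXb : (X b₀ : MvPolynomial (Fin n) k) ∈ Q := Ideal.subset_span ⟨_, hb₀, rfl⟩
      have k1 : X a₀ * (1 - h) ∈ I := by
        apply hf
        have := I.add_mem (I.mul_mem_left (X a₀) hh) (hPQ (Ideal.mul_mem_mul hXa hq))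
        convert this using 1
        rw [← hpq]
        ring
      have k2 : X b₀ * h ∈ I := by
        apply hf
        have := I.sub_mem (hPQ (Ideal.mul_mem_mul hp hXb)) (I.mul_mem_left (X b₀) hh)
        convert this using 1
        ring
      have c1 := (aux_memI L _).mp k1 (Finsupp.single a₀ 1 + 0)
        (by rw [add_zero]; exact auxN_single hL _ _)
      have c2 := (aux_memI L _).mp k2 (Finsupp.single b₀ 1 + 0)
        (by rw [add_zero]; exact auxN_single hL _ _)
      rw [coeff_X_mul] at c1 c2
      rw [coeff_sub, c2] at c1
      simp at c1
  unfold depthQ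
  apply le_antisymm
  · exact csSup_le ⟨1, [f], rfl, hmem1, hreg⟩ hup
  · exact le_csSup ⟨1, hup⟩ ⟨[f], rfl, hmem1, hreg⟩

/-- Lex order on pairs written with increasing indices. -/
lemma aux_ge_pair (a b c d : Fin n) (hab : a < b) (hcd : c < d) :
    sqGeLex ({a, b} : Finset (Fin n)) {c, d} ↔ a < c ∨ (a = c ∧ b ≤ d) := by
  constructor
  · rintro (h | ⟨x, hx, hx', h⟩)
    · right
      have h1 : a ∈ ({c, d} : Finset (Fin n)) := h ▸ by simp
      have h2 : b ∈ ({c, d} : Finset (Fin n)) := h ▸ by simp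
      have h3 : c ∈ ({a, b} : Finset (Fin n)) := h ▸ by simp
      simp only [Finset.mem_insert, Finset.mem_singleton] at h1 h2 h3
      omega
    · have ha := h a
      have hb := h b
      have hc := h c
      have hd := h d
      simp only [Finset.mem_insert, Finset.mem_singleton] at hx hx' ha hb hc hd
      rcases hx with rfl | rfl <;> grind
  · rintro (h | ⟨rfl, h⟩)
    · right
      refine ⟨a, by simp, ?_, ?_⟩
      · simp only [Finset.mem_insert, Finset.mem_singleton]; omega
      · intro x hx
        simp only [Finset.mem_insert, Finset.mem_singleton]; omega
    · rcases h.eq_or_lt with rfl | h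
      · left; rfl
      · right
        refine ⟨b, by simp, ?_, ?_⟩
        · simp only [Finset.mem_insert, Finset.mem_singleton]; omega
        · intro x hx
          simp only [Finset.mem_insert, Finset.mem_singleton]; omega

lemma aux_mem_seg (z i j r a b : Fin n) (hzi : z < i) (hjr : j < r) (hab : a < b) :
    ({a, b} : Finset (Fin n)) ∈ sqLexSeg 2 ({z, i} : Finset (Fin n)) {j, r} ↔
      (z < a ∨ (z = a ∧ i ≤ b)) ∧ (a < j ∨ (a = j ∧ b ≤ r)) := by
  unfold sqLexSeg
  rw [Set.mem_ofPred_eq, aux_ge_pair _ _ _ _ hzi hab, aux_ge_pair _ _ _ _ hab hjr,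
    Finset.card_pair hab.ne]
  simp

end

/-- let `u = x_1 x_i`, `v = x_j x_r` with `j ≥ 2` be squarefree degree-2
monomials with `u ≥_lex v`, and `I = (L(u,v))` the lexsegment edge ideal.  Then
`depth(S/I) = 1` iff `x_{i-1} x_n ≥_lex v`.  (Variables are 0-indexed: `x_1` is index
`0`, `x_{i-1}` is index `(i : ℕ) - 1` and `x_n` is index `n - 1`; the hypothesis
`0 < (j : ℕ)` encodes `j ≥ 2`.) -/
theorem stmt15 {k : Type*} [Field k] (n : ℕ) (hn : 0 < n) (i j r : Fin n)
    (hi : 0 < (i : ℕ)) (hj : 0 < (j : ℕ)) (hjr : j < r)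
    (huv : sqGeLex ({⟨0, hn⟩, i} : Finset (Fin n)) ({j, r} : Finset (Fin n))) :
    depthQ (sqIdeal n k (sqLexSeg 2 ({⟨0, hn⟩, i} : Finset (Fin n)) {j, r})) = 1
      ↔ sqGeLex ({⟨(i : ℕ) - 1, by omega⟩, ⟨n - 1, by omega⟩} : Finset (Fin n))
          ({j, r} : Finset (Fin n)) := by
  set z : Fin n := ⟨0, hn⟩ with hz
  have hzi : z < i := hi
  have hL : ∀ F ∈ sqLexSeg 2 ({z, i} : Finset (Fin n)) {j, r}, F.card = 2 := fun F hF => hF.1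
  have hlt : (⟨(i : ℕ) - 1, by omega⟩ : Fin n) < ⟨n - 1, by omega⟩ := by
    rw [Fin.mk_lt_mk]; omega
  rw [aux_ge_pair _ _ _ _ hlt hjr]
  have hjr' : (j : ℕ) < r := hjr
  simp only [Fin.lt_def, Fin.le_def, Fin.ext_iff]
  constructor
  · intro hd
    by_contra hc
    refine aux_conn (k := k) hL (by omega) ?_ hd
    intro c hcc
    have hcl : ∀ a b : Fin n, a < b →
        ¬ ((z < a ∨ (z = a ∧ i ≤ b)) ∧ (a < j ∨ (a = j ∧ b ≤ r))) → c a = c b := by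
      intro a b hab h
      exact hcc a b hab.ne (fun hm => h ((aux_mem_seg z i j r a b hzi hjr hab).mp hm))
    let l : Fin n := ⟨n - 1, by omega⟩
    have hl : (l : ℕ) = n - 1 := rfl
    have hz0 : (z : ℕ) = 0 := rfl
    -- small vertices are joined to `z`
    have h1 : ∀ a : Fin n, a < i → c z = c a := by
      intro a ha
      by_cases haz : a = z
      · rw [haz]
      · exact hcl z a (by rw [Fin.lt_def, hz0]; rw [Fin.ext_iff] at haz; omega) (by omega)
    have h2 : ∀ a : Fin n, j < a → c a = c l := by
      intro a ha
      by_cases hal : a = l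
      · rw [hal]
      · exact hcl a l (by rw [Fin.lt_def]; rw [Fin.ext_iff] at hal; omega) (by omega)
    have h3 : c z = c l := by
      by_cases hji : (j : ℕ) + 1 < i
      · have e1 := h1 ⟨j + 1, by omega⟩ (by rw [Fin.lt_def]; exact hji)
        have e2 := h2 ⟨j + 1, by omega⟩ (by rw [Fin.lt_def]; simp)
        rw [e1, e2]
      · have e1 := h1 j (by rw [Fin.lt_def]; omega)
        rw [e1]
        exact hcl j l (by rw [Fin.lt_def]; omega) (by omega)
    have h4 : ∀ a, c a = c z := by
      intro a
      by_cases ha : a < i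
      · exact (h1 a ha).symm
      · rw [h3]
        exact h2 a (by omega)
    intro a b
    rw [h4 a, h4 b]
  · intro hc
    refine aux_disc (k := k) hL {a | a < i} ?_ z i hzi (by simp)
    intro a ha b hb
    simp only [Set.mem_ofPred_eq, not_lt] at ha hb
    rw [aux_mem_seg z i j r a b hzi hjr (by omega)]
    have hz0 : (z : ℕ) = 0 := rfl
    have := b.2
    omega
end

section
/- Let I = (L(u,v)) be a lexsegment edge ideal in S = k[x_1,...,x_n] determined by u = x_1 x_i and v = x_j x_r with j ≥ 2. Then the Castelnuovo–Mumford regularity of I is 3 if i ≥ j + 2 and x_n does not divide v, and is 2 otherwise. -/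
open MvPolynomial

variable {k : Type*} [Field k]

/-- `RegBound I r` holds if the ideal `I` admits a graded free resolution
`... → F_1 → F_0 → I → 0` in which every basis element of the `m`-th free module is
homogeneous of some degree `≤ m + r`.  The infimum of such `r` is the
Castelnuovo–Mumford regularity of `I`. -/
def RegBound {n : ℕ} {k : Type*} [Field k] (I : Ideal (MvPolynomial (Fin n) k))
    (r : ℕ) : Prop :=
  ∃ (ι : ℕ → Type) (_ : ∀ m, Fintype (ι m)) (degf : ∀ m, ι m → ℕ)
    (f : ∀ m, ((ι (m + 1)) →₀ MvPolynomial (Fin n) k) →ₗ[MvPolynomial (Fin n) k]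
      ((ι m) →₀ MvPolynomial (Fin n) k))
    (g : ((ι 0) →₀ MvPolynomial (Fin n) k) →ₗ[MvPolynomial (Fin n) k]
      (MvPolynomial (Fin n) k)),
    LinearMap.range g = I ∧
    (∀ b : ι 0, (g (Finsupp.single b 1)).IsHomogeneous (degf 0 b)) ∧
    (∀ m (b : ι (m + 1)) (c : ι m),
      (f m (Finsupp.single b 1)) c = 0 ∨
        (degf m c ≤ degf (m + 1) b ∧
          ((f m (Finsupp.single b 1)) c).IsHomogeneous (degf (m + 1) b - degf m c))) ∧
    LinearMap.range (f 0) = LinearMap.ker g ∧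
    (∀ m, LinearMap.range (f (m + 1)) = LinearMap.ker (f m)) ∧
    (∀ m (b : ι m), degf m b ≤ m + r)

/-- The Castelnuovo–Mumford regularity of the ideal `I`, as the least `r` such that `I`
has a graded free resolution with all generators of homological degree `m` living in
internal degrees `≤ m + r`. -/
noncomputable def regI {n : ℕ} {k : Type*} [Field k]
    (I : Ideal (MvPolynomial (Fin n) k)) : ℕ :=
  sInf {r | RegBound I r}

namespace RegAux

/-- homogeneous element of degree `d` of a graded free module -/
def HomEl {n : ℕ} {k : Type*} [Field k] {ι : Type} (deg : ι → ℕ) (d : ℕ)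
    (x : ι →₀ MvPolynomial (Fin n) k) : Prop :=
  ∀ c, x c = 0 ∨ (deg c ≤ d ∧ (x c).IsHomogeneous (d - deg c))

/-- projection to the degree `d` part -/
noncomputable def projD {n : ℕ} {k : Type*} [Field k] {ι : Type} (deg : ι → ℕ) (d : ℕ) :
    (ι →₀ MvPolynomial (Fin n) k) →ₗ[k] (ι →₀ MvPolynomial (Fin n) k) :=
  Finsupp.lsum k (fun c => (Finsupp.lsingle c) ∘ₗ
    (if deg c ≤ d then homogeneousComponent (d - deg c) else 0))

section
variable {n : ℕ} {ι κ : Type} (deg : ι → ℕ) (dk : κ → ℕ)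

theorem projD_apply (d : ℕ) (x : ι →₀ MvPolynomial (Fin n) k) (c : ι) :
    projD deg d x c = if deg c ≤ d then homogeneousComponent (d - deg c) (x c) else 0 := by
  classical
  induction x using Finsupp.induction_linear with
  | zero => simp
  | add f g hf hg =>
    rw [map_add, Finsupp.add_apply, hf, hg]
    split_ifs <;> simp
  | single a p =>
    simp only [projD, Finsupp.lsum_apply, Finsupp.sum_single_index, map_zero,
      LinearMap.comp_apply, Finsupp.lsingle_apply, Finsupp.single_apply]
    by_cases h : a = c
    · subst h
      split_ifs <;> simp
    · simp [h]

variable {deg dk}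

theorem projD_homEl (d : ℕ) (x : ι →₀ MvPolynomial (Fin n) k) : HomEl deg d (projD deg d x) := by
  intro c
  rw [projD_apply]
  split_ifs with h
  · exact Or.inr ⟨h, homogeneousComponent_isHomogeneous _ _⟩
  · exact Or.inl rfl

theorem HomEl.projD_eq {d e : ℕ} {x : ι →₀ MvPolynomial (Fin n) k} (hx : HomEl deg e x) :
    projD deg d x = if d = e then x else 0 := by
  ext1 c
  rw [projD_apply]
  rcases hx c with h | ⟨h1, h2⟩
  · rw [h]; split_ifs <;> simp [h]
  · have h2' : x c ∈ homogeneousSubmodule (Fin n) k (e - deg c) := h2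
    split_ifs with h3 h4 h4
    · subst h4; rw [homogeneousComponent_of_mem h2', if_pos rfl]
    · rw [homogeneousComponent_of_mem h2', if_neg (by omega)]; rfl
    · subst h4; exact absurd h1 h3
    · rfl

theorem HomEl.add {d : ℕ} {x y : ι →₀ MvPolynomial (Fin n) k} (hx : HomEl deg d x)
    (hy : HomEl deg d y) : HomEl deg d (x + y) := by
  intro c
  rcases hx c with h | ⟨h1, h2⟩
  · simpa [h] using hy c
  · rcases hy c with h' | ⟨h1', h2'⟩
    · right; simpa [h'] using ⟨h1, h2⟩
    · right; exact ⟨h1, h2.add h2'⟩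

theorem HomEl.smul {d e : ℕ} {x : ι →₀ MvPolynomial (Fin n) k} (hx : HomEl deg d x)
    {p : MvPolynomial (Fin n) k} (hp : p.IsHomogeneous e) : HomEl deg (d + e) (p • x) := by
  intro c
  rcases hx c with h | ⟨h1, h2⟩
  · left; simp [h]
  · right
    refine ⟨by omega, ?_⟩
    have := hp.mul h2
    rw [show d + e - deg c = e + (d - deg c) by omega]
    simpa using this

theorem homEl_single {b : κ} {e : ℕ}
    {p : MvPolynomial (Fin n) k} (hp : p.IsHomogeneous e) :
    HomEl dk (dk b + e) (Finsupp.single b p) := by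
  classical
  intro c
  rw [Finsupp.single_apply]
  split_ifs with h
  · subst h; right; exact ⟨by omega, by simpa using hp⟩
  · left; rfl

/-- homogeneous linear maps -/
def HomMap (dk : κ → ℕ) (deg : ι → ℕ)
    (φ : (κ →₀ MvPolynomial (Fin n) k) →ₗ[MvPolynomial (Fin n) k]
      (ι →₀ MvPolynomial (Fin n) k)) : Prop :=
  ∀ b, HomEl deg (dk b) (φ (Finsupp.single b 1))

theorem HomMap.comm {φ : (κ →₀ MvPolynomial (Fin n) k) →ₗ[MvPolynomial (Fin n) k]
      (ι →₀ MvPolynomial (Fin n) k)} (h : HomMap dk deg φ) (d : ℕ)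
      (x : κ →₀ MvPolynomial (Fin n) k) : φ (projD dk d x) = projD deg d (φ x) := by
  induction x using Finsupp.induction_linear with
  | zero => simp
  | add f g hf hg => simp only [map_add, hf, hg]
  | single b p =>
    induction p using MvPolynomial.induction_on' with
    | monomial m a =>
      have h1 : HomEl dk (dk b + m.degree)
          (Finsupp.single b (monomial m a : MvPolynomial (Fin n) k)) :=
        homEl_single (isHomogeneous_monomial _ rfl)
      have h2 : HomEl deg (dk b + m.degree)
          (φ (Finsupp.single b (monomial m a : MvPolynomial (Fin n) k))) := by
        have : Finsupp.single b (monomial m a : MvPolynomial (Fin n) k)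
          = monomial m a • Finsupp.single b 1 := by simp
        rw [this, map_smul]
        exact (h b).smul (isHomogeneous_monomial _ rfl)
      rw [h1.projD_eq, h2.projD_eq]
      split_ifs <;> simp
    | add p q hp hq => simp only [Finsupp.single_add, map_add, hp, hq]

def GrSub (deg : ι → ℕ) (N : Submodule (MvPolynomial (Fin n) k) (ι →₀ MvPolynomial (Fin n) k)) :
    Prop := ∀ x ∈ N, ∀ d, projD deg d x ∈ N

theorem HomMap.grSub_ker {φ : (κ →₀ MvPolynomial (Fin n) k) →ₗ[MvPolynomial (Fin n) k]
      (ι →₀ MvPolynomial (Fin n) k)} (h : HomMap dk deg φ) : GrSub dk (LinearMap.ker φ) := by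
  intro x hx d
  rw [LinearMap.mem_ker] at hx ⊢
  rw [h.comm, hx, map_zero]

end

/-- one step of a resolution -/
def RStep {n : ℕ} {k : Type*} [Field k]
    (P : ∀ (ι : Type) (_ : ι → ℕ)
      (_ : Submodule (MvPolynomial (Fin n) k) (ι →₀ MvPolynomial (Fin n) k)) (_ : ℕ), Prop)
    (ι : Type) (deg : ι → ℕ)
    (N : Submodule (MvPolynomial (Fin n) k) (ι →₀ MvPolynomial (Fin n) k)) (r : ℕ) : Prop :=
  ∃ (κ : Type) (_ : Fintype κ) (dk : κ → ℕ)
    (φ : (κ →₀ MvPolynomial (Fin n) k) →ₗ[MvPolynomial (Fin n) k]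
      (ι →₀ MvPolynomial (Fin n) k)),
    LinearMap.range φ = N ∧ HomMap dk deg φ ∧ (∀ b, dk b ≤ r) ∧ P κ dk (LinearMap.ker φ) (r + 1)

/-- regularity bound, coinductively -/
def Reg {n : ℕ} {k : Type*} [Field k] (ι : Type) (deg : ι → ℕ)
    (N : Submodule (MvPolynomial (Fin n) k) (ι →₀ MvPolynomial (Fin n) k)) (r : ℕ) : Prop :=
  ∃ (P : ∀ (ι : Type) (_ : ι → ℕ)
      (_ : Submodule (MvPolynomial (Fin n) k) (ι →₀ MvPolynomial (Fin n) k)) (_ : ℕ), Prop),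
    (∀ ι deg N r, P ι deg N r → RStep P ι deg N r) ∧ P ι deg N r

section
variable {n : ℕ}

theorem RStep.mono {P Q : ∀ (ι : Type) (_ : ι → ℕ)
      (_ : Submodule (MvPolynomial (Fin n) k) (ι →₀ MvPolynomial (Fin n) k)) (_ : ℕ), Prop}
    (h : ∀ ι deg N r, P ι deg N r → Q ι deg N r) {ι deg N r} (hP : RStep P ι deg N r) :
    RStep Q ι deg N r := by
  obtain ⟨κ, i, dk, φ, h1, h2, h3, h4⟩ := hP
  exact ⟨κ, i, dk, φ, h1, h2, h3, h _ _ _ _ h4⟩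

theorem Reg.step {ι : Type} {deg : ι → ℕ}
    {N : Submodule (MvPolynomial (Fin n) k) (ι →₀ MvPolynomial (Fin n) k)} {r : ℕ}
    (h : Reg ι deg N r) : RStep (Reg (n := n) (k := k)) ι deg N r := by
  obtain ⟨P, hP, h0⟩ := h
  exact RStep.mono (fun _ _ _ _ h => ⟨P, hP, h⟩) (hP _ _ _ _ h0)

theorem Reg.of_step {ι : Type} {deg : ι → ℕ}
    {N : Submodule (MvPolynomial (Fin n) k) (ι →₀ MvPolynomial (Fin n) k)} {r : ℕ}
    (h : RStep (Reg (n := n) (k := k)) ι deg N r) : Reg ι deg N r := by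
  refine ⟨RStep (Reg (n := n) (k := k)), ?_, h⟩
  intro ι deg N r h
  exact RStep.mono (fun _ _ _ _ h => h.step) h

theorem Reg.mono {ι : Type} {deg : ι → ℕ}
    {N : Submodule (MvPolynomial (Fin n) k) (ι →₀ MvPolynomial (Fin n) k)} {r s : ℕ}
    (h : Reg ι deg N r) (hrs : r ≤ s) : Reg ι deg N s := by
  refine ⟨fun ι deg N s => ∃ r ≤ s, Reg ι deg N r, ?_, r, hrs, h⟩
  rintro ι deg N s ⟨r, hrs, h⟩
  obtain ⟨κ, i, dk, φ, h1, h2, h3, h4⟩ := h.step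
  exact ⟨κ, i, dk, φ, h1, h2, fun b => (h3 b).trans hrs, r + 1, by omega, h4⟩

theorem Reg.bot {ι : Type} {deg : ι → ℕ} {r : ℕ} : 
    Reg ι deg (⊥ : Submodule (MvPolynomial (Fin n) k) (ι →₀ MvPolynomial (Fin n) k)) r := by
  refine ⟨fun ι deg N r => N = ⊥, ?_, rfl⟩
  rintro ι deg N r rfl
  refine ⟨Empty, inferInstance, fun _ => 0, 0, LinearMap.range_zero, fun b => b.elim,
    fun b => b.elim, ?_⟩
  exact Subsingleton.elim _ _

/-- embedding of the first summand -/
noncomputable def inlM (n : ℕ) (k : Type*) [Field k] (α β : Type) : (α →₀ MvPolynomial (Fin n) k) →ₗ[MvPolynomial (Fin n) k]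
      (α ⊕ β →₀ MvPolynomial (Fin n) k) :=
  (Finsupp.sumFinsuppLEquivProdFinsupp _).symm.toLinearMap ∘ₗ LinearMap.inl _ _ _

noncomputable def fstM (n : ℕ) (k : Type*) [Field k] (α β : Type) : (α ⊕ β →₀ MvPolynomial (Fin n) k) →ₗ[MvPolynomial (Fin n) k]
      (α →₀ MvPolynomial (Fin n) k) :=
  LinearMap.fst _ _ _ ∘ₗ (Finsupp.sumFinsuppLEquivProdFinsupp _).toLinearMap

noncomputable def sndM (n : ℕ) (k : Type*) [Field k] (α β : Type) : (α ⊕ β →₀ MvPolynomial (Fin n) k) →ₗ[MvPolynomial (Fin n) k]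
      (β →₀ MvPolynomial (Fin n) k) :=
  LinearMap.snd _ _ _ ∘ₗ (Finsupp.sumFinsuppLEquivProdFinsupp _).toLinearMap

variable {α β : Type}

@[simp] theorem sndM_apply (x : α ⊕ β →₀ MvPolynomial (Fin n) k) (b : β) :
    sndM n k α β x b = x (Sum.inr b) := rfl

@[simp] theorem fstM_apply (x : α ⊕ β →₀ MvPolynomial (Fin n) k) (b : α) :
    fstM n k α β x b = x (Sum.inl b) := rfl

@[simp] theorem inlM_inl (x : α →₀ MvPolynomial (Fin n) k) (b : α) :
    inlM n k α β x (Sum.inl b) = x b := by simp [inlM]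

@[simp] theorem inlM_inr (x : α →₀ MvPolynomial (Fin n) k) (b : β) :
    inlM n k α β x (Sum.inr b) = 0 := by simp [inlM]

@[simp] theorem fstM_inlM (x : α →₀ MvPolynomial (Fin n) k) :
    fstM n k α β (inlM n k α β x) = x := by ext1; simp
@[simp] theorem sndM_inlM (x : α →₀ MvPolynomial (Fin n) k) :
    sndM n k α β (inlM n k α β x) = 0 := by ext1; simp

theorem eq_inlM {x : α ⊕ β →₀ MvPolynomial (Fin n) k} (h : sndM n k α β x = 0) :
    inlM n k α β (fstM n k α β x) = x := by
  ext1 c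
  rcases c with c | c
  · simp
  · rw [inlM_inr, ← sndM_apply, h]; rfl

inductive HS : ∀ (ι : Type) (_ : ι → ℕ)
      (_ : Submodule (MvPolynomial (Fin n) k) (ι →₀ MvPolynomial (Fin n) k)) (_ : ℕ), Prop
  | mk (α β : Type) (deg : α ⊕ β → ℕ)
      (B : Submodule (MvPolynomial (Fin n) k) (α ⊕ β →₀ MvPolynomial (Fin n) k)) (r : ℕ)
      (hgr : GrSub deg B)
      (h1 : Reg α (fun a => deg (Sum.inl a)) (B.comap (inlM n k α β)) r)
      (h2 : Reg β (fun a => deg (Sum.inr a)) (B.map (sndM n k α β)) r) : HS (α ⊕ β) deg B r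

theorem sndM_projD (deg : α ⊕ β → ℕ) (d : ℕ) (x : α ⊕ β →₀ MvPolynomial (Fin n) k) :
    sndM n k α β (projD deg d x) = projD (fun a => deg (Sum.inr a)) d (sndM n k α β x) := by
  ext1 c
  simp [projD_apply]

theorem horseshoe {ι : Type} {deg : ι → ℕ}
    {N : Submodule (MvPolynomial (Fin n) k) (ι →₀ MvPolynomial (Fin n) k)} {r : ℕ}
    (h : HS ι deg N r) : Reg ι deg N r := by
  refine ⟨HS, ?_, h⟩
  rintro _ _ _ _ ⟨α, β, deg, B, r, hgr, h1, h2⟩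
  obtain ⟨κ, iκ, dκ, φ, f1, f2, f3, f4⟩ := h1.step
  obtain ⟨μ, iμ, dμ, χ, g1, g2, g3, g4⟩ := h2.step
  have hlift : ∀ b : μ, ∃ y ∈ B, sndM n k α β y = χ (Finsupp.single b 1) ∧ HomEl deg (dμ b) y := by
    intro b
    have hb : χ (Finsupp.single b 1) ∈ B.map (sndM n k α β) := by rw [← g1]; exact ⟨_, rfl⟩
    obtain ⟨y, hy, hyb⟩ := hb
    refine ⟨projD deg (dμ b) y, hgr y hy _, ?_, projD_homEl _ _⟩
    rw [sndM_projD, hyb, (g2 b).projD_eq, if_pos rfl]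
  choose y hyB hys hyh using hlift
  let ψ := Finsupp.linearCombination (MvPolynomial (Fin n) k) y
  have hψs : ∀ z, sndM n k α β (ψ z) = χ z := by
    have : sndM n k α β ∘ₗ ψ = χ := by
      ext1 b; ext1
      simp [ψ, hys]
    intro z; rw [← this]; rfl
  have hψB : ∀ z, ψ z ∈ B := by
    intro z
    have : z ∈ (Submodule.comap ψ B) := by
      induction z using Finsupp.induction_linear with
      | zero => exact zero_mem _
      | add f g hf hg => exact add_mem hf hg
      | single b p => 
        simp only [Submodule.mem_comap, ψ, Finsupp.linearCombination_single]
        exact B.smul_mem _ (hyB b)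
    exact this
  let F := (inlM n k α β ∘ₗ φ) ∘ₗ fstM n k κ μ + ψ ∘ₗ sndM n k κ μ
  have hF : ∀ x, F x = inlM n k α β (φ (fstM n k κ μ x)) + ψ (sndM n k κ μ x) := fun x => rfl
  have hφB : ∀ x, inlM n k α β (φ x) ∈ B := by
    intro x
    have : φ x ∈ B.comap (inlM n k α β) := by rw [← f1]; exact ⟨_, rfl⟩
    exact this
  have hsec : ∀ x ∈ B, sndM n k α β x = 0 → ∃ w, inlM n k α β (φ w) = x := by
    intro x hx h0
    have : fstM n k α β x ∈ B.comap (inlM n k α β) := by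
      rw [Submodule.mem_comap, eq_inlM h0]; exact hx
    rw [← f1] at this
    obtain ⟨w, hw⟩ := this
    exact ⟨w, by rw [hw, eq_inlM h0]⟩
  have hmk : ∀ (w : κ →₀ MvPolynomial (Fin n) k) (z : μ →₀ MvPolynomial (Fin n) k),
      ∃ x, fstM n k κ μ x = w ∧ sndM n k κ μ x = z := by
    intro w z
    refine ⟨(Finsupp.sumFinsuppLEquivProdFinsupp (MvPolynomial (Fin n) k)).symm (w, z), ?_, ?_⟩
    · ext1; simp
    · ext1; simp
  have hHom : HomMap (Sum.elim dκ dμ) deg F := by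
    intro b
    rcases b with b | b
    · have e1 : fstM n k κ μ (Finsupp.single (Sum.inl b) 1) = Finsupp.single b 1 := by
        classical
        ext1 c; simp [Finsupp.single_apply]
      have e2 : sndM n k κ μ (Finsupp.single (Sum.inl b) 1) = 0 := by
        classical
        ext1 c; simp
      rw [hF, e1, e2, map_zero, add_zero]
      intro c
      rcases c with c | c
      · simpa using f2 b c
      · left; simp
    · have e1 : fstM n k κ μ (Finsupp.single (Sum.inr b) 1) = 0 := by
        classical
        ext1 c; simp
      have e2 : sndM n k κ μ (Finsupp.single (Sum.inr b) 1) = Finsupp.single b 1 := by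
        classical
        ext1 c; simp [Finsupp.single_apply]
      rw [hF, e1, e2, map_zero, map_zero, zero_add]
      have : ψ (Finsupp.single b 1) = y b := by simp [ψ]
      rw [this]
      exact hyh b
  refine ⟨κ ⊕ μ, inferInstance, Sum.elim dκ dμ, F, ?_, hHom, ?_, HS.mk _ _ _ _ _ hHom.grSub_ker ?_ ?_⟩
  · apply le_antisymm
    · rintro _ ⟨x, rfl⟩
      rw [hF]
      exact add_mem (hφB _) (hψB _)
    · intro x hx
      have : sndM n k α β x ∈ B.map (sndM n k α β) := ⟨x, hx, rfl⟩
      rw [← g1] at this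
      obtain ⟨z, hz⟩ := this
      obtain ⟨w, hw⟩ := hsec (x - ψ z) (sub_mem hx (hψB z)) (by rw [map_sub, hψs, hz, sub_self])
      obtain ⟨t, rfl, rfl⟩ := hmk w z
      exact ⟨t, by rw [hF, hw, sub_add_cancel]⟩
  · rintro (b | b)
    · exact f3 b
    · exact g3 b
  · have : (LinearMap.ker F).comap (inlM n k κ μ) = LinearMap.ker φ := by
      ext x
      rw [Submodule.mem_comap, LinearMap.mem_ker, LinearMap.mem_ker, hF, fstM_inlM, sndM_inlM,
        map_zero, add_zero]
      constructor
      · intro h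
        have := congrArg (fstM n k α β) h
        rwa [fstM_inlM, map_zero] at this
      · intro h; rw [h, map_zero]
    rw [this]
    exact f4
  · have : (LinearMap.ker F).map (sndM n k κ μ) = LinearMap.ker χ := by
      apply le_antisymm
      · rintro _ ⟨x, hx, rfl⟩
        have hx : F x = 0 := hx
        rw [hF] at hx
        have := congrArg (sndM n k α β) hx
        rwa [map_add, sndM_inlM, zero_add, hψs, map_zero] at this
      · intro z hz
        have hz : χ z = 0 := hz
        obtain ⟨w, hw⟩ := hsec (ψ z) (hψB z) (by rw [hψs, hz])
        obtain ⟨t, ht, rfl⟩ := hmk (-w) z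
        refine ⟨t, ?_, rfl⟩
        change F t = 0
        rw [hF, ht, map_neg, map_neg, hw, neg_add_cancel]
    rw [this]
    exact g4

end

section
variable {n : ℕ}

/-- regularity bound of an ideal, with the generator of the ring placed in degree `e` -/
def RegId {n : ℕ} {k : Type*} [Field k] (e : ℕ) (J : Ideal (MvPolynomial (Fin n) k)) (r : ℕ) :
    Prop :=
  Reg Unit (fun _ => e) (Submodule.comap (Finsupp.lapply ()) J) r

/-- state of the construction of a resolution -/
structure St (n : ℕ) (k : Type*) [Field k] where
  ι : Type
  deg : ι → ℕ
  N : Submodule (MvPolynomial (Fin n) k) (ι →₀ MvPolynomial (Fin n) k)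
  r : ℕ
  h : Reg ι deg N r
  fin : Fintype ι

theorem St.exists_next (s : St n k) : ∃ (t : St n k)
    (φ : (t.ι →₀ MvPolynomial (Fin n) k) →ₗ[MvPolynomial (Fin n) k]
      (s.ι →₀ MvPolynomial (Fin n) k)), LinearMap.range φ = s.N ∧ HomMap t.deg s.deg φ ∧
      (∀ b, t.deg b ≤ s.r) ∧ t.N = LinearMap.ker φ ∧ t.r = s.r + 1 := by
  obtain ⟨κ, i, dk, φ, h1, h2, h3, h4⟩ := s.h.step
  exact ⟨⟨κ, dk, LinearMap.ker φ, s.r + 1, h4, i⟩, φ, h1, h2, h3, rfl, rfl⟩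

noncomputable def St.next (s : St n k) : St n k := s.exists_next.choose
noncomputable def St.phi (s : St n k) : (s.next.ι →₀ MvPolynomial (Fin n) k) →ₗ[MvPolynomial (Fin n) k]
      (s.ι →₀ MvPolynomial (Fin n) k) := s.exists_next.choose_spec.choose
theorem St.spec (s : St n k) : LinearMap.range s.phi = s.N ∧ HomMap s.next.deg s.deg s.phi ∧
      (∀ b, s.next.deg b ≤ s.r) ∧ s.next.N = LinearMap.ker s.phi ∧ s.next.r = s.r + 1 :=
  s.exists_next.choose_spec.choose_spec

noncomputable def stSeq (s : St n k) : ℕ → St n k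
  | 0 => s
  | m + 1 => (stSeq s m).next

theorem stSeq_r (s : St n k) (m : ℕ) : (stSeq s m).r = s.r + m := by
  induction m with
  | zero => rfl
  | succ m ih => 
    have := (stSeq s m).spec.2.2.2.2
    change (stSeq s m).next.r = _
    omega

theorem lapply_inj (x : Unit →₀ MvPolynomial (Fin n) k) :
    (Finsupp.lapply () : (Unit →₀ MvPolynomial (Fin n) k) →ₗ[MvPolynomial (Fin n) k] _) x = 0
      ↔ x = 0 := by
  constructor
  · intro h; ext1; exact h
  · rintro rfl; simp

theorem RegId.regBound {J : Ideal (MvPolynomial (Fin n) k)} {r : ℕ} (h : RegId 0 J r) :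
    RegBound J r := by
  obtain ⟨κ, iκ, dκ, φ, f1, f2, f3, f4⟩ := Reg.step h
  let s : St n k := ⟨κ, dκ, LinearMap.ker φ, r + 1, f4, iκ⟩
  refine ⟨fun m => (stSeq s m).ι, fun m => (stSeq s m).fin, fun m => (stSeq s m).deg,
    fun m => (stSeq s m).phi, (Finsupp.lapply () ∘ₗ φ :
      (κ →₀ MvPolynomial (Fin n) k) →ₗ[MvPolynomial (Fin n) k] (MvPolynomial (Fin n) k)),
      ?_, ?_, ?_, ?_, ?_, ?_⟩
  · have : LinearMap.range (Finsupp.lapply () ∘ₗ φ) = J := by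
      rw [LinearMap.range_comp, f1]
      apply Submodule.map_comap_eq_of_surjective
      intro p
      exact ⟨Finsupp.single () p, by simp⟩
    exact this
  · intro b
    rcases f2 b () with h | ⟨_, h⟩
    · change (φ (Finsupp.single b 1) ()).IsHomogeneous _
      rw [h]; exact isHomogeneous_zero _ _ _
    · exact h
  · intro m b c
    exact (stSeq s m).spec.2.1 b c
  · have e1 : LinearMap.range (stSeq s 0).phi = LinearMap.ker φ := (stSeq s 0).spec.1
    have e2 : LinearMap.ker (Finsupp.lapply () ∘ₗ φ) = LinearMap.ker φ := by
      ext x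
      simp only [LinearMap.mem_ker, LinearMap.comp_apply, lapply_inj]
    exact e1.trans e2.symm
  · intro m
    exact (stSeq s (m + 1)).spec.1.trans (stSeq s m).spec.2.2.2.1
  · intro m b
    cases m with
    | zero => 
      have := f3 b
      change dκ b ≤ _
      omega
    | succ m =>
      have := (stSeq s m).spec.2.2.1 b
      rw [stSeq_r] at this
      change (stSeq s m).next.deg b ≤ _
      change _ ≤ r + 1 + m at this
      omega

theorem RegId.bot (e r : ℕ) : RegId e (⊥ : Ideal (MvPolynomial (Fin n) k)) r := by
  have : Submodule.comap (Finsupp.lapply () :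
      (Unit →₀ MvPolynomial (Fin n) k) →ₗ[MvPolynomial (Fin n) k] _) ⊥ = ⊥ := by
    ext x
    simp only [Submodule.mem_comap, Submodule.mem_bot, lapply_inj]
  unfold RegId
  rw [this]
  exact Reg.bot

theorem RegId.cone {I J : Ideal (MvPolynomial (Fin n) k)} {f : MvPolynomial (Fin n) k}
    {e d R : ℕ} (hI : RegId e I R) (hf : f.IsHomogeneous d) (hJ : ∀ h, h ∈ J ↔ h * f ∈ I)
    (hR : e + d ≤ R) (hJR : RegId (e + d) J (R + 1)) : RegId e (I ⊔ Ideal.span {f}) R := by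
  obtain ⟨κ, iκ, dκ, φ, f1, f2, f3, f4⟩ := Reg.step hI
  let F := φ ∘ₗ fstM n k κ Unit + (LinearMap.toSpanSingleton _ _ (Finsupp.single () f)) ∘ₗ
    (Finsupp.lapply () : (Unit →₀ MvPolynomial (Fin n) k) →ₗ[MvPolynomial (Fin n) k] _) ∘ₗ sndM n k κ Unit
  have hF : ∀ x, F x = φ (fstM n k κ Unit x) + Finsupp.single () (x (Sum.inr ()) * f) := by
    intro x
    simp [F]
  have hmk : ∀ (w : κ →₀ MvPolynomial (Fin n) k) (z : Unit →₀ MvPolynomial (Fin n) k),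
      ∃ x, fstM n k κ Unit x = w ∧ sndM n k κ Unit x = z := by
    intro w z
    refine ⟨(Finsupp.sumFinsuppLEquivProdFinsupp (MvPolynomial (Fin n) k)).symm (w, z), ?_, ?_⟩
    · ext1; simp
    · ext1; simp
  have hφ : ∀ x, φ x () ∈ I := by
    intro x
    have : φ x ∈ LinearMap.range φ := ⟨x, rfl⟩
    rw [f1] at this
    exact this
  have hφ' : ∀ p ∈ I, ∃ x, φ x = Finsupp.single () p := by
    intro p hp
    have : Finsupp.single () p ∈ LinearMap.range φ := by rw [f1]; simpa using hp
    exact this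
  have hHom : HomMap (Sum.elim dκ (fun _ => e + d)) (fun _ => e) F := by
    intro b
    rcases b with b | b
    · have e1 : fstM n k κ Unit (Finsupp.single (Sum.inl b) 1) = Finsupp.single b 1 := by
        classical
        ext1 c; simp [Finsupp.single_apply]
      rw [hF, e1]
      simpa using f2 b
    · have e1 : fstM n k κ Unit (Finsupp.single (Sum.inr b) 1) = 0 := by
        classical
        ext1 c; simp
      rw [hF, e1]
      intro c
      right
      simpa using hf
  apply Reg.of_step
  refine ⟨κ ⊕ Unit, inferInstance, Sum.elim dκ (fun _ => e + d), F, ?_, hHom, ?_,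
    horseshoe (HS.mk _ _ _ _ _ hHom.grSub_ker ?_ ?_)⟩
  · apply le_antisymm
    · rintro _ ⟨x, rfl⟩
      rw [hF, Submodule.mem_comap]
      refine Submodule.add_mem_sup (hφ _) ?_
      simp only [Finsupp.single_eq_same]
      exact Ideal.mul_mem_left _ _ (Ideal.subset_span rfl)
    · intro x hx
      rw [Submodule.mem_comap] at hx
      obtain ⟨p, hp, q, hq, hpq⟩ := Submodule.mem_sup.1 hx
      obtain ⟨w, hw⟩ := hφ' p hp
      obtain ⟨c, rfl⟩ := Ideal.mem_span_singleton'.1 hq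
      obtain ⟨t, ht1, ht2⟩ := hmk w (Finsupp.single () c)
      refine ⟨t, ?_⟩
      rw [hF, ht1, hw, ← sndM_apply, ht2]
      ext1
      simpa using hpq
  · rintro (b | b)
    · exact f3 b
    · exact hR
  · have : (LinearMap.ker F).comap (inlM n k κ Unit) = LinearMap.ker φ := by
      ext x
      rw [Submodule.mem_comap, LinearMap.mem_ker, LinearMap.mem_ker, hF, fstM_inlM, inlM_inr,
        zero_mul, Finsupp.single_zero, add_zero]
    rw [this]
    exact f4
  · have : (LinearMap.ker F).map (sndM n k κ Unit) = Submodule.comap (Finsupp.lapply ()) J := by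
      apply le_antisymm
      · rintro _ ⟨x, hx, rfl⟩
        have hx : F x = 0 := hx
        rw [hF] at hx
        rw [Submodule.mem_comap, hJ]
        have := congrArg (fun z => z ()) hx
        simp only [Finsupp.add_apply, Finsupp.single_eq_same, Finsupp.zero_apply] at this
        have h2 : x (Sum.inr ()) * f = - φ (fstM n k κ Unit x) () := by
          rw [eq_neg_iff_add_eq_zero, add_comm, this]
        simp only [Finsupp.lapply_apply, sndM_apply]
        rw [h2]
        exact I.neg_mem (hφ _)
      · intro z hz
        rw [Submodule.mem_comap, hJ] at hz
        obtain ⟨w, hw⟩ := hφ' _ hz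
        obtain ⟨t, ht, rfl⟩ := hmk (-w) z
        refine ⟨t, ?_, rfl⟩
        change F t = 0
        rw [hF, ht, map_neg, hw]
        simp
    rw [this]
    exact hJR

/-- monomial ideal -/
noncomputable def MI (k : Type*) [Field k] (D : Set (Fin n →₀ ℕ)) : Ideal (MvPolynomial (Fin n) k) :=
  Ideal.span ((fun s => monomial s (1 : k)) '' D)

theorem mem_MI {D : Set (Fin n →₀ ℕ)} {p : MvPolynomial (Fin n) k} :
    p ∈ MI k D ↔ ∀ s, coeff s p ≠ 0 → ∃ x ∈ D, x ≤ s := by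
  rw [MI, mem_ideal_span_monomial_image]
  simp only [mem_support_iff]

theorem MI_insert (m : Fin n →₀ ℕ) (D : Set (Fin n →₀ ℕ)) :
    MI k (insert m D) = MI k D ⊔ Ideal.span {monomial m (1 : k)} := by
  rw [MI, Set.image_insert_eq, Ideal.span_insert, sup_comm, MI]

theorem mem_MI_mul_monomial {D D' : Set (Fin n →₀ ℕ)} {m : Fin n →₀ ℕ}
    (h : ∀ s, (∃ x ∈ D, x ≤ s + m) ↔ ∃ x ∈ D', x ≤ s) (p : MvPolynomial (Fin n) k) :
    p ∈ MI k D' ↔ p * monomial m 1 ∈ MI k D := by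
  rw [mem_MI, mem_MI]
  constructor
  · intro hp s hs
    rw [coeff_mul_monomial'] at hs
    split_ifs at hs with hm
    · rw [mul_one] at hs
      have := (h _).2 (hp _ hs)
      rwa [tsub_add_cancel_of_le hm] at this
    · exact absurd rfl hs
  · intro hp s hs
    rw [← h]
    apply hp
    rwa [coeff_mul_monomial, mul_one]

theorem linq {τ : Type*} [LinearOrder τ] (D0 : Set (Fin n →₀ ℕ)) (T : Finset τ)
    (mon : τ → Fin n →₀ ℕ) (e d R : ℕ) (hd : ∀ t ∈ T, (mon t).degree = d) (hR : e + d ≤ R)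
    (h0 : RegId e (MI k D0) R)
    (hstep : ∀ t ∈ T, ∃ D', RegId (e + d) (MI k D') (R + 1) ∧
      ∀ s, (∃ x ∈ D0 ∪ mon '' {t' | t' ∈ T ∧ t' < t}, x ≤ s + mon t) ↔ ∃ x ∈ D', x ≤ s) :
    RegId e (MI k (D0 ∪ mon '' T)) R := by
  classical
  induction T using Finset.induction_on_max with
  | empty => simpa using h0
  | insert a T hlt ih =>
    have ha : a ∉ T := fun h => lt_irrefl _ (hlt a h)
    have h1 : RegId e (MI k (D0 ∪ mon '' T)) R := by
      apply ih (fun t ht => hd t (Finset.mem_insert_of_mem ht))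
      intro t ht
      obtain ⟨D', h1, h2⟩ := hstep t (Finset.mem_insert_of_mem ht)
      refine ⟨D', h1, ?_⟩
      have : {t' | t' ∈ insert a T ∧ t' < t} = {t' | t' ∈ T ∧ t' < t} := by
        ext t'
        simp only [Finset.mem_insert, Set.mem_ofPred_eq]
        constructor
        · rintro ⟨rfl | h, h'⟩
          · exact absurd (hlt t ht) (not_lt.2 h'.le)
          · exact ⟨h, h'⟩
        · rintro ⟨h, h'⟩; exact ⟨Or.inr h, h'⟩
      rwa [this] at h2
    obtain ⟨D', h2, h3⟩ := hstep a (Finset.mem_insert_self _ _)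
    have : {t' | t' ∈ insert a T ∧ t' < a} = (T : Set τ) := by
      ext t'
      simp only [Finset.mem_insert, Set.mem_ofPred_eq, Finset.mem_coe]
      constructor
      · rintro ⟨rfl | h, h'⟩
        · exact absurd h' (lt_irrefl _)
        · exact h
      · intro h; exact ⟨Or.inr h, hlt _ h⟩
    rw [this] at h3
    have h4 := h1.cone (isHomogeneous_monomial (1 : k) (hd a (Finset.mem_insert_self _ _)))
      (mem_MI_mul_monomial h3) hR h2
    rw [← MI_insert] at h4
    convert h4 using 2
    rw [Finset.coe_insert, Set.image_insert_eq, Set.union_insert]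

theorem MI_empty : MI k (∅ : Set (Fin n →₀ ℕ)) = ⊥ := by simp [MI]

/-- variable exponents -/
noncomputable def vx (a : Fin n) : Fin n →₀ ℕ := Finsupp.single a 1
/-- edge exponents -/
noncomputable def ed (a b : Fin n) : Fin n →₀ ℕ := Finsupp.single a 1 + Finsupp.single b 1

theorem vx_le {a : Fin n} {s : Fin n →₀ ℕ} : vx a ≤ s ↔ s a ≠ 0 := by
  rw [vx, Finsupp.single_le_iff]; omega

theorem ed_le {a b : Fin n} (h : a ≠ b) {s : Fin n →₀ ℕ} : ed a b ≤ s ↔ s a ≠ 0 ∧ s b ≠ 0 := by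
  classical
  constructor
  · intro hs
    have h1 := hs a
    have h2 := hs b
    simp [ed, h, h.symm] at h1 h2
    omega
  · rintro ⟨h1, h2⟩ c
    simp only [ed, Finsupp.add_apply, Finsupp.single_apply]
    split_ifs with h3 h4 h4
    · exact absurd (h3.trans h4.symm) h
    · subst h3; omega
    · subst h4; omega
    · omega

theorem add_vx {a c : Fin n} {s : Fin n →₀ ℕ} : (s + vx a) c ≠ 0 ↔ s c ≠ 0 ∨ c = a := by
  classical
  simp only [vx, Finsupp.add_apply, Finsupp.single_apply]
  split_ifs with h
  · subst h; simp
  · simp [Ne.symm h]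

theorem add_ed {a b c : Fin n} {s : Fin n →₀ ℕ} :
    (s + ed a b) c ≠ 0 ↔ s c ≠ 0 ∨ c = a ∨ c = b := by
  have h0 : s + ed a b = s + vx a + vx b := (add_assoc _ _ _).symm
  rw [h0, add_vx, add_vx, or_assoc]

theorem reg_vars (e : ℕ) (T : Finset (Fin n)) : RegId e (MI k (vx '' (T : Set (Fin n)))) (e + 1) := by
  induction T using Finset.strongInduction generalizing e with
  | _ T ih =>
  have := linq (k := k) (∅ : Set (Fin n →₀ ℕ)) T vx e 1 (e + 1) (fun t _ => by simp [vx]) le_rfl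
    (by rw [MI_empty]; exact RegId.bot _ _) ?_
  · simpa using this
  · intro t ht
    refine ⟨vx '' ((T.filter (· < t) : Finset (Fin n)) : Set (Fin n)), ih _ ?_ _, ?_⟩
    · refine ⟨Finset.filter_subset _ _, fun h => ?_⟩
      have := h ht
      simp at this
    · intro s
      simp only [Set.empty_union, Set.mem_image, Set.mem_ofPred_eq, exists_exists_and_eq_and,
        vx_le, add_vx, Finset.coe_filter]
      constructor
      · rintro ⟨a, ⟨h1, h2⟩, h | h⟩
        · exact ⟨a, ⟨h1, h2⟩, h⟩
        · exact absurd h h2.ne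
      · rintro ⟨a, h1, h2⟩; exact ⟨a, h1, Or.inl h2⟩

end

section
variable {n : ℕ}

theorem coeff_mul_eq_single {h G : MvPolynomial (Fin n) k} {s u v : Fin n →₀ ℕ} (huv : u + v = s)
    (H : ∀ w, w ≤ s → coeff w G ≠ 0 → w = v) :
    coeff s (h * G) = coeff u h * coeff v G := by
  classical
  rw [coeff_mul]
  rw [Finset.sum_eq_single (u, v)]
  · rintro ⟨a, b⟩ hab hne
    rw [Finset.HasAntidiagonal.mem_antidiagonal] at hab
    simp only at hab ⊢
    by_contra hcon
    have hb := right_ne_zero_of_mul hcon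
    have := H b (hab ▸ le_add_self) hb
    subst this
    have : a = u := add_right_cancel (hab.trans huv.symm)
    subst this
    exact hne rfl
  · intro h'
    exact absurd (Finset.HasAntidiagonal.mem_antidiagonal.2 huv) h'

theorem eq_of_le_degree {a b : Fin n →₀ ℕ} (h : a ≤ b) (hd : b.degree ≤ a.degree) : a = b := by
  obtain ⟨c, rfl⟩ := le_iff_exists_add.1 h
  rw [map_add] at hd
  have : c.degree = 0 := by omega
  rw [Finsupp.degree_eq_zero_iff] at this
  rw [this, add_zero]

theorem degree_le {a b : Fin n →₀ ℕ} (h : a ≤ b) : a.degree ≤ b.degree := by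
  obtain ⟨c, rfl⟩ := le_iff_exists_add.1 h
  rw [map_add]; omega

theorem MI_hom_zero {D : Set (Fin n →₀ ℕ)} (hD : ∀ x ∈ D, x.degree = 2)
    {p : MvPolynomial (Fin n) k} (hp : p ∈ MI k D) {d : ℕ} (hd : p.IsHomogeneous d) (h2 : d < 2) :
    p = 0 := by
  by_contra hne
  obtain ⟨s, hs⟩ := MvPolynomial.ne_zero_iff.1 hne
  obtain ⟨x, hx, hxs⟩ := mem_MI.1 hp s hs
  have h1 := degree_le hxs
  have h3 : s.degree = d := by
    by_contra h
    exact hs (hd.coeff_eq_zero h)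
  rw [hD x hx] at h1
  omega

theorem low1 {D : Set (Fin n →₀ ℕ)} (hD : ∀ x ∈ D, x.degree = 2) (hne : D.Nonempty) {r : ℕ}
    (hr : RegBound (MI k D) r) : 2 ≤ r := by
  by_contra hlt
  obtain ⟨ι, _, degf, f, g, h1, h2, _, _, _, h6⟩ := hr
  have hg : g = 0 := by
    apply Finsupp.lhom_ext'
    intro b
    ext1
    have hmem : g (Finsupp.single b 1) ∈ MI k D := by rw [← h1]; exact ⟨_, rfl⟩
    have := h6 0 b
    simpa using MI_hom_zero hD hmem (h2 b) (by omega)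
  rw [hg, LinearMap.range_zero] at h1
  obtain ⟨x, hx⟩ := hne
  have : monomial x (1 : k) ∈ MI k D := Ideal.subset_span ⟨x, hx, rfl⟩
  rw [← h1] at this
  simp at this

theorem low2 {D : Set (Fin n →₀ ℕ)} (hD : ∀ x ∈ D, x.degree = 2) {e : Fin n →₀ ℕ} {x y : Fin n}
    (he : e ∈ D) (he' : ed x y ∈ D) (hxy : x ≠ y) (hne : e ≠ ed x y)
    (hx : ∀ z ∈ D, z ≤ e + vx x → z = e) (hy : ∀ z ∈ D, z ≤ e + vx y → z = e) :
    ¬ RegBound (MI k D) 2 := by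
  rintro ⟨ι, _, degf, f, g, h1, h2, h3, h4, _, h6⟩
  have hmem : ∀ z, g z ∈ MI k D := by intro z; rw [← h1]; exact ⟨_, rfl⟩
  have hdeg : ∀ c, g (Finsupp.single c 1) ≠ 0 → degf 0 c = 2 := by
    intro c hc
    by_contra h
    have := h6 0 c
    exact hc (MI_hom_zero hD (hmem _) (h2 c) (by omega))
  have hgs : ∀ c h, g (Finsupp.single c h) = h * g (Finsupp.single c 1) := by
    intro c h
    rw [← smul_eq_mul, ← map_smul, Finsupp.smul_single, smul_eq_mul, mul_one]
  let α : (ι 0 →₀ MvPolynomial (Fin n) k) →ₗ[MvPolynomial (Fin n) k] MvPolynomial (Fin n) k :=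
    Finsupp.linearCombination _ (fun c => C (coeff e (g (Finsupp.single c 1))))
  have hα : ∀ c h, α (Finsupp.single c h) = h * C (coeff e (g (Finsupp.single c 1))) := by
    intro c h; simp [α]
  have hsupp : ∀ c w, coeff w (g (Finsupp.single c 1)) ≠ 0 → w ∈ D := by
    intro c w hw
    have h0 : g (Finsupp.single c 1) ≠ 0 := by
      intro h; rw [h] at hw; simp at hw
    have hd := h2 c
    rw [hdeg c h0] at hd
    have hwd : w.degree = 2 := by
      by_contra h
      exact hw (hd.coeff_eq_zero h)
    obtain ⟨z, hz, hzw⟩ := mem_MI.1 (hmem _) w hw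
    rw [← eq_of_le_degree hzw (by rw [hwd, hD z hz])]
    exact hz
  have key : ∀ u, (∀ z ∈ D, z ≤ e + u → z = e) → ∀ z, coeff u (α z) = coeff (e + u) (g z) := by
    intro u hu z
    induction z using Finsupp.induction_linear with
    | zero => simp
    | add a b ha hb => simp only [map_add, coeff_add, ha, hb]
    | single c h =>
      have e1 : coeff u (α (Finsupp.single c h)) =
          coeff u h * coeff e (g (Finsupp.single c 1)) := by
        rw [hα, mul_comm h (C _), coeff_C_mul, mul_comm]
      rw [e1, hgs c h, coeff_mul_eq_single (add_comm u e)]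
      intro w hw hw'
      exact hu w (hsupp c w hw') hw
  have key0 : ∀ z, coeff 0 (α z) = coeff e (g z) := by
    intro z
    have := key 0 (fun z hz hze => by
      rw [add_zero] at hze
      exact eq_of_le_degree hze (by rw [hD z hz, hD e he])) z
    rwa [add_zero] at this
  have hker : ∀ Y, g (f 0 Y) = 0 := by
    intro Y
    have : f 0 Y ∈ LinearMap.ker g := by rw [← h4]; exact ⟨_, rfl⟩
    exact this
  have hbig : ∀ b, coeff (ed x y) (α (f 0 (Finsupp.single b 1))) = 0 := by
    intro b
    simp only [α]
    rw [Finsupp.linearCombination_apply, Finsupp.sum, coeff_sum]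
    apply Finset.sum_eq_zero
    intro c _
    rw [smul_eq_mul, mul_comm _ (C _), coeff_C_mul, mul_comm]
    by_cases h0 : g (Finsupp.single c 1) = 0
    · rw [h0]; simp
    · rcases h3 0 b c with h | ⟨h, h'⟩
      · rw [h]; simp
      · rw [h'.coeff_eq_zero, zero_mul]
        have e1 := hdeg c h0
        have e2 := h6 (0 + 1) b
        have e3 := hD _ he'
        omega
  have hcases : ∀ v, v ≤ ed x y → v = 0 ∨ v = vx x ∨ v = vx y ∨ v = ed x y := by
    intro v hv
    have h0 : ∀ c, c ≠ x → c ≠ y → v c = 0 := by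
      intro c hcx hcy
      have := hv c
      simpa [ed, hcx, hcy, Finsupp.single_apply, hcx.symm, hcy.symm] using this
    have hvx := hv x
    have hvy := hv y
    simp [ed, hxy, hxy.symm] at hvx hvy
    have hext : ∀ w : Fin n →₀ ℕ, (∀ c, c ≠ x → c ≠ y → w c = 0) → w x = v x → w y = v y → v = w := by
      intro w hw hwx hwy
      ext c
      by_cases hcx : c = x
      · rw [hcx, hwx]
      · by_cases hcy : c = y
        · rw [hcy, hwy]
        · rw [h0 c hcx hcy, hw c hcx hcy]
    rcases Nat.le_one_iff_eq_zero_or_eq_one.1 hvx with hx' | hx' <;>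
    rcases Nat.le_one_iff_eq_zero_or_eq_one.1 hvy with hy' | hy'
    · left; apply hext <;> simp [hx', hy']
    · right; right; left
      apply hext <;> simp +contextual [hx', hy', vx, hxy]
    · right; left
      apply hext <;> simp +contextual [hx', hy', vx, hxy, hxy.symm]
    · right; right; right
      apply hext <;> simp +contextual [hx', hy', ed, hxy, hxy.symm]
  have hall : ∀ Y, coeff (ed x y) (α (f 0 Y)) = 0 := by
    intro Y
    induction Y using Finsupp.induction_linear with
    | zero => simp
    | add a b ha hb => simp only [map_add, coeff_add, ha, hb, add_zero]
    | single b h =>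
      classical
      have : Finsupp.single b h = h • Finsupp.single b 1 := by simp
      rw [this, map_smul, map_smul, smul_eq_mul, coeff_mul]
      apply Finset.sum_eq_zero
      rintro ⟨u, v⟩ huv
      rw [Finset.HasAntidiagonal.mem_antidiagonal] at huv
      simp only at huv ⊢
      rcases hcases v (huv ▸ le_add_self) with rfl | rfl | rfl | rfl
      · rw [key0, hker]; simp
      · rw [key _ hx, hker]; simp
      · rw [key _ hy, hker]; simp
      · rw [hbig, mul_zero]
  obtain ⟨E, hE⟩ : monomial e (1 : k) ∈ LinearMap.range g := by
    rw [h1]; exact Ideal.subset_span ⟨e, he, rfl⟩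
  obtain ⟨E', hE'⟩ : monomial (ed x y) (1 : k) ∈ LinearMap.range g := by
    rw [h1]; exact Ideal.subset_span ⟨_, he', rfl⟩
  have hk : monomial (ed x y) (1 : k) • E - monomial e (1 : k) • E' ∈ LinearMap.range (f 0) := by
    rw [h4, LinearMap.mem_ker, map_sub, map_smul, map_smul, hE, hE', smul_eq_mul, smul_eq_mul,
      mul_comm, sub_self]
  obtain ⟨Y, hY⟩ := hk
  have hfin := hall Y
  rw [hY, map_sub, map_smul, map_smul, smul_eq_mul, smul_eq_mul, coeff_sub, coeff_monomial_mul',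
    coeff_monomial_mul', if_pos le_rfl, if_neg, tsub_self, key0, hE] at hfin
  · simp at hfin
  · intro h
    exact hne (eq_of_le_degree h (by rw [hD _ he, hD _ he']))

end

section
variable {n : ℕ}

/-- the edges of the lexsegment avoiding the first vertex -/
def T1 (j r : Fin n) : Finset (Fin n ×ₗ Fin n) :=
  {t | 0 < ((ofLex t).1 : ℕ) ∧ (ofLex t).1 < (ofLex t).2 ∧
    ((ofLex t).1 < j ∨ ((ofLex t).1 = j ∧ (ofLex t).2 ≤ r))}

noncomputable def edP (t : Fin n ×ₗ Fin n) : Fin n →₀ ℕ := ed (ofLex t).1 (ofLex t).2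

/-- edge condition -/
def EC (j r a b : Fin n) : Prop := 0 < (a : ℕ) ∧ a < b ∧ (a < j ∨ (a = j ∧ b ≤ r))

theorem mem_T1 {j r a b : Fin n} : toLex (a, b) ∈ T1 j r ↔ EC j r a b := by
  simp [T1, EC]

theorem degree_ed (a b : Fin n) : (ed a b).degree = 2 := by simp [ed]

theorem exists_edP {j r : Fin n} {Q : Fin n → Fin n → Prop} {s : Fin n →₀ ℕ} :
    (∃ x ∈ edP '' {t | t ∈ T1 j r ∧ Q (ofLex t).1 (ofLex t).2}, x ≤ s) ↔
      ∃ a b, EC j r a b ∧ Q a b ∧ s a ≠ 0 ∧ s b ≠ 0 := by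
  constructor
  · rintro ⟨_, ⟨t, ⟨h1, h2⟩, rfl⟩, h3⟩
    obtain ⟨⟨a, b⟩, rfl⟩ := toLex.surjective t
    have h1 := mem_T1.1 h1
    exact ⟨a, b, h1, h2, (ed_le h1.2.1.ne).1 h3⟩
  · rintro ⟨a, b, h1, h2, h3⟩
    exact ⟨_, ⟨toLex (a, b), ⟨mem_T1.2 h1, h2⟩, rfl⟩, (ed_le h1.2.1.ne).2 h3⟩

theorem exists_edP' {j r : Fin n} {s : Fin n →₀ ℕ} :
    (∃ x ∈ edP '' (T1 j r : Set (Fin n ×ₗ Fin n)), x ≤ s) ↔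
      ∃ a b, EC j r a b ∧ s a ≠ 0 ∧ s b ≠ 0 := by
  have := exists_edP (j := j) (r := r) (Q := fun _ _ => True) (s := s)
  simpa using this

theorem exists_vx {Q : Fin n → Prop} [DecidablePred Q] {s : Fin n →₀ ℕ} :
    (∃ x ∈ vx '' ((Finset.univ.filter Q : Finset (Fin n)) : Set (Fin n)), x ≤ s) ↔
      ∃ c, Q c ∧ s c ≠ 0 := by
  simp [vx_le]

theorem exists_union {A B : Set (Fin n →₀ ℕ)} {s : Fin n →₀ ℕ} :
    (∃ x ∈ A ∪ B, x ≤ s) ↔ (∃ x ∈ A, x ≤ s) ∨ ∃ x ∈ B, x ≤ s := by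
  constructor
  · rintro ⟨x, h | h, h'⟩
    · exact Or.inl ⟨x, h, h'⟩
    · exact Or.inr ⟨x, h, h'⟩
  · rintro (⟨x, h, h'⟩ | ⟨x, h, h'⟩)
    · exact ⟨x, Or.inl h, h'⟩
    · exact ⟨x, Or.inr h, h'⟩

theorem reg_T1 (j r : Fin n) : RegId 0 (MI k (edP '' (T1 j r : Set (Fin n ×ₗ Fin n)))) 2 := by
  classical
  have := linq (k := k) (∅ : Set (Fin n →₀ ℕ)) (T1 j r) edP 0 2 2
    (fun t _ => degree_ed _ _) le_rfl (by rw [MI_empty]; exact RegId.bot _ _) ?_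
  · simpa using this
  · intro t ht
    obtain ⟨⟨a, b⟩, rfl⟩ := toLex.surjective t
    rw [mem_T1] at ht
    refine ⟨_, reg_vars _ (Finset.univ.filter (fun c : Fin n => 0 < (c : ℕ) ∧ c < b ∧ c ≠ a)), ?_⟩
    intro s
    rw [exists_vx, Set.empty_union]
    have e : {t' | t' ∈ T1 j r ∧ t' < toLex (a, b)} =
        {t' | t' ∈ T1 j r ∧ (fun p q => p < a ∨ (p = a ∧ q < b)) (ofLex t').1 (ofLex t').2} := by
      ext t'
      simp only [Set.mem_ofPred_eq, Prod.Lex.lt_iff, ofLex_toLex]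
    rw [e]
    refine (exists_edP (Q := fun p q => p < a ∨ (p = a ∧ q < b))).trans ?_
    obtain ⟨ha0, hab, hj⟩ := ht
    constructor
    · rintro ⟨a', b', ⟨h1, h2, h3⟩, h4, h5, h6⟩
      rw [edP, add_ed] at h5 h6
      simp only [ofLex_toLex] at h5 h6
      rcases h4 with h4 | ⟨rfl, h4⟩
      · refine ⟨a', ⟨h1, by omega, by omega⟩, ?_⟩
        rcases h5 with h5 | h5 | h5
        · exact h5
        · omega
        · omega
      · refine ⟨b', ⟨by omega, by omega, by omega⟩, ?_⟩
        rcases h6 with h6 | h6 | h6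
        · exact h6
        · omega
        · omega
    · rintro ⟨c, ⟨h1, h2, h3⟩, h4⟩
      simp only [edP, add_ed, ofLex_toLex]
      rcases lt_or_gt_of_ne h3 with h | h
      · exact ⟨c, b, ⟨h1, h2, Or.inl (by omega)⟩, Or.inl h, Or.inl h4, by simp⟩
      · exact ⟨a, c, ⟨ha0, h, by omega⟩, Or.inr ⟨rfl, h2⟩, by simp, Or.inl h4⟩

theorem exists_ed_image {j : Fin n} {T : Set (Fin n)} (hT : ∀ c ∈ T, j ≠ c) {s : Fin n →₀ ℕ} :
    (∃ x ∈ ed j '' T, x ≤ s) ↔ ∃ c ∈ T, s j ≠ 0 ∧ s c ≠ 0 := by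
  constructor
  · rintro ⟨_, ⟨c, hc, rfl⟩, h⟩
    exact ⟨c, hc, (ed_le (hT c hc)).1 h⟩
  · rintro ⟨c, hc, h⟩
    exact ⟨_, ⟨c, hc, rfl⟩, (ed_le (hT c hc)).2 h⟩

theorem exists_vx_image {T : Set (Fin n)} {s : Fin n →₀ ℕ} :
    (∃ x ∈ vx '' T, x ≤ s) ↔ ∃ c ∈ T, s c ≠ 0 := by
  simp [vx_le]

theorem reg_star (e : ℕ) (G T : Finset (Fin n)) (j : Fin n) (hjG : j ∉ G) (hjT : j ∉ T)
    (hd : Disjoint G T) :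
    RegId e (MI k (vx '' (G : Set (Fin n)) ∪ ed j '' (T : Set (Fin n)))) (e + 2) := by
  classical
  refine linq (k := k) _ T (ed j) e 2 (e + 2) (fun t _ => degree_ed _ _) le_rfl
    ((reg_vars e G).mono (by omega)) ?_
  intro c hc
  refine ⟨_, reg_vars _ (G ∪ T.filter (· < c)), ?_⟩
  intro s
  rw [exists_union, exists_ed_image, exists_vx_image, exists_vx_image]
  · simp only [add_ed]
    have hcG : c ∉ G := fun h => Finset.disjoint_left.1 hd h hc
    constructor
    · rintro (⟨a, ha, h⟩ | ⟨a, ⟨ha, hac⟩, _, h⟩)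
      · have ha : a ∈ G := ha
        refine ⟨a, by simp [ha], ?_⟩
        rcases h with h | rfl | rfl
        · exact h
        · exact absurd ha hjG
        · exact absurd ha hcG
      · refine ⟨a, by simp [ha, hac], ?_⟩
        rcases h with h | rfl | rfl
        · exact h
        · exact absurd ha hjT
        · exact absurd hac (lt_irrefl _)
    · rintro ⟨a, ha, h⟩
      simp only [Finset.coe_union, Finset.coe_filter, Set.mem_union, Finset.mem_coe,
        Set.mem_ofPred_eq] at ha
      rcases ha with ha | ha
      · exact Or.inl ⟨a, ha, Or.inl h⟩
      · exact Or.inr ⟨a, ha, by simp, Or.inl h⟩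
  · rintro a ⟨ha, _⟩ rfl
    exact hjT ha

/-- the generators -/
noncomputable def DD (z i j r : Fin n) : Set (Fin n →₀ ℕ) :=
  edP '' (T1 j r : Set (Fin n ×ₗ Fin n)) ∪
    ed z '' ((Finset.univ.filter (fun b => i ≤ b) : Finset (Fin n)) : Set (Fin n))

theorem reg_DD (z i j r : Fin n) (hz : (z : ℕ) = 0) (hi : 0 < (i : ℕ)) (hj : 0 < (j : ℕ))
    (hjr : j < r) (R : ℕ) (hR : 2 ≤ R)
    (H : R = 2 → ((i : ℕ) ≤ j + 1 ∨ (r : ℕ) = n - 1)) (H3 : R = 3 ∨ R = 2) :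
    RegId 0 (MI k (DD z i j r)) R := by
  classical
  refine linq (k := k) _ _ (ed z) 0 2 R (fun t _ => degree_ed _ _) (by omega)
    ((reg_T1 j r).mono hR) ?_
  intro b hb
  have hb : i ≤ b := by simpa using hb
  let Q : Fin n → Prop := fun c => 0 < (c : ℕ) ∧
    ((c < b ∧ (c < j ∨ (c = j ∧ b ≤ r))) ∨ (b < c ∧ (b < j ∨ (b = j ∧ c ≤ r))) ∨ (i ≤ c ∧ c < b))
  have hset : {t' | t' ∈ (Finset.univ.filter (fun b => i ≤ b) : Finset (Fin n)) ∧ t' < b} =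
      {t' | i ≤ t' ∧ t' < b} := by ext; simp
  rw [hset]
  by_cases hlin : (i : ℕ) ≤ j + 1 ∨ b ≤ r
  · refine ⟨_, (reg_vars _ (Finset.univ.filter Q)).mono (by omega), ?_⟩
    intro s
    rw [exists_vx, exists_union, exists_edP', exists_ed_image]
    · simp only [add_ed]
      constructor
      · rintro (⟨a, c, ⟨h1, h2, h3⟩, h4, h5⟩ | ⟨c, ⟨h1, h2⟩, _, h⟩)
        · by_cases hab : a = b
          · subst hab
            refine ⟨c, ⟨by omega, by omega⟩, ?_⟩
            rcases h5 with h | h | h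
            · exact h
            · omega
            · omega
          · by_cases hcb : c = b
            · subst hcb
              refine ⟨a, ⟨by omega, by omega⟩, ?_⟩
              rcases h4 with h | h | h
              · exact h
              · omega
              · omega
            · have h4 : s a ≠ 0 := by
                rcases h4 with h | h | h
                · exact h
                · omega
                · omega
              have h5 : s c ≠ 0 := by
                rcases h5 with h | h | h
                · exact h
                · omega
                · omega
              by_cases hQa : Q a
              · exact ⟨a, hQa, h4⟩
              · refine ⟨c, ?_, h5⟩
                simp only [Q] at hQa ⊢
                omega
        · refine ⟨c, ⟨by omega, by omega⟩, ?_⟩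
          rcases h with h | h | h
          · exact h
          · omega
          · omega
      · rintro ⟨c, ⟨h0, h | h | h⟩, hc⟩
        · exact Or.inl ⟨c, b, ⟨h0, h.1, h.2⟩, Or.inl hc, by simp⟩
        · exact Or.inl ⟨b, c, ⟨by omega, h.1, h.2⟩, by simp, Or.inl hc⟩
        · exact Or.inr ⟨c, h, by simp, Or.inl hc⟩
    · rintro c ⟨h1, h2⟩ rfl
      omega
  · have hRR : R = 3 := by
      rcases H3 with h | h
      · exact h
      · have := H h
        have := b.isLt
        omega
    subst hRR
    let T : Finset (Fin n) := Finset.univ.filter (fun c => j < c ∧ c ≤ r ∧ c < i)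
    refine ⟨_, reg_star _ (Finset.univ.filter Q) T j ?_ ?_ ?_, ?_⟩
    · simp only [Finset.mem_filter, Finset.mem_univ, true_and, Q]
      omega
    · simp [T]
    · rw [Finset.disjoint_left]
      simp only [Finset.mem_filter, Finset.mem_univ, true_and, Q, T]
      intro a
      omega
    intro s
    rw [exists_union, exists_union, exists_vx, exists_edP', exists_ed_image, exists_ed_image]
    · simp only [add_ed]
      constructor
      · rintro (⟨a, c, ⟨h1, h2, h3⟩, h4, h5⟩ | ⟨c, ⟨h1, h2⟩, _, h⟩)
        · have hab : a ≠ b := by omega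
          by_cases hcb : c = b
          · subst hcb
            refine Or.inl ⟨a, ⟨by omega, by omega⟩, ?_⟩
            rcases h4 with h | h | h
            · exact h
            · omega
            · omega
          · have h4 : s a ≠ 0 := by
              rcases h4 with h | h | h
              · exact h
              · omega
              · omega
            have h5 : s c ≠ 0 := by
              rcases h5 with h | h | h
              · exact h
              · omega
              · omega
            by_cases hQa : Q a
            · exact Or.inl ⟨a, hQa, h4⟩
            · by_cases hQc : Q c
              · exact Or.inl ⟨c, hQc, h5⟩
              · right
                simp only [Q] at hQa hQc
                have haj : a = j := by omega
                subst haj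
                refine ⟨c, ?_, h4, h5⟩
                simp only [T, Finset.coe_filter, Finset.mem_univ, true_and, Set.mem_ofPred_eq]
                omega
        · refine Or.inl ⟨c, ⟨by omega, by omega⟩, ?_⟩
          rcases h with h | h | h
          · exact h
          · omega
          · omega
      · rintro (⟨c, ⟨h0, h | h | h⟩, hc⟩ | ⟨c, hcT, hj', hc⟩)
        · exact Or.inl ⟨c, b, ⟨h0, h.1, h.2⟩, Or.inl hc, by simp⟩
        · exact Or.inl ⟨b, c, ⟨by omega, h.1, h.2⟩, by simp, Or.inl hc⟩
        · exact Or.inr ⟨c, h, by simp, Or.inl hc⟩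
        · simp only [T, Finset.coe_filter, Finset.mem_univ, true_and, Set.mem_ofPred_eq] at hcT
          exact Or.inl ⟨j, c, ⟨hj, hcT.1, Or.inr ⟨rfl, hcT.2.1⟩⟩, Or.inl hj', Or.inl hc⟩
    · intro c hc
      simp only [T, Finset.coe_filter, Finset.mem_univ, true_and, Set.mem_ofPred_eq] at hc
      omega
    · rintro c ⟨h1, h2⟩ rfl
      omega

theorem degree_DD (z i j r : Fin n) : ∀ x ∈ DD z i j r, x.degree = 2 := by
  rintro _ (⟨t, _, rfl⟩ | ⟨t, _, rfl⟩) <;> exact degree_ed _ _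

theorem low_DD (z i j r : Fin n) (hz : (z : ℕ) = 0) (hj : 0 < (j : ℕ))
    (hjr : j < r) (h1 : (j : ℕ) + 2 ≤ i) (h2 : (r : ℕ) ≠ n - 1) :
    ¬ RegBound (MI k (DD z i j r)) 2 := by
  classical
  have hrn := r.isLt
  have hin := i.isLt
  let m : Fin n := ⟨n - 1, by omega⟩
  let q : Fin n := ⟨j + 1, by omega⟩
  have hm : (m : ℕ) = n - 1 := rfl
  have hq : (q : ℕ) = j + 1 := rfl
  have main : ∀ x : Fin n, x = j ∨ x = q → ∀ w ∈ DD z i j r, w ≤ ed z m + vx x → w = ed z m := by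
    intro x hx w hw hle
    rw [add_comm] at hle
    rcases hw with ⟨t, ht, rfl⟩ | ⟨b, hb, rfl⟩
    · exfalso
      obtain ⟨⟨a, b⟩, rfl⟩ := toLex.surjective t
      obtain ⟨h3, h4, h5⟩ := mem_T1.1 ht
      have hle : ed a b ≤ vx x + ed z m := hle
      rw [ed_le h4.ne, add_ed, add_ed] at hle
      have hv : ∀ c, vx x c ≠ 0 → c = x := by
        intro c hc
        by_contra h
        exact hc (by simp [vx, Finsupp.single_apply, Ne.symm h])
      obtain ⟨ha, hb⟩ := hle
      have ha' : a = x ∨ a = z ∨ a = m := ha.imp_left (hv a)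
      have hb' : b = x ∨ b = z ∨ b = m := hb.imp_left (hv b)
      omega
    · have hb : i ≤ b := by simpa using hb
      rw [ed_le (by omega), add_ed, add_ed] at hle
      have hv : ∀ c, vx x c ≠ 0 → c = x := by
        intro c hc
        by_contra h
        exact hc (by simp [vx, Finsupp.single_apply, Ne.symm h])
      have hb' : b = x ∨ b = z ∨ b = m := hle.2.imp_left (hv b)
      have : b = m := by omega
      rw [this]
  refine low2 (degree_DD z i j r) (e := ed z m) (x := j) (y := q) ?_ ?_ (by omega) ?_
    (main j (Or.inl rfl)) (main q (Or.inr rfl))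
  · right
    refine ⟨m, ?_, rfl⟩
    simp only [Finset.coe_filter, Finset.mem_univ, true_and, Set.mem_ofPred_eq]
    omega
  · left
    refine ⟨toLex (j, q), mem_T1.2 ⟨hj, by omega, Or.inr ⟨rfl, by omega⟩⟩, rfl⟩
  · intro h
    have := DFunLike.congr_fun h z
    have e1 : j ≠ z := by omega
    have e2 : q ≠ z := by omega
    have e3 : m ≠ z := by omega
    simp [ed, e1.symm, e2.symm, e3.symm] at this

theorem sqMon_pair {a b : Fin n} (h : a ≠ b) : sqMon n k {a, b} = monomial (ed a b) 1 := by
  classical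
  rw [sqMon, Finset.prod_pair h, ed, X, X, monomial_mul, one_mul]

theorem geLex_pair {a b c d : Fin n} (hab : a < b) (hcd : c < d) :
    sqGeLex ({a, b} : Finset (Fin n)) {c, d} ↔ a < c ∨ (a = c ∧ b ≤ d) := by
  constructor
  · rintro (h | ⟨x, h1, h2, h3⟩)
    · have e1 : a ∈ ({c, d} : Finset (Fin n)) := by rw [← h]; simp
      have e2 : b ∈ ({c, d} : Finset (Fin n)) := by rw [← h]; simp
      simp only [Finset.mem_insert, Finset.mem_singleton] at e1 e2
      omega
    · have e1 := h3 a
      have e2 := h3 c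
      have e3 := h3 d
      simp only [Finset.mem_insert, Finset.mem_singleton] at h1 h2 e1 e2 e3
      simp only [true_or, or_true, iff_true, true_iff] at e1 e2 e3
      omega
  · rintro (h | ⟨rfl, h⟩)
    · right
      refine ⟨a, by simp, ?_, ?_⟩
      · simp only [Finset.mem_insert, Finset.mem_singleton]; omega
      · intro y hy
        simp only [Finset.mem_insert, Finset.mem_singleton]; omega
    · rcases h.eq_or_lt with rfl | h
      · left; rfl
      · right
        refine ⟨b, by simp, ?_, ?_⟩
        · simp only [Finset.mem_insert, Finset.mem_singleton]; omega
        · intro y hy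
          simp only [Finset.mem_insert, Finset.mem_singleton]; omega

theorem sqIdeal_eq (z i j r : Fin n) (hz : (z : ℕ) = 0) (hi : 0 < (i : ℕ)) (hj : 0 < (j : ℕ))
    (hjr : j < r) : sqIdeal n k (sqLexSeg 2 {z, i} {j, r}) = MI k (DD z i j r) := by
  classical
  have hzi : z < i := by omega
  rw [sqIdeal, MI]
  congr 1
  apply Set.Subset.antisymm
  · rintro _ ⟨w, ⟨hw, h1, h2⟩, rfl⟩
    obtain ⟨a, b, hab, rfl⟩ : ∃ a b, a < b ∧ w = {a, b} := by
      obtain ⟨a, b, hab, rfl⟩ := Finset.card_eq_two.1 hw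
      rcases lt_or_gt_of_ne hab with h | h
      · exact ⟨a, b, h, rfl⟩
      · exact ⟨b, a, h, Finset.pair_comm _ _⟩
    rw [geLex_pair hzi hab] at h1
    rw [geLex_pair hab hjr] at h2
    refine ⟨ed a b, ?_, (sqMon_pair hab.ne).symm⟩
    rcases h1 with h1 | ⟨rfl, h1⟩
    · left
      exact ⟨toLex (a, b), mem_T1.2 ⟨by omega, hab, h2⟩, rfl⟩
    · right
      exact ⟨b, by simpa using h1, rfl⟩
  · rintro _ ⟨_, ⟨t, ht, rfl⟩ | ⟨b, hb, rfl⟩, rfl⟩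
    · obtain ⟨⟨a, b⟩, rfl⟩ := toLex.surjective t
      obtain ⟨h3, h4, h5⟩ := mem_T1.1 ht
      refine ⟨{a, b}, ⟨Finset.card_pair h4.ne, ?_, ?_⟩, sqMon_pair h4.ne⟩
      · rw [geLex_pair hzi h4]; left; omega
      · rw [geLex_pair h4 hjr]; exact h5
    · have hb : i ≤ b := by simpa using hb
      have h4 : z < b := by omega
      refine ⟨{z, b}, ⟨Finset.card_pair h4.ne, ?_, ?_⟩, sqMon_pair h4.ne⟩
      · rw [geLex_pair hzi h4]; right; exact ⟨rfl, hb⟩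
      · rw [geLex_pair h4 hjr]; left; omega

theorem RegBound_mono {I : Ideal (MvPolynomial (Fin n) k)} {r s : ℕ} (h : RegBound I r)
    (hrs : r ≤ s) : RegBound I s := by
  obtain ⟨ι, i, degf, f, g, h1, h2, h3, h4, h5, h6⟩ := h
  exact ⟨ι, i, degf, f, g, h1, h2, h3, h4, h5, fun m b => (h6 m b).trans (by omega)⟩

theorem regI_eq {I : Ideal (MvPolynomial (Fin n) k)} {r : ℕ} (h : RegBound I r)
    (h' : ∀ s, RegBound I s → r ≤ s) : regI I = r :=
  le_antisymm (Nat.sInf_le h) (le_csInf ⟨r, h⟩ h')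

end

end RegAux
open Classical in
/-- let `I = (L(u,v))` be the lexsegment edge ideal determined by
`u = x_1 x_i` and `v = x_j x_r` with `j ≥ 2`.  Then `reg(I) = 3` if `i ≥ j + 2` and
`x_n ∤ v`, and `reg(I) = 2` otherwise.  (Variables are 0-indexed: `x_1` is index `0`,
`x_n` is index `n - 1`; `0 < (j : ℕ)` encodes `j ≥ 2`, and the 1-based condition
`i ≥ j + 2` reads `(j : ℕ) + 2 ≤ (i : ℕ)`.) -/
theorem stmt16 {k : Type*} [Field k] (n : ℕ) (hn : 0 < n) (i j r : Fin n)
    (hi : 0 < (i : ℕ)) (hj : 0 < (j : ℕ)) (hjr : j < r)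
    (huv : sqGeLex ({⟨0, hn⟩, i} : Finset (Fin n)) ({j, r} : Finset (Fin n))) :
    regI (sqIdeal n k (sqLexSeg 2 ({⟨0, hn⟩, i} : Finset (Fin n)) {j, r}))
      = if ((j : ℕ) + 2 ≤ (i : ℕ) ∧ (r : ℕ) ≠ n - 1) then 3 else 2 := by
  rw [RegAux.sqIdeal_eq ⟨0, hn⟩ i j r rfl hi hj hjr]
  have hne : (RegAux.DD ⟨0, hn⟩ i j r).Nonempty :=
    ⟨_, Or.inl ⟨toLex (j, r), RegAux.mem_T1.2 ⟨hj, hjr, Or.inr ⟨rfl, le_rfl⟩⟩, rfl⟩⟩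
  split_ifs with h
  · apply RegAux.regI_eq
    · exact (RegAux.reg_DD _ i j r rfl hi hj hjr 3 (by omega) (by omega) (by omega)).regBound
    · intro s hs
      by_contra hlt
      exact RegAux.low_DD ⟨0, hn⟩ i j r rfl hj hjr h.1 h.2 (RegAux.RegBound_mono hs (by omega))
  · apply RegAux.regI_eq
    · exact (RegAux.reg_DD _ i j r rfl hi hj hjr 2 (by omega) (by omega) (by omega)).regBound
    · intro s hs
      exact RegAux.low1 (RegAux.degree_DD _ i j r) hne hs
end
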